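/- Let H be a finite dimensional quasi-Hopf algebra, (𝔄, ρ, Φ_ρ) a right H-comodule algebra, and M a two-sided (𝔄,H)-Hopf module. Then M becomes a right (H*, 𝔄 #̄ H*)-Hopf module via the left H-action h•m = S²(h)≻m and the right 𝔄#̄H*-action m•(a #̄ φ) = ∑ φ(S⁻¹(S(U¹)f² m(1) a⟨1⟩ p̃²_ρ)) · S(U²)f¹ ≻ m(0) ≺ a⟨0⟩ p̃¹_ρ, where U = ∑U¹⊗U² = ∑g¹S(q²_R)⊗g²S(q¹_R). Moreover every left H-linear, right 𝔄-linear, right H-colinear map between two-sided (𝔄,H)-Hopf modules is a morphism of the corresponding right (H*, 𝔄#̄H*)-Hopf modules, so this defines a functor F: _H M^H_𝔄 → M^{H*}_{𝔄#̄H*} acting as the identity on underlying maps. -/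

import Mathlib

open TensorProduct Finset

noncomputable section

/-- A quasi-bialgebra in the sense of Drinfeld, together with chosen finite
Sweedler-type families representing the comultiplication and the reassociator. -/
structure QuasiBialgebra (k : Type*) [Field k] (H : Type*) [Ring H] [Algebra k H] where
  comul : H →ₐ[k] H ⊗[k] H
  counit : H →ₐ[k] k
  nD : ℕ
  D1 : H → ℕ → H
  D2 : H → ℕ → H
  hcomul : ∀ h, comul h = ∑ i ∈ range nD, D1 h i ⊗ₜ[k] D2 h i
  nP : ℕ
  X1 : ℕ → H
  X2 : ℕ → H
  X3 : ℕ → H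
  nQ : ℕ
  x1 : ℕ → H
  x2 : ℕ → H
  x3 : ℕ → H
  P_inv : ∑ s ∈ range nP, ∑ q ∈ range nQ,
      (X1 s * x1 q) ⊗ₜ[k] ((X2 s * x2 q) ⊗ₜ[k] (X3 s * x3 q)) =
      (1 : H) ⊗ₜ[k] ((1 : H) ⊗ₜ[k] (1 : H))
  inv_P : ∑ q ∈ range nQ, ∑ s ∈ range nP,
      (x1 q * X1 s) ⊗ₜ[k] ((x2 q * X2 s) ⊗ₜ[k] (x3 q * X3 s)) =
      (1 : H) ⊗ₜ[k] ((1 : H) ⊗ₜ[k] (1 : H))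
  coassoc : ∀ h : H,
    ∑ i ∈ range nD, ∑ j ∈ range nD,
      D1 h i ⊗ₜ[k] (D1 (D2 h i) j ⊗ₜ[k] D2 (D2 h i) j) =
    ∑ s ∈ range nP, ∑ i ∈ range nD, ∑ j ∈ range nD, ∑ q ∈ range nQ,
      (X1 s * D1 (D1 h i) j * x1 q) ⊗ₜ[k]
        ((X2 s * D2 (D1 h i) j * x2 q) ⊗ₜ[k] (X3 s * D2 h i * x3 q))
  counit_r : ∀ h : H, ∑ i ∈ range nD, counit (D2 h i) • D1 h i = h
  counit_l : ∀ h : H, ∑ i ∈ range nD, counit (D1 h i) • D2 h i = h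
  pentagon :
    ∑ p ∈ range nP, ∑ s ∈ range nP, ∑ l ∈ range nD, ∑ r ∈ range nP,
      (X1 s * X1 r) ⊗ₜ[k] ((X1 p * D1 (X2 s) l * X2 r) ⊗ₜ[k]
        ((X2 p * D2 (X2 s) l * X3 r) ⊗ₜ[k] (X3 p * X3 s))) =
    ∑ p ∈ range nP, ∑ s ∈ range nP, ∑ l ∈ range nD, ∑ j ∈ range nD,
      (X1 p * D1 (X1 s) j) ⊗ₜ[k] ((X2 p * D2 (X1 s) j) ⊗ₜ[k]
        ((D1 (X3 p) l * X2 s) ⊗ₜ[k] (D2 (X3 p) l * X3 s)))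
  normal : ∑ s ∈ range nP, counit (X2 s) • (X1 s ⊗ₜ[k] X3 s) = (1 : H) ⊗ₜ[k] (1 : H)

/-- A quasi-Hopf algebra: a quasi-bialgebra with an anti-automorphism `S`
and elements `aE = α`, `bE = β` satisfying the antipode axioms. -/
structure QuasiHopfAlgebra (k : Type*) [Field k] (H : Type*) [Ring H] [Algebra k H]
    extends QuasiBialgebra k H where
  S : H →ₗ[k] H
  Sinv : H →ₗ[k] H
  S_Sinv : ∀ h, S (Sinv h) = h
  Sinv_S : ∀ h, Sinv (S h) = h
  S_one : S 1 = 1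
  S_mul : ∀ g h : H, S (g * h) = S h * S g
  aE : H
  bE : H
  antip_l : ∀ h, ∑ i ∈ range nD, S (D1 h i) * aE * D2 h i = counit h • aE
  antip_r : ∀ h, ∑ i ∈ range nD, D1 h i * bE * S (D2 h i) = counit h • bE
  antip_X : ∑ s ∈ range nP, X1 s * bE * S (X2 s) * aE * X3 s = 1
  antip_x : ∑ q ∈ range nQ, S (x1 q) * aE * x2 q * bE * S (x3 q) = 1

/-- The Drinfeld twist `f` of a quasi-Hopf algebra, given by families `f₁ ⊗ f₂`
with inverse `g₁ ⊗ g₂`, together with its defining formula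
`f = ∑ (S⊗S)(Δᵒᵖ(x¹)) γ Δ(x²βS(x³))`, `γ = ∑ S(A²)αA³ ⊗ S(A¹)αA⁴`,
`∑A¹⊗A²⊗A³⊗A⁴ = (Φ⊗1)(Δ⊗id⊗id)(Φ⁻¹)`. -/
structure DrinfeldTwist {k : Type*} [Field k] {H : Type*} [Ring H] [Algebra k H]
    (QH : QuasiHopfAlgebra k H) where
  nf : ℕ
  f1 : ℕ → H
  f2 : ℕ → H
  g1 : ℕ → H
  g2 : ℕ → H
  f_inv : ∑ t ∈ range nf, ∑ u ∈ range nf,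
      (f1 t * g1 u) ⊗ₜ[k] (f2 t * g2 u) = (1 : H) ⊗ₜ[k] (1 : H)
  inv_f : ∑ u ∈ range nf, ∑ t ∈ range nf,
      (g1 u * f1 t) ⊗ₜ[k] (g2 u * f2 t) = (1 : H) ⊗ₜ[k] (1 : H)
  h_f : ∑ t ∈ range nf, f1 t ⊗ₜ[k] f2 t =
    ∑ j ∈ range QH.nQ, ∑ l ∈ range QH.nD, ∑ p ∈ range QH.nP, ∑ j' ∈ range QH.nQ,
      ∑ l' ∈ range QH.nD, ∑ l'' ∈ range QH.nD,
      (QH.S (QH.D2 (QH.x1 j) l) *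
          (QH.S (QH.X2 p * QH.D2 (QH.x1 j') l') * QH.aE * (QH.X3 p * QH.x2 j')) *
          QH.D1 (QH.x2 j * QH.bE * QH.S (QH.x3 j)) l'') ⊗ₜ[k]
        (QH.S (QH.D1 (QH.x1 j) l) *
          (QH.S (QH.X1 p * QH.D1 (QH.x1 j') l') * QH.aE * QH.x3 j') *
          QH.D2 (QH.x2 j * QH.bE * QH.S (QH.x3 j)) l'')

/-- A right `H`-comodule algebra over a quasi-bialgebra, with Sweedler families. -/
structure RightComoduleAlgebra {k : Type*} [Field k] {H : Type*} [Ring H] [Algebra k H]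
    (QB : QuasiBialgebra k H) (A : Type*) [Ring A] [Algebra k A] where
  rho : A →ₐ[k] A ⊗[k] H
  nR : ℕ
  r0 : A → ℕ → A
  r1 : A → ℕ → H
  hrho : ∀ a, rho a = ∑ i ∈ range nR, r0 a i ⊗ₜ[k] r1 a i
  nP : ℕ
  P1 : ℕ → A
  P2 : ℕ → H
  P3 : ℕ → H
  nQ : ℕ
  Q1 : ℕ → A
  Q2 : ℕ → H
  Q3 : ℕ → H
  P_inv : ∑ s ∈ range nP, ∑ q ∈ range nQ,
      (P1 s * Q1 q) ⊗ₜ[k] ((P2 s * Q2 q) ⊗ₜ[k] (P3 s * Q3 q)) =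
      (1 : A) ⊗ₜ[k] ((1 : H) ⊗ₜ[k] (1 : H))
  inv_P : ∑ q ∈ range nQ, ∑ s ∈ range nP,
      (Q1 q * P1 s) ⊗ₜ[k] ((Q2 q * P2 s) ⊗ₜ[k] (Q3 q * P3 s)) =
      (1 : A) ⊗ₜ[k] ((1 : H) ⊗ₜ[k] (1 : H))
  rca1 : ∀ a : A,
    ∑ s ∈ range nP, ∑ i ∈ range nR, ∑ j ∈ range nR,
      (P1 s * r0 (r0 a i) j) ⊗ₜ[k] ((P2 s * r1 (r0 a i) j) ⊗ₜ[k] (P3 s * r1 a i)) =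
    ∑ i ∈ range nR, ∑ l ∈ range QB.nD, ∑ s ∈ range nP,
      (r0 a i * P1 s) ⊗ₜ[k] ((QB.D1 (r1 a i) l * P2 s) ⊗ₜ[k] (QB.D2 (r1 a i) l * P3 s))
  rca2 :
    ∑ s ∈ range QB.nP, ∑ i ∈ range nP, ∑ l ∈ range QB.nD, ∑ j ∈ range nP,
      (P1 i * P1 j) ⊗ₜ[k] ((QB.X1 s * QB.D1 (P2 i) l * P2 j) ⊗ₜ[k]
        ((QB.X2 s * QB.D2 (P2 i) l * P3 j) ⊗ₜ[k] (QB.X3 s * P3 i))) =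
    ∑ i ∈ range nP, ∑ l ∈ range QB.nD, ∑ j ∈ range nP, ∑ u ∈ range nR,
      (P1 i * r0 (P1 j) u) ⊗ₜ[k] ((P2 i * r1 (P1 j) u) ⊗ₜ[k]
        ((QB.D1 (P3 i) l * P2 j) ⊗ₜ[k] (QB.D2 (P3 i) l * P3 j)))
  rca3 : ∀ a, ∑ i ∈ range nR, QB.counit (r1 a i) • r0 a i = a
  rca4a : ∑ s ∈ range nP, QB.counit (P2 s) • (P1 s ⊗ₜ[k] P3 s) = (1 : A) ⊗ₜ[k] (1 : H)
  rca4b : ∑ s ∈ range nP, QB.counit (P3 s) • (P1 s ⊗ₜ[k] P2 s) = (1 : A) ⊗ₜ[k] (1 : H)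

/-- A left `H`-comodule algebra over a quasi-bialgebra, with Sweedler families. -/
structure LeftComoduleAlgebra {k : Type*} [Field k] {H : Type*} [Ring H] [Algebra k H]
    (QB : QuasiBialgebra k H) (B : Type*) [Ring B] [Algebra k B] where
  lam : B →ₐ[k] H ⊗[k] B
  nL : ℕ
  l1 : B → ℕ → H
  l0 : B → ℕ → B
  hlam : ∀ b, lam b = ∑ i ∈ range nL, l1 b i ⊗ₜ[k] l0 b i
  nP : ℕ
  P1 : ℕ → H
  P2 : ℕ → H
  P3 : ℕ → B
  nQ : ℕ
  Q1 : ℕ → H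
  Q2 : ℕ → H
  Q3 : ℕ → B
  P_inv : ∑ s ∈ range nP, ∑ q ∈ range nQ,
      (P1 s * Q1 q) ⊗ₜ[k] ((P2 s * Q2 q) ⊗ₜ[k] (P3 s * Q3 q)) =
      (1 : H) ⊗ₜ[k] ((1 : H) ⊗ₜ[k] (1 : B))
  inv_P : ∑ q ∈ range nQ, ∑ s ∈ range nP,
      (Q1 q * P1 s) ⊗ₜ[k] ((Q2 q * P2 s) ⊗ₜ[k] (Q3 q * P3 s)) =
      (1 : H) ⊗ₜ[k] ((1 : H) ⊗ₜ[k] (1 : B))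
  lca1 : ∀ b : B,
    ∑ i ∈ range nL, ∑ l ∈ range nL, ∑ s ∈ range nP,
      (l1 b i * P1 s) ⊗ₜ[k] ((l1 (l0 b i) l * P2 s) ⊗ₜ[k] (l0 (l0 b i) l * P3 s)) =
    ∑ s ∈ range nP, ∑ i ∈ range nL, ∑ l ∈ range QB.nD,
      (P1 s * QB.D1 (l1 b i) l) ⊗ₜ[k] ((P2 s * QB.D2 (l1 b i) l) ⊗ₜ[k] (P3 s * l0 b i))
  lca2 :
    ∑ p ∈ range nP, ∑ s ∈ range nP, ∑ l ∈ range QB.nD, ∑ r ∈ range QB.nP,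
      (P1 s * QB.X1 r) ⊗ₜ[k] ((P1 p * QB.D1 (P2 s) l * QB.X2 r) ⊗ₜ[k]
        ((P2 p * QB.D2 (P2 s) l * QB.X3 r) ⊗ₜ[k] (P3 p * P3 s))) =
    ∑ p ∈ range nP, ∑ s ∈ range nP, ∑ j ∈ range QB.nD, ∑ l ∈ range nL,
      (P1 p * QB.D1 (P1 s) j) ⊗ₜ[k] ((P2 p * QB.D2 (P1 s) j) ⊗ₜ[k]
        ((l1 (P3 p) l * P2 s) ⊗ₜ[k] (l0 (P3 p) l * P3 s)))
  lca3 : ∀ b, ∑ i ∈ range nL, QB.counit (l1 b i) • l0 b i = b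
  lca4a : ∑ s ∈ range nP, QB.counit (P2 s) • (P1 s ⊗ₜ[k] P3 s) = (1 : H) ⊗ₜ[k] (1 : B)
  lca4b : ∑ s ∈ range nP, QB.counit (P1 s) • (P2 s ⊗ₜ[k] P3 s) = (1 : H) ⊗ₜ[k] (1 : B)

/-- An algebra in the monoidal category of left `H`-modules
(a left `H`-module algebra), on a carrier `V`. -/
structure LeftModuleAlgebra {k : Type*} [Field k] {H : Type*} [Ring H] [Algebra k H]
    (QB : QuasiBialgebra k H) (V : Type*) [AddCommMonoid V] [Module k V] where
  mul : V →ₗ[k] V →ₗ[k] V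
  one : V
  act : H →ₗ[k] V →ₗ[k] V
  act_one : ∀ v, act 1 v = v
  act_mul : ∀ g h v, act (g * h) v = act g (act h v)
  mul_one : ∀ v, mul v one = v
  one_mul : ∀ v, mul one v = v
  mul_assoc : ∀ u v w, mul (mul u v) w =
    ∑ s ∈ range QB.nP, mul (act (QB.X1 s) u) (mul (act (QB.X2 s) v) (act (QB.X3 s) w))
  act_mul_mul : ∀ h u v, act h (mul u v) =
    ∑ i ∈ range QB.nD, mul (act (QB.D1 h i) u) (act (QB.D2 h i) v)
  act_unit : ∀ h, act h one = QB.counit h • one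

/-- The right action `φ ↦ h ⇀ φ`, `(h ⇀ φ)(h') = φ(h'h)`. -/
def rA (k : Type*) [Field k] {H : Type*} [Ring H] [Algebra k H] (h : H) :
    Module.Dual k H →ₗ[k] Module.Dual k H :=
  LinearMap.lcomp k k (LinearMap.mulRight k h)

/-- The left action `φ ↦ φ ↼ h`, `(φ ↼ h)(h') = φ(hh')`. -/
def lA (k : Type*) [Field k] {H : Type*} [Ring H] [Algebra k H] (h : H) :
    Module.Dual k H →ₗ[k] Module.Dual k H :=
  LinearMap.lcomp k k (LinearMap.mulLeft k h)

/-- Convolution product on the dual of a "coalgebra" with comultiplication `DC`. -/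
def convC {k : Type*} [Field k] {C : Type*} [AddCommGroup C] [Module k C]
    (DC : C →ₗ[k] C ⊗[k] C) (φ ψ : Module.Dual k C) : Module.Dual k C :=
  (TensorProduct.lid k k).toLinearMap ∘ₗ (TensorProduct.map φ ψ) ∘ₗ DC

/-- A two-sided `(𝔄, H)`-Hopf module. -/
structure TwoSidedHopfModule {k : Type*} [Field k] {H : Type*} [Ring H] [Algebra k H]
    (QB : QuasiBialgebra k H) {A : Type*} [Ring A] [Algebra k A]
    (CA : RightComoduleAlgebra QB A) (M : Type*) [AddCommGroup M] [Module k M] where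
  ha : H →ₗ[k] M →ₗ[k] M
  ha_one : ∀ m, ha 1 m = m
  ha_mul : ∀ g h m, ha (g * h) m = ha g (ha h m)
  ra : A →ₗ[k] M →ₗ[k] M
  ra_one : ∀ m, ra 1 m = m
  ra_mul : ∀ a b m, ra (a * b) m = ra b (ra a m)
  ha_ra : ∀ h a m, ha h (ra a m) = ra a (ha h m)
  rho : M →ₗ[k] M ⊗[k] H
  counit_rho : ∀ m,
    (TensorProduct.rid k M) ((TensorProduct.map LinearMap.id QB.counit.toLinearMap) (rho m)) = m
  coassoc_rho : ∀ m,
    ∑ s ∈ range QB.nP,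
      (TensorProduct.map (ha (QB.X1 s))
        (TensorProduct.map (LinearMap.mulLeft k (QB.X2 s)) (LinearMap.mulLeft k (QB.X3 s))))
        ((TensorProduct.assoc k M H H) ((TensorProduct.map rho LinearMap.id) (rho m))) =
    ∑ j ∈ range CA.nP,
      (TensorProduct.map (ra (CA.P1 j))
        (TensorProduct.map (LinearMap.mulRight k (CA.P2 j)) (LinearMap.mulRight k (CA.P3 j))))
        ((TensorProduct.map LinearMap.id QB.comul.toLinearMap) (rho m))
  colin_l : ∀ h m, rho (ha h m) =
    ∑ i ∈ range QB.nD,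
      (TensorProduct.map (ha (QB.D1 h i)) (LinearMap.mulLeft k (QB.D2 h i))) (rho m)
  colin_r : ∀ a m, rho (ra a m) =
    ∑ i ∈ range CA.nR,
      (TensorProduct.map (ra (CA.r0 a i)) (LinearMap.mulRight k (CA.r1 a i))) (rho m)

/-- A right `(H^*, A)`-Hopf module over a left `H`-module algebra `A` (carrier `V`). -/
structure RelHopfModule {k : Type*} [Field k] {H : Type*} [Ring H] [Algebra k H]
    (QB : QuasiBialgebra k H) {V : Type*} [AddCommMonoid V] [Module k V]
    (MA : LeftModuleAlgebra QB V) (M : Type*) [AddCommGroup M] [Module k M] where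
  hb : H →ₗ[k] M →ₗ[k] M
  hb_one : ∀ m, hb 1 m = m
  hb_mul : ∀ g h m, hb (g * h) m = hb g (hb h m)
  rb : V →ₗ[k] M →ₗ[k] M
  rb_one : ∀ m, rb MA.one m = m
  rb_assoc : ∀ m u v, rb v (rb u m) =
    ∑ s ∈ range QB.nP, rb (MA.mul (MA.act (QB.X2 s) u) (MA.act (QB.X3 s) v)) (hb (QB.X1 s) m)
  hb_rb : ∀ h u m, hb h (rb u m) =
    ∑ i ∈ range QB.nD, rb (MA.act (QB.D2 h i) u) (hb (QB.D1 h i) m)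

/-- A right module over the (possibly nonassociative) algebra `(V, mul, one)`. -/
structure RightAlgModule (k : Type*) [Field k] {V : Type*} [AddCommMonoid V] [Module k V]
    (mul : V →ₗ[k] V →ₗ[k] V) (one : V) (N : Type*) [AddCommGroup N] [Module k N] where
  ract : V →ₗ[k] N →ₗ[k] N
  ract_one : ∀ n, ract one n = n
  ract_mul : ∀ u v n, ract (mul u v) n = ract v (ract u n)

/-- A left `H'`-comodule algebra structure on a carrier `V` equipped with a
(bilinear, possibly nonassociative) multiplication `mulV` and unit `oneV`. -/
structure LeftComoduleAlgebraS {k : Type*} [Field k] {H' : Type*} [Ring H'] [Algebra k H']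
    (QB : QuasiBialgebra k H') (V : Type*) [AddCommMonoid V] [Module k V]
    (mulV : V →ₗ[k] V →ₗ[k] V) (oneV : V) where
  lam : V →ₗ[k] H' ⊗[k] V
  nL : ℕ
  l1 : V → ℕ → H'
  l0 : V → ℕ → V
  hlam : ∀ v, lam v = ∑ i ∈ range nL, l1 v i ⊗ₜ[k] l0 v i
  lam_one : lam oneV = (1 : H') ⊗ₜ[k] oneV
  lam_mul : ∀ u v, lam (mulV u v) =
    ∑ i ∈ range nL, ∑ j ∈ range nL, (l1 u i * l1 v j) ⊗ₜ[k] mulV (l0 u i) (l0 v j)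
  nP : ℕ
  P1 : ℕ → H'
  P2 : ℕ → H'
  P3 : ℕ → V
  nQ : ℕ
  Q1 : ℕ → H'
  Q2 : ℕ → H'
  Q3 : ℕ → V
  P_inv : ∑ s ∈ range nP, ∑ q ∈ range nQ,
      (P1 s * Q1 q) ⊗ₜ[k] ((P2 s * Q2 q) ⊗ₜ[k] mulV (P3 s) (Q3 q)) =
      (1 : H') ⊗ₜ[k] ((1 : H') ⊗ₜ[k] oneV)
  inv_P : ∑ q ∈ range nQ, ∑ s ∈ range nP,
      (Q1 q * P1 s) ⊗ₜ[k] ((Q2 q * P2 s) ⊗ₜ[k] mulV (Q3 q) (P3 s)) =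
      (1 : H') ⊗ₜ[k] ((1 : H') ⊗ₜ[k] oneV)
  lca1 : ∀ v : V,
    ∑ i ∈ range nL, ∑ l ∈ range nL, ∑ s ∈ range nP,
      (l1 v i * P1 s) ⊗ₜ[k] ((l1 (l0 v i) l * P2 s) ⊗ₜ[k] mulV (l0 (l0 v i) l) (P3 s)) =
    ∑ s ∈ range nP, ∑ i ∈ range nL, ∑ l ∈ range QB.nD,
      (P1 s * QB.D1 (l1 v i) l) ⊗ₜ[k] ((P2 s * QB.D2 (l1 v i) l) ⊗ₜ[k] mulV (P3 s) (l0 v i))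
  lca2 :
    ∑ p ∈ range nP, ∑ s ∈ range nP, ∑ l ∈ range QB.nD, ∑ r ∈ range QB.nP,
      (P1 s * QB.X1 r) ⊗ₜ[k] ((P1 p * QB.D1 (P2 s) l * QB.X2 r) ⊗ₜ[k]
        ((P2 p * QB.D2 (P2 s) l * QB.X3 r) ⊗ₜ[k] mulV (P3 p) (P3 s))) =
    ∑ p ∈ range nP, ∑ s ∈ range nP, ∑ j ∈ range QB.nD, ∑ l ∈ range nL,
      (P1 p * QB.D1 (P1 s) j) ⊗ₜ[k] ((P2 p * QB.D2 (P1 s) j) ⊗ₜ[k]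
        ((l1 (P3 p) l * P2 s) ⊗ₜ[k] mulV (l0 (P3 p) l) (P3 s)))
  lca3 : ∀ v, ∑ i ∈ range nL, QB.counit (l1 v i) • l0 v i = v
  lca4a : ∑ s ∈ range nP, QB.counit (P2 s) • (P1 s ⊗ₜ[k] P3 s) = (1 : H') ⊗ₜ[k] oneV
  lca4b : ∑ s ∈ range nP, QB.counit (P1 s) • (P2 s ⊗ₜ[k] P3 s) = (1 : H') ⊗ₜ[k] oneV

/-- A right-left Doi-Hopf module over the quasi-bialgebra `QB'`, a left comodule
algebra (given by its carrier `V`, multiplication data and coaction families) and a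
module coalgebra `C` (given by its comultiplication `DC`, counit `eC` and right
`H'`-action `actC`). -/
structure DoiHopfModule {k : Type*} [Field k] {H' : Type*} [Ring H'] [Algebra k H']
    (QB' : QuasiBialgebra k H') {V : Type*} [AddCommMonoid V] [Module k V]
    (mulV : V →ₗ[k] V →ₗ[k] V) (oneV : V)
    (nL : ℕ) (l1 : V → ℕ → H') (l0 : V → ℕ → V)
    (nPl : ℕ) (Pl1 Pl2 : ℕ → H') (Pl3 : ℕ → V)
    {C : Type*} [AddCommGroup C] [Module k C]
    (DC : C →ₗ[k] C ⊗[k] C) (eC : C →ₗ[k] k) (actC : H' →ₗ[k] C →ₗ[k] C)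
    (N : Type*) [AddCommGroup N] [Module k N] where
  ract : V →ₗ[k] N →ₗ[k] N
  ract_one : ∀ n, ract oneV n = n
  ract_mul : ∀ u v n, ract (mulV u v) n = ract v (ract u n)
  rhoN : N →ₗ[k] C ⊗[k] N
  dh2 : ∀ n, (TensorProduct.lid k N) ((TensorProduct.map eC LinearMap.id) (rhoN n)) = n
  dh1 : ∀ n,
    (TensorProduct.assoc k C C N) ((TensorProduct.map DC LinearMap.id) (rhoN n)) =
    ∑ j ∈ range nPl,
      (TensorProduct.map (actC (Pl1 j)) (TensorProduct.map (actC (Pl2 j)) (ract (Pl3 j))))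
        ((TensorProduct.map LinearMap.id rhoN) (rhoN n))
  dh3 : ∀ v n, rhoN (ract v n) =
    ∑ w ∈ range nL, (TensorProduct.map (actC (l1 v w)) (ract (l0 v w))) (rhoN n)

/-- A right `H`-module coalgebra, with Sweedler families for the comultiplication. -/
structure RightModuleCoalgebra {k : Type*} [Field k] {H : Type*} [Ring H] [Algebra k H]
    (QB : QuasiBialgebra k H) (C : Type*) [AddCommGroup C] [Module k C] where
  act : H →ₗ[k] C →ₗ[k] C
  act_one : ∀ c, act 1 c = c
  act_mul : ∀ g h c, act (g * h) c = act h (act g c)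
  DC : C →ₗ[k] C ⊗[k] C
  nC : ℕ
  C1 : C → ℕ → C
  C2 : C → ℕ → C
  hDC : ∀ c, DC c = ∑ i ∈ range nC, C1 c i ⊗ₜ[k] C2 c i
  eC : C →ₗ[k] k
  counit_l : ∀ c, ∑ i ∈ range nC, eC (C1 c i) • C2 c i = c
  counit_r : ∀ c, ∑ i ∈ range nC, eC (C2 c i) • C1 c i = c
  rmc1 : ∀ c : C,
    ∑ i ∈ range nC, ∑ j ∈ range nC, ∑ q ∈ range QB.nQ,
      act (QB.x1 q) (C1 (C1 c i) j) ⊗ₜ[k]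
        (act (QB.x2 q) (C2 (C1 c i) j) ⊗ₜ[k] act (QB.x3 q) (C2 c i)) =
    ∑ i ∈ range nC, ∑ j ∈ range nC,
      C1 c i ⊗ₜ[k] (C1 (C2 c i) j ⊗ₜ[k] C2 (C2 c i) j)
  rmc2 : ∀ c h,
    ∑ i ∈ range nC, C1 (act h c) i ⊗ₜ[k] C2 (act h c) i =
    ∑ i ∈ range nC, ∑ l ∈ range QB.nD,
      act (QB.D1 h l) (C1 c i) ⊗ₜ[k] act (QB.D2 h l) (C2 c i)
  rmc3 : ∀ c h, eC (act h c) = eC c * QB.counit h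

/-- An `H`-bimodule coalgebra: a coalgebra in the monoidal category of
`(H,H)`-bimodules, with Sweedler families. -/
structure HBimoduleCoalgebra {k : Type*} [Field k] {H : Type*} [Ring H] [Algebra k H]
    (QB : QuasiBialgebra k H) (C : Type*) [AddCommGroup C] [Module k C] where
  lact : H →ₗ[k] C →ₗ[k] C
  lact_one : ∀ c, lact 1 c = c
  lact_mul : ∀ g h c, lact (g * h) c = lact g (lact h c)
  ract : H →ₗ[k] C →ₗ[k] C
  ract_one : ∀ c, ract 1 c = c
  ract_mul : ∀ g h c, ract (g * h) c = ract h (ract g c)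
  lact_ract : ∀ g h c, lact g (ract h c) = ract h (lact g c)
  DC : C →ₗ[k] C ⊗[k] C
  nC : ℕ
  C1 : C → ℕ → C
  C2 : C → ℕ → C
  hDC : ∀ c, DC c = ∑ i ∈ range nC, C1 c i ⊗ₜ[k] C2 c i
  eC : C →ₗ[k] k
  counit_l : ∀ c, ∑ i ∈ range nC, eC (C1 c i) • C2 c i = c
  counit_r : ∀ c, ∑ i ∈ range nC, eC (C2 c i) • C1 c i = c
  bmc1 : ∀ c : C,
    ∑ s ∈ range QB.nP, ∑ i ∈ range nC, ∑ j ∈ range nC, ∑ q ∈ range QB.nQ,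
      lact (QB.X1 s) (ract (QB.x1 q) (C1 (C1 c i) j)) ⊗ₜ[k]
        (lact (QB.X2 s) (ract (QB.x2 q) (C2 (C1 c i) j)) ⊗ₜ[k]
          lact (QB.X3 s) (ract (QB.x3 q) (C2 c i))) =
    ∑ i ∈ range nC, ∑ j ∈ range nC,
      C1 c i ⊗ₜ[k] (C1 (C2 c i) j ⊗ₜ[k] C2 (C2 c i) j)
  bmc2l : ∀ c h,
    ∑ i ∈ range nC, C1 (lact h c) i ⊗ₜ[k] C2 (lact h c) i =
    ∑ l ∈ range QB.nD, ∑ i ∈ range nC,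
      lact (QB.D1 h l) (C1 c i) ⊗ₜ[k] lact (QB.D2 h l) (C2 c i)
  bmc2r : ∀ c h,
    ∑ i ∈ range nC, C1 (ract h c) i ⊗ₜ[k] C2 (ract h c) i =
    ∑ l ∈ range QB.nD, ∑ i ∈ range nC,
      ract (QB.D1 h l) (C1 c i) ⊗ₜ[k] ract (QB.D2 h l) (C2 c i)
  bmc3l : ∀ c h, eC (lact h c) = QB.counit h * eC c
  bmc3r : ∀ c h, eC (ract h c) = eC c * QB.counit h

/-- An `H`-bicomodule algebra `(𝔸, λ, ρ, Φ_λ, Φ_ρ, Φ_{λ,ρ})`. -/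
structure BicomoduleAlgebra {k : Type*} [Field k] {H : Type*} [Ring H] [Algebra k H]
    (QB : QuasiBialgebra k H) (A : Type*) [Ring A] [Algebra k A] where
  rca : RightComoduleAlgebra QB A
  lca : LeftComoduleAlgebra QB A
  nO : ℕ
  O1 : ℕ → H
  O2 : ℕ → A
  O3 : ℕ → H
  nW : ℕ
  w1 : ℕ → H
  w2 : ℕ → A
  w3 : ℕ → H
  O_inv : ∑ v ∈ range nO, ∑ w ∈ range nW,
      (O1 v * w1 w) ⊗ₜ[k] ((O2 v * w2 w) ⊗ₜ[k] (O3 v * w3 w)) =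
      (1 : H) ⊗ₜ[k] ((1 : A) ⊗ₜ[k] (1 : H))
  inv_O : ∑ w ∈ range nW, ∑ v ∈ range nO,
      (w1 w * O1 v) ⊗ₜ[k] ((w2 w * O2 v) ⊗ₜ[k] (w3 w * O3 v)) =
      (1 : H) ⊗ₜ[k] ((1 : A) ⊗ₜ[k] (1 : H))
  bca1 : ∀ a : A,
    ∑ v ∈ range nO, ∑ r ∈ range rca.nR, ∑ l ∈ range lca.nL,
      (O1 v * lca.l1 (rca.r0 a r) l) ⊗ₜ[k]
        ((O2 v * lca.l0 (rca.r0 a r) l) ⊗ₜ[k] (O3 v * rca.r1 a r)) =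
    ∑ l ∈ range lca.nL, ∑ r ∈ range rca.nR, ∑ v ∈ range nO,
      (lca.l1 a l * O1 v) ⊗ₜ[k]
        ((rca.r0 (lca.l0 a l) r * O2 v) ⊗ₜ[k] (rca.r1 (lca.l0 a l) r * O3 v))
  bca2 :
    ∑ v ∈ range nO, ∑ v' ∈ range nO, ∑ l ∈ range lca.nL, ∑ j ∈ range lca.nP,
      (O1 v' * lca.P1 j) ⊗ₜ[k] ((O1 v * lca.l1 (O2 v') l * lca.P2 j) ⊗ₜ[k]
        ((O2 v * lca.l0 (O2 v') l * lca.P3 j) ⊗ₜ[k] (O3 v * O3 v'))) =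
    ∑ j ∈ range lca.nP, ∑ v ∈ range nO, ∑ i ∈ range QB.nD, ∑ r ∈ range rca.nR,
      (lca.P1 j * QB.D1 (O1 v) i) ⊗ₜ[k] ((lca.P2 j * QB.D2 (O1 v) i) ⊗ₜ[k]
        ((rca.r0 (lca.P3 j) r * O2 v) ⊗ₜ[k] (rca.r1 (lca.P3 j) r * O3 v)))
  bca3 :
    ∑ s ∈ range rca.nP, ∑ v ∈ range nO, ∑ r ∈ range rca.nR, ∑ v' ∈ range nO,
      (O1 v * O1 v') ⊗ₜ[k] ((rca.P1 s * rca.r0 (O2 v) r * O2 v') ⊗ₜ[k]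
        ((rca.P2 s * rca.r1 (O2 v) r * O3 v') ⊗ₜ[k] (rca.P3 s * O3 v))) =
    ∑ v ∈ range nO, ∑ i ∈ range QB.nD, ∑ s ∈ range rca.nP, ∑ l ∈ range lca.nL,
      (O1 v * lca.l1 (rca.P1 s) l) ⊗ₜ[k] ((O2 v * lca.l0 (rca.P1 s) l) ⊗ₜ[k]
        ((QB.D1 (O3 v) i * rca.P2 s) ⊗ₜ[k] (QB.D2 (O3 v) i * rca.P3 s)))

/-- A two-sided two-cosided `(H, 𝔸, C)`-Hopf module. -/
structure TwoSidedTwoCosided {k : Type*} [Field k] {H : Type*} [Ring H] [Algebra k H]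
    (QB : QuasiBialgebra k H) {A : Type*} [Ring A] [Algebra k A]
    (BA : BicomoduleAlgebra QB A) {C : Type*} [AddCommGroup C] [Module k C]
    (lactC ractC : H →ₗ[k] C →ₗ[k] C) (DC : C →ₗ[k] C ⊗[k] C) (eC : C →ₗ[k] k)
    (N : Type*) [AddCommGroup N] [Module k N]
    extends TwoSidedHopfModule QB BA.rca N where
  rhoC : N →ₗ[k] C ⊗[k] N
  counit_rhoC : ∀ n,
    (TensorProduct.lid k N) ((TensorProduct.map eC LinearMap.id) (rhoC n)) = n
  tstc1 : ∀ n,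
    ∑ s ∈ range QB.nP,
      (TensorProduct.map (lactC (QB.X1 s))
        (TensorProduct.map (lactC (QB.X2 s)) (ha (QB.X3 s))))
        ((TensorProduct.assoc k C C N) ((TensorProduct.map DC LinearMap.id) (rhoC n))) =
    ∑ j ∈ range BA.lca.nP,
      (TensorProduct.map (ractC (BA.lca.P1 j))
        (TensorProduct.map (ractC (BA.lca.P2 j)) (ra (BA.lca.P3 j))))
        ((TensorProduct.map LinearMap.id rhoC) (rhoC n))
  tstc2 : ∀ n,
    ∑ s ∈ range QB.nP,
      (TensorProduct.map (lactC (QB.X1 s))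
        (TensorProduct.map (ha (QB.X2 s)) (LinearMap.mulLeft k (QB.X3 s))))
        ((TensorProduct.assoc k C N H) ((TensorProduct.map rhoC LinearMap.id) (rho n))) =
    ∑ v ∈ range BA.nO,
      (TensorProduct.map (ractC (BA.O1 v))
        (TensorProduct.map (ra (BA.O2 v)) (LinearMap.mulRight k (BA.O3 v))))
        ((TensorProduct.map LinearMap.id rho) (rhoC n))
  tstc3 : ∀ h n, rhoC (ha h n) =
    ∑ i ∈ range QB.nD,
      (TensorProduct.map (lactC (QB.D1 h i)) (ha (QB.D2 h i))) (rhoC n)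
  tstc4 : ∀ a n, rhoC (ra a n) =
    ∑ l ∈ range BA.lca.nL,
      (TensorProduct.map (ractC (BA.lca.l1 a l)) (ra (BA.lca.l0 a l))) (rhoC n)

/-- `MA` is the quasi-smash product `𝔄 #̄ H^*` left `H`-module algebra structure
on `𝔄 ⊗ H^*`. -/
def IsQuasiSmash {k : Type*} [Field k] {H : Type*} [Ring H] [Algebra k H]
    (QB : QuasiBialgebra k H) {A : Type*} [Ring A] [Algebra k A]
    (CA : RightComoduleAlgebra QB A)
    (MA : LeftModuleAlgebra QB (A ⊗[k] Module.Dual k H)) : Prop :=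
  (∀ (a a' : A) (φ ψ : Module.Dual k H),
    MA.mul (a ⊗ₜ[k] φ) (a' ⊗ₜ[k] ψ) =
      ∑ i ∈ Finset.range CA.nR, ∑ j ∈ Finset.range CA.nQ,
        (a * CA.r0 a' i * CA.Q1 j) ⊗ₜ[k]
          convC QB.comul.toLinearMap
            (lA k (CA.r1 a' i * CA.Q2 j) φ) (lA k (CA.Q3 j) ψ)) ∧
  MA.one = (1 : A) ⊗ₜ[k] (QB.counit.toLinearMap : Module.Dual k H) ∧
  (∀ (h : H) (a : A) (φ : Module.Dual k H),
    MA.act h (a ⊗ₜ[k] φ) = a ⊗ₜ[k] rA k h φ)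

/-- The structure transport formulas of the functor
`F : _H𝓜^H_𝔄 → 𝓜^{H^*}_{𝔄 #̄ H^*}`:  `h • m = S²(h) ≻ m` and
`m • (a #̄ φ) = ∑ φ(S⁻¹(S(U¹)f² m₍₁₎ a⟨1⟩ p̃²ρ)) S(U²)f¹ ≻ m₍₀₎ ≺ a⟨0⟩ p̃¹ρ`,
where `U = ∑ g¹S(q²_R) ⊗ g²S(q¹_R)`. -/
def IsFImage {k : Type*} [Field k] {H : Type*} [Ring H] [Algebra k H]
    {QH : QuasiHopfAlgebra k H} (DT : DrinfeldTwist QH)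
    {A : Type*} [Ring A] [Algebra k A]
    {CA : RightComoduleAlgebra QH.toQuasiBialgebra A}
    {MA : LeftModuleAlgebra QH.toQuasiBialgebra (A ⊗[k] Module.Dual k H)}
    {M : Type*} [AddCommGroup M] [Module k M]
    (T : TwoSidedHopfModule QH.toQuasiBialgebra CA M)
    (R : RelHopfModule QH.toQuasiBialgebra MA M) : Prop :=
  (∀ (h : H) (m : M), R.hb h m = T.ha (QH.S (QH.S h)) m) ∧
  (∀ (a : A) (φ : Module.Dual k H) (m : M),
    R.rb (a ⊗ₜ[k] φ) m =
      ∑ t' ∈ Finset.range DT.nf, ∑ t ∈ Finset.range DT.nf, ∑ s ∈ Finset.range QH.nP,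
        ∑ r ∈ Finset.range CA.nR, ∑ j ∈ Finset.range CA.nQ,
        (TensorProduct.rid k M)
          ((TensorProduct.map
            ((T.ra (CA.r0 a r * CA.Q1 j)) ∘ₗ
              (T.ha (QH.S (DT.g2 t * QH.S (QH.X1 s)) * DT.f1 t')))
            (φ ∘ₗ QH.Sinv ∘ₗ
              (LinearMap.mulRight k (CA.r1 a r * (CA.Q2 j * QH.bE * QH.S (CA.Q3 j)))) ∘ₗ
              (LinearMap.mulLeft k
                (QH.S (DT.g1 t * QH.S (QH.Sinv (QH.aE * QH.X3 s) * QH.X2 s)) * DT.f2 t'))))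
            (T.rho m)))

namespace QuasiHopf

section HomCalculus

variable {k : Type*} [Field k] {G : Type*} [Ring G] [Algebra k G]
  {G' : Type*} [Ring G'] [Algebra k G'] {G'' : Type*} [Ring G''] [Algebra k G'']
  {B : Type*} [Ring B] [Algebra k B]

/-- Two algebra maps with elementwise commuting images. -/
class CommH (a : G →ₐ[k] B) (b : G' →ₐ[k] B) : Prop where
  comm : ∀ x y, Commute (a x) (b y)

/-- The image of an algebra map commutes with an element. -/
class CommW (a : G →ₐ[k] B) (w : B) : Prop where
  comm : ∀ x, Commute (a x) w

instance CommH.symm' (a : G →ₐ[k] B) (b : G' →ₐ[k] B) [h : CommH a b] : CommH b a :=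
  ⟨fun x y => (h.comm y x).symm⟩

lemma CommH.swap (a : G →ₐ[k] B) (b : G' →ₐ[k] B) [h : CommH a b] (x : G) (y : G') :
    b y * a x = a x * b y := (h.comm x y).eq.symm

lemma CommH.swap_mul (a : G →ₐ[k] B) (b : G' →ₐ[k] B) [CommH a b] (x : G) (y : G') (z : B) :
    b y * (a x * z) = a x * (b y * z) := by
  rw [← mul_assoc, CommH.swap a b, mul_assoc]

instance (a : G →ₐ[k] B) (b : G' →ₐ[k] B) [h : CommH a b] (y : G') : CommW a (b y) :=
  ⟨fun x => h.comm x y⟩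

instance (a : G →ₐ[k] B) (v w : B) [hv : CommW a v] [hw : CommW a w] : CommW a (v * w) :=
  ⟨fun x => (hv.comm x).mul_right (hw.comm x)⟩

/-- The algebra map out of a tensor product induced by two commuting algebra maps. -/
def lift2 (a : G →ₐ[k] B) (b : G' →ₐ[k] B) [h : CommH a b] : G ⊗[k] G' →ₐ[k] B :=
  Algebra.TensorProduct.lift a b h.comm

@[simp] lemma lift2_tmul (a : G →ₐ[k] B) (b : G' →ₐ[k] B) [CommH a b] (x : G) (y : G') :
    lift2 a b (x ⊗ₜ y) = a x * b y := rfl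

instance commW_lift2 (c : G'' →ₐ[k] B) (a : G →ₐ[k] B) (b : G' →ₐ[k] B) [CommH a b]
    [hca : CommH c a] [hcb : CommH c b] (t : G ⊗[k] G') : CommW c (lift2 a b t) := by
  refine ⟨fun x => ?_⟩
  induction t with
  | zero => simp
  | tmul u v => exact (hca.comm x u).mul_right (hcb.comm x v)
  | add s t hs ht => rw [map_add]; exact hs.add_right ht

instance commH_lift2 (c : G'' →ₐ[k] B) (a : G →ₐ[k] B) (b : G' →ₐ[k] B) [CommH a b]
    [CommH c a] [CommH c b] : CommH c (lift2 a b) :=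
  ⟨fun x t => (commW_lift2 c a b t).comm x⟩

/-- `P` intertwines the algebra maps `a` and `a'`. -/
def Intertw (P : B) (a a' : G →ₐ[k] B) : Prop := ∀ x, P * a x = a' x * P

lemma Intertw.of_comm (P : B) (a : G →ₐ[k] B) [h : CommW a P] : Intertw P a a :=
  fun x => ((h.comm x).eq).symm

lemma Intertw.lift2 {P : B} {a a' : G →ₐ[k] B} {b b' : G' →ₐ[k] B} [CommH a b] [CommH a' b']
    (ha : Intertw P a a') (hb : Intertw P b b') (t : G ⊗[k] G') :
    P * lift2 a b t = QuasiHopf.lift2 a' b' t * P := by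
  induction t with
  | zero => simp
  | tmul u v =>
    rw [lift2_tmul, lift2_tmul, ← mul_assoc, ha, mul_assoc, hb, mul_assoc]
  | add s t hs ht => rw [map_add, map_add, mul_add, add_mul, hs, ht]

section Replace
variable {N : Type*} [AddCommGroup N] [Module k N] (E : B →ₗ[k] N)

/-- Right multiplication by `a` and by `b` agree under `E`. -/
def EqR (a b : G →ₐ[k] B) : Prop := ∀ x z, E (z * a x) = E (z * b x)

/-- Left multiplication by `a` and by `b` agree under `E`. -/
def EqL (a b : G →ₐ[k] B) : Prop := ∀ x z, E (a x * z) = E (b x * z)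

variable {E}

lemma EqR.snd {a : G →ₐ[k] B} {b b' : G' →ₐ[k] B} [CommH a b] [CommH a b'] (h : EqR E b b')
    (t : G ⊗[k] G') (z : B) : E (z * lift2 a b t) = E (z * lift2 a b' t) := by
  induction t with
  | zero => simp
  | tmul u v => rw [lift2_tmul, lift2_tmul, ← mul_assoc, ← mul_assoc, h]
  | add s t hs ht => simp only [map_add, mul_add, hs, ht]

lemma EqR.fst {a a' : G →ₐ[k] B} {b : G' →ₐ[k] B} [i : CommH a b] [i' : CommH a' b]
    (h : EqR E a a') (t : G ⊗[k] G') (z : B) :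
    E (z * lift2 a b t) = E (z * lift2 a' b t) := by
  induction t with
  | zero => simp
  | tmul u v =>
    rw [lift2_tmul, lift2_tmul, (i.comm u v).eq, (i'.comm u v).eq, ← mul_assoc, ← mul_assoc, h]
  | add s t hs ht => simp only [map_add, mul_add, hs, ht]

lemma EqL.fst {a a' : G →ₐ[k] B} {b : G' →ₐ[k] B} [CommH a b] [CommH a' b]
    (h : EqL E a a') (t : G ⊗[k] G') (z : B) :
    E (lift2 a b t * z) = E (lift2 a' b t * z) := by
  induction t with
  | zero => simp
  | tmul u v => rw [lift2_tmul, lift2_tmul, mul_assoc, mul_assoc, h]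
  | add s t hs ht => simp only [map_add, add_mul, hs, ht]

lemma EqL.snd {a : G →ₐ[k] B} {b b' : G' →ₐ[k] B} [i : CommH a b] [i' : CommH a b']
    (h : EqL E b b') (t : G ⊗[k] G') (z : B) :
    E (lift2 a b t * z) = E (lift2 a b' t * z) := by
  induction t with
  | zero => simp
  | tmul u v =>
    rw [lift2_tmul, lift2_tmul, (i.comm u v).eq, (i'.comm u v).eq, mul_assoc, mul_assoc, h]
  | add s t hs ht => simp only [map_add, add_mul, hs, ht]

/-- A map commuting with `w` may be replaced inside `z * _ * w`. -/
lemma EqR.mulRight {a a' : G →ₐ[k] B} (h : EqR E a a') (w : B) [i : CommW a w]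
    [i' : CommW a' w] : EqR (E ∘ₗ LinearMap.mulRight k w) a a' := by
  intro x z
  simp only [LinearMap.comp_apply, LinearMap.mulRight_apply]
  rw [mul_assoc, mul_assoc, (i.comm x).eq, (i'.comm x).eq, ← mul_assoc, ← mul_assoc, h]

lemma EqL.mulLeft {a a' : G →ₐ[k] B} (h : EqL E a a') (w : B) [i : CommW a w]
    [i' : CommW a' w] : EqL (E ∘ₗ LinearMap.mulLeft k w) a a' := by
  intro x z
  simp only [LinearMap.comp_apply, LinearMap.mulLeft_apply]
  rw [← mul_assoc, ← mul_assoc, ← (i.comm x).eq, ← (i'.comm x).eq, mul_assoc, mul_assoc, h]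

end Replace

end HomCalculus

section Regular

variable {k : Type*} [Field k] {H : Type*} [Ring H] [Algebra k H]

/-- The algebra map `h ↦ ε(h) 1`. -/
def eta (Q : QuasiBialgebra k H) (B : Type*) [Ring B] [Algebra k B] : H →ₐ[k] B :=
  (Algebra.ofId k B).comp Q.counit

lemma eta_apply (Q : QuasiBialgebra k H) (B : Type*) [Ring B] [Algebra k B] (h : H) :
    eta Q B h = algebraMap k B (Q.counit h) := rfl

instance {B : Type*} [Ring B] [Algebra k B] {G : Type*} [Ring G] [Algebra k G]
    (Q : QuasiBialgebra k H) (a : G →ₐ[k] B) : CommH (eta Q B) a :=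
  ⟨fun _ _ => Algebra.commutes _ _⟩

variable (Q : QuasiBialgebra k H)

/-- The reassociator. -/
def phi : H ⊗[k] (H ⊗[k] H) := ∑ s ∈ range Q.nP, Q.X1 s ⊗ₜ[k] (Q.X2 s ⊗ₜ[k] Q.X3 s)

/-- The inverse reassociator. -/
def psi : H ⊗[k] (H ⊗[k] H) := ∑ s ∈ range Q.nQ, Q.x1 s ⊗ₜ[k] (Q.x2 s ⊗ₜ[k] Q.x3 s)

lemma phi_mul_psi : phi Q * psi Q = 1 := by
  rw [phi, psi, sum_mul_sum]
  simp only [Algebra.TensorProduct.tmul_mul_tmul]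
  exact Q.P_inv

lemma psi_mul_phi : psi Q * phi Q = 1 := by
  rw [phi, psi, sum_mul_sum]
  simp only [Algebra.TensorProduct.tmul_mul_tmul]
  exact Q.inv_P

lemma counit_right_phi :
    ∑ s ∈ range Q.nP, Q.counit (Q.X3 s) • (Q.X1 s ⊗ₜ[k] Q.X2 s) = (1 : H) ⊗ₜ[k] (1 : H) := by
  have e1 : ∑ s ∈ range Q.nP, (Q.counit (Q.X2 s) * Q.counit (Q.X3 s)) • Q.X1 s = (1 : H) := by
    have h := congrArg (lift2 (AlgHom.id k H) (eta Q H)) Q.normal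
    simpa [eta_apply, ← Algebra.commutes (R := k), ← Algebra.smul_def, smul_smul] using h
  set y : H ⊗[k] H := ∑ s ∈ range Q.nP, Q.counit (Q.X3 s) • (Q.X1 s ⊗ₜ[k] Q.X2 s) with hy
  have comm1 : CommH (Algebra.TensorProduct.includeLeft : H →ₐ[k] H ⊗[k] H)
      (Algebra.TensorProduct.includeRight : H →ₐ[k] H ⊗[k] H) := ⟨fun x y => by
    simp [commute_iff_eq]⟩
  set L : H ⊗[k] (H ⊗[k] (H ⊗[k] H)) →ₐ[k] H ⊗[k] H :=
    lift2 Algebra.TensorProduct.includeLeft (lift2 Algebra.TensorProduct.includeRight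
      (lift2 (eta Q (H ⊗[k] H)) (eta Q (H ⊗[k] H)))) with hL
  set L' : H ⊗[k] (H ⊗[k] H) →ₐ[k] H ⊗[k] H :=
    lift2 Algebra.TensorProduct.includeLeft (lift2 Algebra.TensorProduct.includeRight
      (eta Q (H ⊗[k] H))) with hL'
  have hLa (u v w z : H) : L (u ⊗ₜ (v ⊗ₜ (w ⊗ₜ z))) =
      (Q.counit w * Q.counit z) • (u ⊗ₜ[k] v) := by
    simp only [hL, lift2_tmul, eta_apply, ← map_mul]
    rw [← mul_assoc, ← Algebra.commutes, ← Algebra.smul_def]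
    simp
  have hLb (u v w : H) : L' (u ⊗ₜ (v ⊗ₜ w)) = Q.counit w • (u ⊗ₜ[k] v) := by
    simp only [hL', lift2_tmul, eta_apply]
    rw [← mul_assoc, ← Algebra.commutes, ← Algebra.smul_def]
    simp
  have hinv : L' (psi Q) * y = 1 := by
    rw [show y = L' (phi Q) by rw [hy, phi, map_sum]; simp only [hLb], ← map_mul, psi_mul_phi,
      map_one]
  have h := congrArg L Q.pentagon
  simp only [map_sum, hLa] at h
  have hl : y * y = ∑ p ∈ range Q.nP, ∑ s ∈ range Q.nP, ∑ l ∈ range Q.nD, ∑ r ∈ range Q.nP,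
      (Q.counit (Q.X2 p * Q.D2 (Q.X2 s) l * Q.X3 r) * Q.counit (Q.X3 p * Q.X3 s)) •
      ((Q.X1 s * Q.X1 r) ⊗ₜ[k] (Q.X1 p * Q.D1 (Q.X2 s) l * Q.X2 r)) := by
    calc y * y = (1 ⊗ₜ[k] ∑ p ∈ range Q.nP, (Q.counit (Q.X2 p) * Q.counit (Q.X3 p)) • Q.X1 p) *
          (∑ s ∈ range Q.nP, Q.counit (Q.X3 s) • (Q.X1 s ⊗ₜ[k]
            ∑ l ∈ range Q.nD, Q.counit (Q.D2 (Q.X2 s) l) • Q.D1 (Q.X2 s) l)) * y := by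
          rw [e1]; simp only [Q.counit_r]
          rw [← hy, ← Algebra.TensorProduct.one_def, one_mul]
      _ = _ := by
        rw [tmul_sum, mul_assoc, Finset.sum_mul]
        refine sum_congr rfl fun p _ => ?_
        rw [Finset.sum_mul, mul_sum]
        refine sum_congr rfl fun s _ => ?_
        rw [tmul_sum, smul_sum, Finset.sum_mul, mul_sum]
        refine sum_congr rfl fun l _ => ?_
        rw [hy, mul_sum, mul_sum]
        refine sum_congr rfl fun r _ => ?_
        simp only [tmul_smul, smul_smul, smul_mul_assoc, mul_smul_comm,
          Algebra.TensorProduct.tmul_mul_tmul, one_mul, map_mul, mul_assoc]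
        congr 1
        ring
  have hr : y = ∑ p ∈ range Q.nP, ∑ s ∈ range Q.nP, ∑ l ∈ range Q.nD, ∑ j ∈ range Q.nD,
      (Q.counit (Q.D1 (Q.X3 p) l * Q.X2 s) * Q.counit (Q.D2 (Q.X3 p) l * Q.X3 s)) •
      ((Q.X1 p * Q.D1 (Q.X1 s) j) ⊗ₜ[k] (Q.X2 p * Q.D2 (Q.X1 s) j)) := by
    calc y = (∑ p ∈ range Q.nP, Q.counit (∑ l ∈ range Q.nD,
            Q.counit (Q.D1 (Q.X3 p) l) • Q.D2 (Q.X3 p) l) • (Q.X1 p ⊗ₜ[k] Q.X2 p)) *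
          Q.comul (∑ s ∈ range Q.nP, (Q.counit (Q.X2 s) * Q.counit (Q.X3 s)) • Q.X1 s) := by
          rw [e1, map_one, mul_one]; simp only [Q.counit_l]; rfl
      _ = _ := by
        rw [Finset.sum_mul]
        refine sum_congr rfl fun p _ => ?_
        rw [map_sum Q.comul, mul_sum]
        refine sum_congr rfl fun s _ => ?_
        rw [map_sum, sum_smul, Finset.sum_mul]
        refine sum_congr rfl fun l _ => ?_
        rw [map_smul Q.comul, Q.hcomul, smul_sum, mul_sum]
        refine sum_congr rfl fun j _ => ?_
        simp only [map_smul, smul_smul, smul_mul_assoc, mul_smul_comm, smul_eq_mul,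
          Algebra.TensorProduct.tmul_mul_tmul, map_mul]
        congr 1
        ring
  have hyy : y * y = y := by rw [hl, h, ← hr]
  calc y = L' (psi Q) * y * y := by rw [hinv, one_mul]
    _ = 1 := by rw [mul_assoc, hyy, hinv]

lemma phi_coassoc (h : H) :
    ∑ s ∈ range Q.nP, ∑ i ∈ range Q.nD, ∑ j ∈ range Q.nD,
      (Q.X1 s * Q.D1 (Q.D1 h i) j) ⊗ₜ[k]
        ((Q.X2 s * Q.D2 (Q.D1 h i) j) ⊗ₜ[k] (Q.X3 s * Q.D2 h i)) =
    ∑ i ∈ range Q.nD, ∑ l ∈ range Q.nD, ∑ s ∈ range Q.nP,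
      (Q.D1 h i * Q.X1 s) ⊗ₜ[k]
        ((Q.D1 (Q.D2 h i) l * Q.X2 s) ⊗ₜ[k] (Q.D2 (Q.D2 h i) l * Q.X3 s)) := by
  have key : (∑ s ∈ range Q.nP, ∑ i ∈ range Q.nD, ∑ j ∈ range Q.nD,
      (Q.X1 s * Q.D1 (Q.D1 h i) j) ⊗ₜ[k]
        ((Q.X2 s * Q.D2 (Q.D1 h i) j) ⊗ₜ[k] (Q.X3 s * Q.D2 h i))) * psi Q =
      ∑ i ∈ range Q.nD, ∑ j ∈ range Q.nD,
        Q.D1 h i ⊗ₜ[k] (Q.D1 (Q.D2 h i) j ⊗ₜ[k] Q.D2 (Q.D2 h i) j) := by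
    rw [Q.coassoc]
    simp only [Finset.sum_mul]
    simp only [psi, mul_sum, Algebra.TensorProduct.tmul_mul_tmul]
  have := congrArg (· * phi Q) key
  simp only [mul_assoc, psi_mul_phi, mul_one] at this
  rw [this]
  simp only [Finset.sum_mul]
  simp only [phi, mul_sum, Algebra.TensorProduct.tmul_mul_tmul]

/-- A quasi-bialgebra as a right comodule algebra over itself. -/
def reg : RightComoduleAlgebra Q H where
  rho := Q.comul
  nR := Q.nD
  r0 := Q.D1
  r1 := Q.D2
  hrho := Q.hcomul
  nP := Q.nP
  P1 := Q.X1
  P2 := Q.X2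
  P3 := Q.X3
  nQ := Q.nQ
  Q1 := Q.x1
  Q2 := Q.x2
  Q3 := Q.x3
  P_inv := Q.P_inv
  inv_P := Q.inv_P
  rca1 := phi_coassoc Q
  rca2 := by
    rw [Q.pentagon]
    exact sum_congr rfl fun p _ => sum_comm
  rca3 := Q.counit_r
  rca4a := Q.normal
  rca4b := counit_right_phi Q

@[simp] lemma reg_nR : (reg Q).nR = Q.nD := rfl
@[simp] lemma reg_r0 : (reg Q).r0 = Q.D1 := rfl
@[simp] lemma reg_r1 : (reg Q).r1 = Q.D2 := rfl
@[simp] lemma reg_nP : (reg Q).nP = Q.nP := rfl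
@[simp] lemma reg_P1 : (reg Q).P1 = Q.X1 := rfl
@[simp] lemma reg_P2 : (reg Q).P2 = Q.X2 := rfl
@[simp] lemma reg_P3 : (reg Q).P3 = Q.X3 := rfl
@[simp] lemma reg_nQ : (reg Q).nQ = Q.nQ := rfl
@[simp] lemma reg_Q1 : (reg Q).Q1 = Q.x1 := rfl
@[simp] lemma reg_Q2 : (reg Q).Q2 = Q.x2 := rfl
@[simp] lemma reg_Q3 : (reg Q).Q3 = Q.x3 := rfl

end Regular

section Coaction

variable {k : Type*} [Field k] {H : Type*} [Ring H] [Algebra k H] {Q : QuasiBialgebra k H}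
  {A : Type*} [Ring A] [Algebra k A] (CA : RightComoduleAlgebra Q A)
  {B : Type*} [Ring B] [Algebra k B]

/-- The element `Φ_ρ`. -/
def cphi : A ⊗[k] (H ⊗[k] H) := ∑ s ∈ range CA.nP, CA.P1 s ⊗ₜ[k] (CA.P2 s ⊗ₜ[k] CA.P3 s)

/-- The inverse of `Φ_ρ`. -/
def cpsi : A ⊗[k] (H ⊗[k] H) := ∑ s ∈ range CA.nQ, CA.Q1 s ⊗ₜ[k] (CA.Q2 s ⊗ₜ[k] CA.Q3 s)

lemma cphi_mul_cpsi : cphi CA * cpsi CA = 1 := by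
  rw [cphi, cpsi, sum_mul_sum]
  simp only [Algebra.TensorProduct.tmul_mul_tmul]
  exact CA.P_inv

lemma cpsi_mul_cphi : cpsi CA * cphi CA = 1 := by
  rw [cphi, cpsi, sum_mul_sum]
  simp only [Algebra.TensorProduct.tmul_mul_tmul]
  exact CA.inv_P

/-- The algebra map `x ↦ r(x₀) a(x₁)`. -/
def star (r : A →ₐ[k] B) (a : H →ₐ[k] B) [CommH r a] : A →ₐ[k] B :=
  (lift2 r a).comp CA.rho

lemma star_apply (r : A →ₐ[k] B) (a : H →ₐ[k] B) [CommH r a] (x : A) :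
    star CA r a x = lift2 r a (CA.rho x) := rfl

lemma star_sum (r : A →ₐ[k] B) (a : H →ₐ[k] B) [CommH r a] (x : A) :
    star CA r a x = ∑ i ∈ range CA.nR, r (CA.r0 x i) * a (CA.r1 x i) := by
  rw [star_apply, CA.hrho, map_sum]; rfl

/-- The image of `Φ_ρ` under three commuting algebra maps. -/
def Phi (r : A →ₐ[k] B) (a b : H →ₐ[k] B) [CommH r a] [CommH r b] [CommH a b] : B :=
  lift2 r (lift2 a b) (cphi CA)

/-- The image of the inverse of `Φ_ρ` under three commuting algebra maps. -/
def Psi (r : A →ₐ[k] B) (a b : H →ₐ[k] B) [CommH r a] [CommH r b] [CommH a b] : B :=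
  lift2 r (lift2 a b) (cpsi CA)

section
variable {G : Type*} [Ring G] [Algebra k G] (c : G →ₐ[k] B)
  (r : A →ₐ[k] B) (a b : H →ₐ[k] B) [CommH r a] [CommH r b] [CommH a b]

instance [CommH c r] [CommH c a] : CommH c (star CA r a) :=
  ⟨fun x y => (commW_lift2 c r a _).comm x⟩

instance [CommH c r] [CommH c a] [CommH c b] : CommW c (Phi CA r a b) :=
  commW_lift2 c r (lift2 a b) _

instance [CommH c r] [CommH c a] [CommH c b] : CommW c (Psi CA r a b) :=
  commW_lift2 c r (lift2 a b) _

lemma Phi_sum : Phi CA r a b =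
    ∑ s ∈ range CA.nP, r (CA.P1 s) * (a (CA.P2 s) * b (CA.P3 s)) := by
  rw [Phi, cphi, map_sum]; rfl

lemma Psi_sum : Psi CA r a b =
    ∑ s ∈ range CA.nQ, r (CA.Q1 s) * (a (CA.Q2 s) * b (CA.Q3 s)) := by
  rw [Psi, cpsi, map_sum]; rfl

@[simp] lemma Phi_mul_Psi : Phi CA r a b * Psi CA r a b = 1 := by
  rw [Phi, Psi, ← map_mul, cphi_mul_cpsi, map_one]

@[simp] lemma Psi_mul_Phi : Psi CA r a b * Phi CA r a b = 1 := by
  rw [Phi, Psi, ← map_mul, cpsi_mul_cphi, map_one]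

@[simp] lemma Phi_mul_Psi_mul (z : B) : Phi CA r a b * (Psi CA r a b * z) = z := by
  rw [← mul_assoc, Phi_mul_Psi, one_mul]

@[simp] lemma Psi_mul_Phi_mul (z : B) : Psi CA r a b * (Phi CA r a b * z) = z := by
  rw [← mul_assoc, Psi_mul_Phi, one_mul]

lemma Phi_intertw :
    Intertw (Phi CA r a b) (star CA (star CA r a) b) (star CA r (star (reg Q) a b)) := by
  intro x
  have h := congrArg (lift2 r (lift2 a b)) (CA.rca1 x)
  simp only [map_sum, lift2_tmul, map_mul] at h
  have hl : Phi CA r a b * star CA (star CA r a) b x = ∑ s ∈ range CA.nP, ∑ i ∈ range CA.nR,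
      ∑ j ∈ range CA.nR, r (CA.P1 s) * r (CA.r0 (CA.r0 x i) j) *
        (a (CA.P2 s) * a (CA.r1 (CA.r0 x i) j) * (b (CA.P3 s) * b (CA.r1 x i))) := by
    rw [Phi_sum, Finset.sum_mul, star_sum]
    simp only [mul_sum, star_sum, Finset.sum_mul]
    simp only [mul_assoc, CommH.swap r a, CommH.swap_mul r a, CommH.swap r b, CommH.swap_mul r b,
      CommH.swap a b, CommH.swap_mul a b]
  have hr : star CA r (star (reg Q) a b) x * Phi CA r a b = ∑ i ∈ range CA.nR,
      ∑ l ∈ range Q.nD, ∑ s ∈ range CA.nP, r (CA.r0 x i) * r (CA.P1 s) *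
        (a (Q.D1 (CA.r1 x i) l) * a (CA.P2 s) * (b (Q.D2 (CA.r1 x i) l) * b (CA.P3 s))) := by
    rw [star_sum, Finset.sum_mul]
    refine sum_congr rfl fun i _ => ?_
    rw [star_sum, mul_sum, Finset.sum_mul]
    refine sum_congr rfl fun l _ => ?_
    rw [Phi_sum, mul_sum]
    simp only [mul_assoc, CommH.swap r a, CommH.swap_mul r a, CommH.swap r b, CommH.swap_mul r b,
      CommH.swap a b, CommH.swap_mul a b]
    rfl
  rw [hl, hr, h]

lemma pentagon (c : H →ₐ[k] B) [CommH r c] [CommH a c] [CommH b c] :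
    Phi (reg Q) a b c * (Phi CA r (star (reg Q) a b) c * Phi CA r a b) =
      Phi CA r a (star (reg Q) b c) * Phi CA (star CA r a) b c := by
  have h := congrArg (lift2 r (lift2 a (lift2 b c))) CA.rca2
  simp only [map_sum, lift2_tmul, map_mul] at h
  have hl : Phi (reg Q) a b c * (Phi CA r (star (reg Q) a b) c * Phi CA r a b) =
      ∑ s ∈ range Q.nP, ∑ i ∈ range CA.nP, ∑ l ∈ range Q.nD, ∑ j ∈ range CA.nP,
      r (CA.P1 i) * r (CA.P1 j) * (a (Q.X1 s) * a (Q.D1 (CA.P2 i) l) * a (CA.P2 j) *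
        (b (Q.X2 s) * b (Q.D2 (CA.P2 i) l) * b (CA.P3 j) * (c (Q.X3 s) * c (CA.P3 i)))) := by
    rw [Phi_sum (reg Q), Finset.sum_mul, Phi_sum CA r _ c]
    refine sum_congr rfl fun s _ => ?_
    rw [Finset.sum_mul, mul_sum]
    refine sum_congr rfl fun i _ => ?_
    rw [star_sum, Finset.sum_mul, mul_sum, Finset.sum_mul, mul_sum]
    refine sum_congr rfl fun l _ => ?_
    rw [Phi_sum, mul_sum, mul_sum]
    simp only [mul_assoc, CommH.swap r a, CommH.swap_mul r a, CommH.swap r b, CommH.swap_mul r b,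
      CommH.swap a b, CommH.swap_mul a b, CommH.swap r c, CommH.swap_mul r c, CommH.swap a c,
      CommH.swap_mul a c, CommH.swap b c, CommH.swap_mul b c]
    rfl
  have hr : Phi CA r a (star (reg Q) b c) * Phi CA (star CA r a) b c =
      ∑ i ∈ range CA.nP, ∑ l ∈ range Q.nD, ∑ j ∈ range CA.nP, ∑ u ∈ range CA.nR,
      r (CA.P1 i) * r (CA.r0 (CA.P1 j) u) * (a (CA.P2 i) * a (CA.r1 (CA.P1 j) u) *
        (b (Q.D1 (CA.P3 i) l) * b (CA.P2 j) * (c (Q.D2 (CA.P3 i) l) * c (CA.P3 j)))) := by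
    rw [Phi_sum CA r, Finset.sum_mul]
    refine sum_congr rfl fun i _ => ?_
    rw [star_sum, mul_sum, mul_sum, Finset.sum_mul]
    refine sum_congr rfl fun l _ => ?_
    rw [Phi_sum, mul_sum]
    refine sum_congr rfl fun j _ => ?_
    rw [star_sum, Finset.sum_mul, mul_sum]
    simp only [mul_assoc, CommH.swap r a, CommH.swap_mul r a, CommH.swap r b, CommH.swap_mul r b,
      CommH.swap a b, CommH.swap_mul a b, CommH.swap r c, CommH.swap_mul r c, CommH.swap a c,
      CommH.swap_mul a c, CommH.swap b c, CommH.swap_mul b c]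
    rfl
  rw [hl, hr, h]
end

end Coaction
section Slots

variable {k : Type*} [Field k] {B : Type*} [Ring B] [Algebra k B]
  {G : Type*} [Ring G] [Algebra k G] {G' : Type*} [Ring G'] [Algebra k G']
  {C : Type*} [Ring C] [Algebra k C]

/-- Composition with the inclusion of the left tensor factor. -/
def inl (C : Type*) [Ring C] [Algebra k C] (f : G →ₐ[k] B) : G →ₐ[k] B ⊗[k] C :=
  Algebra.TensorProduct.includeLeft.comp f

/-- Composition with the inclusion of the right tensor factor. -/
def inr (C : Type*) [Ring C] [Algebra k C] (f : G →ₐ[k] B) : G →ₐ[k] C ⊗[k] B :=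
  Algebra.TensorProduct.includeRight.comp f

@[simp] lemma inl_apply (f : G →ₐ[k] B) (x : G) : inl C f x = f x ⊗ₜ[k] (1 : C) := rfl

@[simp] lemma inr_apply (f : G →ₐ[k] B) (x : G) : inr C f x = (1 : C) ⊗ₜ[k] f x := rfl

instance (f : G →ₐ[k] B) (g : G' →ₐ[k] C) : CommH (inl C f) (inr B g) :=
  ⟨fun x y => by simp [commute_iff_eq]⟩

instance (f : G →ₐ[k] B) (g : G' →ₐ[k] B) [h : CommH f g] : CommH (inl C f) (inl C g) :=
  ⟨fun x y => by simp [commute_iff_eq, (h.comm x y).eq]⟩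

instance (f : G →ₐ[k] B) (g : G' →ₐ[k] B) [h : CommH f g] : CommH (inr C f) (inr C g) :=
  ⟨fun x y => by simp [commute_iff_eq, (h.comm x y).eq]⟩

instance (p : B →ₐ[k] C) (f : G →ₐ[k] B) (g : G' →ₐ[k] B) [h : CommH f g] :
    CommH (p.comp f) (p.comp g) :=
  ⟨fun x y => (h.comm x y).map p⟩

lemma map_lift2 (p : B →ₐ[k] C) (f : G →ₐ[k] B) (g : G' →ₐ[k] B) [CommH f g] (t : G ⊗[k] G') :
    p (lift2 f g t) = lift2 (p.comp f) (p.comp g) t := by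
  have : p.comp (lift2 f g) = lift2 (p.comp f) (p.comp g) := by
    ext <;> simp
  exact DFunLike.congr_fun this t

end Slots

section Calculus

variable {k : Type*} [Field k] {H : Type*} [Ring H] [Algebra k H] {Q : QuasiBialgebra k H}
  {A : Type*} [Ring A] [Algebra k A] {CA : RightComoduleAlgebra Q A}
  {B : Type*} [Ring B] [Algebra k B]

section Functoriality
variable {C : Type*} [Ring C] [Algebra k C] (p : B →ₐ[k] C)
  (r : A →ₐ[k] B) (a b : H →ₐ[k] B) [CommH r a] [CommH r b] [CommH a b]

lemma comp_star : p.comp (star CA r a) = star CA (p.comp r) (p.comp a) := by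
  ext x; exact map_lift2 p r a _

lemma map_Phi : p (Phi CA r a b) = Phi CA (p.comp r) (p.comp a) (p.comp b) := by
  simp only [Phi_sum, map_sum, map_mul]; rfl

lemma map_Psi : p (Psi CA r a b) = Psi CA (p.comp r) (p.comp a) (p.comp b) := by
  simp only [Psi_sum, map_sum, map_mul]; rfl

end Functoriality

section Naturality
variable {P : B} {r r' : A →ₐ[k] B} {a a' b b' : H →ₐ[k] B} [CommH r a] [CommH r' a']

lemma Intertw.star (hr : Intertw P r r') (ha : Intertw P a a') :
    Intertw P (star CA r a) (QuasiHopf.star CA r' a') :=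
  fun x => Intertw.lift2 hr ha (CA.rho x)

variable [CommH r b] [CommH a b] [CommH r' b'] [CommH a' b']

lemma Intertw.Phi (hr : Intertw P r r') (ha : Intertw P a a') (hb : Intertw P b b') :
    P * Phi CA r a b = QuasiHopf.Phi CA r' a' b' * P :=
  Intertw.lift2 hr (fun t => Intertw.lift2 ha hb t) _

lemma Intertw.Psi (hr : Intertw P r r') (ha : Intertw P a a') (hb : Intertw P b b') :
    P * Psi CA r a b = QuasiHopf.Psi CA r' a' b' * P :=
  Intertw.lift2 hr (fun t => Intertw.lift2 ha hb t) _

end Naturality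

section
variable (r : A →ₐ[k] B) (a b c : H →ₐ[k] B) [CommH r a] [CommH r b] [CommH a b]

variable (CA) in
lemma Psi_intertw :
    Intertw (Psi CA r a b) (star CA r (star (reg Q) a b)) (star CA (star CA r a) b) := by
  intro x
  have h := congrArg (fun t => Psi CA r a b * t * Psi CA r a b) (Phi_intertw CA r a b x)
  simp only [mul_assoc, Phi_mul_Psi, mul_one, Psi_mul_Phi_mul] at h
  exact h.symm

variable (CA) in
lemma pentagon_inv [CommH r c] [CommH a c] [CommH b c] :
    Psi CA r a b * (Psi CA r (star (reg Q) a b) c * Psi (reg Q) a b c) =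
      Psi CA (star CA r a) b c * Psi CA r a (star (reg Q) b c) := by
  have h := pentagon CA r a b c
  have e1 : (Psi CA r a b * (Psi CA r (star (reg Q) a b) c * Psi (reg Q) a b c)) *
      (Phi (reg Q) a b c * (Phi CA r (star (reg Q) a b) c * Phi CA r a b)) = 1 := by
    simp only [mul_assoc, Psi_mul_Phi_mul, Psi_mul_Phi]
  rw [h] at e1
  have h2 := congrArg (· * (Psi CA (star CA r a) b c * Psi CA r a (star (reg Q) b c))) e1
  simpa only [mul_assoc, Phi_mul_Psi_mul, Phi_mul_Psi, mul_one, one_mul] using h2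

variable (CA) in
lemma star_eta : star CA r (eta Q B) = r := by
  ext x
  rw [star_sum]
  conv_rhs => rw [← CA.rca3 x, map_sum]
  refine sum_congr rfl fun i _ => ?_
  rw [eta_apply, ← Algebra.commutes, ← Algebra.smul_def, map_smul]

lemma eta_star : star (reg Q) (eta Q B) a = a := by
  ext x
  rw [star_sum]
  conv_rhs => rw [← Q.counit_l x, map_sum]
  refine sum_congr rfl fun i _ => ?_
  rw [eta_apply, ← Algebra.smul_def, map_smul]
  rfl

variable (CA) in
lemma Phi_eta_mid : Phi CA r (eta Q B) b = 1 := by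
  have h := congrArg (lift2 r b) CA.rca4a
  simp only [map_sum, map_smul, lift2_tmul, map_one, mul_one] at h
  rw [Phi_sum, ← h]
  refine sum_congr rfl fun i _ => ?_
  rw [eta_apply, ← Algebra.smul_def, mul_smul_comm]

variable (CA) in
lemma Phi_eta_right : Phi CA r a (eta Q B) = 1 := by
  have h := congrArg (lift2 r a) CA.rca4b
  simp only [map_sum, map_smul, lift2_tmul, map_one, mul_one] at h
  rw [Phi_sum, ← h]
  refine sum_congr rfl fun i _ => ?_
  rw [eta_apply, ← Algebra.commutes, ← Algebra.smul_def, mul_smul_comm]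

lemma Phi_eta_left : Phi (reg Q) (eta Q B) a b = 1 := by
  have h := pentagon (reg Q) (eta Q B) (eta Q B) a b
  simp only [eta_star, star_eta] at h
  rw [Phi_eta_mid, mul_one] at h
  have h2 := congrArg (Psi (reg Q) (eta Q B) a b * ·) h
  simp only [Psi_mul_Phi_mul, Psi_mul_Phi, Phi_eta_mid, one_mul] at h2
  exact h2

variable (CA) in
lemma Psi_eta_mid : Psi CA r (eta Q B) b = 1 := by
  rw [← Psi_mul_Phi CA r (eta Q B) b, Phi_eta_mid, mul_one]

variable (CA) in
lemma Psi_eta_right : Psi CA r a (eta Q B) = 1 := by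
  rw [← Psi_mul_Phi CA r a (eta Q B), Phi_eta_right, mul_one]

lemma Psi_eta_left : Psi (reg Q) (eta Q B) a b = 1 := by
  rw [← Psi_mul_Phi (reg Q) (eta Q B) a b, Phi_eta_left, mul_one]

end

section Replacement
variable {N : Type*} [AddCommGroup N] [Module k N] {E : B →ₗ[k] N}

section Star
variable {r r' : A →ₐ[k] B} {a a' : H →ₐ[k] B}

lemma EqR.star_left [CommH r a] [CommH r' a] (h : EqR E r r') :
    EqR E (star CA r a) (star CA r' a) := fun _ z => h.fst _ z

lemma EqR.star_right [CommH r a] [CommH r a'] (h : EqR E a a') :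
    EqR E (star CA r a) (star CA r a') := fun _ z => h.snd _ z

lemma EqL.star_left [CommH r a] [CommH r' a] (h : EqL E r r') :
    EqL E (star CA r a) (star CA r' a) := fun _ z => h.fst _ z

lemma EqL.star_right [CommH r a] [CommH r a'] (h : EqL E a a') :
    EqL E (star CA r a) (star CA r a') := fun _ z => h.snd _ z

lemma EqR.star_absorb_right [CommH r a] (h : EqR E a (eta Q B)) : EqR E (star CA r a) r := by
  have := h.star_right (CA := CA) (r := r)
  rwa [star_eta] at this

lemma EqL.star_absorb_left {u : H →ₐ[k] B} [CommH u a] (h : EqL E u (eta Q B)) :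
    EqL E (star (reg Q) u a) a := by
  have := h.star_left (CA := reg Q) (a := a)
  rwa [eta_star] at this

lemma EqL.star_absorb_right [CommH r a] (h : EqL E a (eta Q B)) : EqL E (star CA r a) r := by
  have := h.star_right (CA := CA) (r := r)
  rwa [star_eta] at this

end Star

lemma EqR.Phi_left {r r' : A →ₐ[k] B} {a b : H →ₐ[k] B} [CommH r a] [CommH r b] [CommH a b]
    [CommH r' a] [CommH r' b] (h : EqR E r r') (z : B) :
    E (z * Phi CA r a b) = E (z * Phi CA r' a b) := h.fst _ z

lemma EqR.Phi_mid {r : A →ₐ[k] B} {a a' b : H →ₐ[k] B} [CommH r a] [CommH r b] [CommH a b]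
    [CommH r a'] [CommH a' b] (h : EqR E a a') (z : B) :
    E (z * Phi CA r a b) = E (z * Phi CA r a' b) :=
  EqR.snd (fun t z => h.fst t z) _ z

lemma EqR.Phi_right {r : A →ₐ[k] B} {a b b' : H →ₐ[k] B} [CommH r a] [CommH r b] [CommH a b]
    [CommH r b'] [CommH a b'] (h : EqR E b b') (z : B) :
    E (z * Phi CA r a b) = E (z * Phi CA r a b') :=
  EqR.snd (fun t z => h.snd t z) _ z

lemma EqR.Phi_absorb_left {r a b : H →ₐ[k] B} [CommH r a] [CommH r b] [CommH a b]
    (h : EqR E r (eta Q B)) (z : B) : E (z * Phi (reg Q) r a b) = E z := by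
  rw [h.Phi_left, Phi_eta_left, mul_one]

lemma EqR.Phi_absorb_mid {r : A →ₐ[k] B} {a b : H →ₐ[k] B} [CommH r a] [CommH r b] [CommH a b]
    (h : EqR E a (eta Q B)) (z : B) : E (z * Phi CA r a b) = E z := by
  rw [h.Phi_mid, Phi_eta_mid, mul_one]

lemma EqR.Phi_absorb_right {r : A →ₐ[k] B} {a b : H →ₐ[k] B} [CommH r a] [CommH r b] [CommH a b]
    (h : EqR E b (eta Q B)) (z : B) : E (z * Phi CA r a b) = E z := by
  rw [h.Phi_right, Phi_eta_right, mul_one]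

lemma EqR.Psi_left {r r' : A →ₐ[k] B} {a b : H →ₐ[k] B} [CommH r a] [CommH r b] [CommH a b]
    [CommH r' a] [CommH r' b] (h : EqR E r r') (z : B) :
    E (z * Psi CA r a b) = E (z * Psi CA r' a b) := h.fst _ z

lemma EqR.Psi_mid {r : A →ₐ[k] B} {a a' b : H →ₐ[k] B} [CommH r a] [CommH r b] [CommH a b]
    [CommH r a'] [CommH a' b] (h : EqR E a a') (z : B) :
    E (z * Psi CA r a b) = E (z * Psi CA r a' b) :=
  EqR.snd (fun t z => h.fst t z) _ z

lemma EqR.Psi_right {r : A →ₐ[k] B} {a b b' : H →ₐ[k] B} [CommH r a] [CommH r b] [CommH a b]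
    [CommH r b'] [CommH a b'] (h : EqR E b b') (z : B) :
    E (z * Psi CA r a b) = E (z * Psi CA r a b') :=
  EqR.snd (fun t z => h.snd t z) _ z

lemma EqR.Psi_absorb_left {r a b : H →ₐ[k] B} [CommH r a] [CommH r b] [CommH a b]
    (h : EqR E r (eta Q B)) (z : B) : E (z * Psi (reg Q) r a b) = E z := by
  rw [h.Psi_left, Psi_eta_left, mul_one]

lemma EqR.Psi_absorb_mid {r : A →ₐ[k] B} {a b : H →ₐ[k] B} [CommH r a] [CommH r b] [CommH a b]
    (h : EqR E a (eta Q B)) (z : B) : E (z * Psi CA r a b) = E z := by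
  rw [h.Psi_mid, Psi_eta_mid, mul_one]

lemma EqR.Psi_absorb_right {r : A →ₐ[k] B} {a b : H →ₐ[k] B} [CommH r a] [CommH r b] [CommH a b]
    (h : EqR E b (eta Q B)) (z : B) : E (z * Psi CA r a b) = E z := by
  rw [h.Psi_right, Psi_eta_right, mul_one]

lemma EqL.Phi_mid {r : A →ₐ[k] B} {a a' b : H →ₐ[k] B} [CommH r a] [CommH r b] [CommH a b]
    [CommH r a'] [CommH a' b] (h : EqL E a a') (z : B) :
    E (Phi CA r a b * z) = E (Phi CA r a' b * z) :=
  EqL.snd (fun t z => h.fst t z) _ z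

lemma EqL.Phi_right {r : A →ₐ[k] B} {a b b' : H →ₐ[k] B} [CommH r a] [CommH r b] [CommH a b]
    [CommH r b'] [CommH a b'] (h : EqL E b b') (z : B) :
    E (Phi CA r a b * z) = E (Phi CA r a b' * z) :=
  EqL.snd (fun t z => h.snd t z) _ z

lemma EqL.Phi_absorb_mid {r : A →ₐ[k] B} {a b : H →ₐ[k] B} [CommH r a] [CommH r b] [CommH a b]
    (h : EqL E a (eta Q B)) (z : B) : E (Phi CA r a b * z) = E z := by
  rw [h.Phi_mid, Phi_eta_mid, one_mul]

lemma EqL.Phi_absorb_right {r : A →ₐ[k] B} {a b : H →ₐ[k] B} [CommH r a] [CommH r b] [CommH a b]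
    (h : EqL E b (eta Q B)) (z : B) : E (Phi CA r a b * z) = E z := by
  rw [h.Phi_right, Phi_eta_right, one_mul]

lemma EqL.Psi_left {r r' : A →ₐ[k] B} {a b : H →ₐ[k] B} [CommH r a] [CommH r b] [CommH a b]
    [CommH r' a] [CommH r' b] (h : EqL E r r') (z : B) :
    E (Psi CA r a b * z) = E (Psi CA r' a b * z) := h.fst _ z

lemma EqL.Psi_mid {r : A →ₐ[k] B} {a a' b : H →ₐ[k] B} [CommH r a] [CommH r b] [CommH a b]
    [CommH r a'] [CommH a' b] (h : EqL E a a') (z : B) :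
    E (Psi CA r a b * z) = E (Psi CA r a' b * z) :=
  EqL.snd (fun t z => h.fst t z) _ z

lemma EqL.Psi_right {r : A →ₐ[k] B} {a b b' : H →ₐ[k] B} [CommH r a] [CommH r b] [CommH a b]
    [CommH r b'] [CommH a b'] (h : EqL E b b') (z : B) :
    E (Psi CA r a b * z) = E (Psi CA r a b' * z) :=
  EqL.snd (fun t z => h.snd t z) _ z

lemma EqL.Psi_absorb_left {r a b : H →ₐ[k] B} [CommH r a] [CommH r b] [CommH a b]
    (h : EqL E r (eta Q B)) (z : B) : E (Psi (reg Q) r a b * z) = E z := by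
  rw [h.Psi_left, Psi_eta_left, one_mul]

lemma EqL.Psi_absorb_mid {r : A →ₐ[k] B} {a b : H →ₐ[k] B} [CommH r a] [CommH r b] [CommH a b]
    (h : EqL E a (eta Q B)) (z : B) : E (Psi CA r a b * z) = E z := by
  rw [h.Psi_mid, Psi_eta_mid, one_mul]

lemma EqL.Psi_absorb_right {r : A →ₐ[k] B} {a b : H →ₐ[k] B} [CommH r a] [CommH r b] [CommH a b]
    (h : EqL E b (eta Q B)) (z : B) : E (Psi CA r a b * z) = E z := by
  rw [h.Psi_right, Psi_eta_right, one_mul]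

end Replacement
end Calculus
section Words

variable {k : Type*} [Field k] {H : Type*} [Ring H] [Algebra k H] (Q : QuasiBialgebra k H)
  {B : Type*} [Ring B] [Algebra k B] {X : Type*} [Ring X] [Algebra k X]

/-- The linear map `u ↦ x f(u)`. -/
def pre (x : B) (f : H →ₗ[k] B) : H →ₗ[k] B := LinearMap.mulLeft k x ∘ₗ f

@[simp] lemma pre_apply (x : B) (f : H →ₗ[k] B) (u : H) : pre x f u = x * f u := rfl

/-- The linear map `u ⊗ x ↦ p(u) q(x)`. -/
def wd (p : H →ₗ[k] B) (q : X →ₗ[k] B) : H ⊗[k] X →ₗ[k] B :=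
  LinearMap.mul' k B ∘ₗ TensorProduct.map p q

@[simp] lemma wd_tmul (p : H →ₗ[k] B) (q : X →ₗ[k] B) (u : H) (x : X) :
    wd p q (u ⊗ₜ x) = p u * q x := rfl

/-- Left multiplication by a coproduct is absorbed by the word `p(u) q(v)`. -/
def AbsL (p q : H →ₗ[k] B) : Prop := ∀ h u v,
  ∑ j ∈ range Q.nD, p (Q.D1 h j * u) * q (Q.D2 h j * v) = Q.counit h • (p u * q v)

/-- Right multiplication by a coproduct is absorbed by the word `p(u) q(v)`. -/
def AbsR (p q : H →ₗ[k] B) : Prop := ∀ h u v,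
  ∑ j ∈ range Q.nD, p (u * Q.D1 h j) * q (v * Q.D2 h j) = Q.counit h • (p u * q v)

variable {Q}

lemma EqL.of_linearMap {Y N : Type*} [Ring Y] [Algebra k Y] [AddCommGroup N] [Module k N]
    {E : Y →ₗ[k] N} {f g : H →ₐ[k] Y}
    (h : ∀ x, E ∘ₗ LinearMap.mulLeft k (f x) = E ∘ₗ LinearMap.mulLeft k (g x)) : EqL E f g :=
  fun x z => LinearMap.congr_fun (h x) z

lemma EqR.of_linearMap {Y N : Type*} [Ring Y] [Algebra k Y] [AddCommGroup N] [Module k N]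
    {E : Y →ₗ[k] N} {f g : H →ₐ[k] Y}
    (h : ∀ x, E ∘ₗ LinearMap.mulRight k (f x) = E ∘ₗ LinearMap.mulRight k (g x)) : EqR E f g :=
  fun x z => LinearMap.congr_fun (h x) z

lemma AbsL.eqL {p q : H →ₗ[k] B} (h : AbsL Q p q) :
    EqL (wd p q) (star (reg Q) (inl H (AlgHom.id k H)) (inr H (AlgHom.id k H)))
      (eta Q (H ⊗[k] H)) := by
  refine EqL.of_linearMap fun x => TensorProduct.ext' fun u v => ?_
  have := h x u v
  simp only [LinearMap.comp_apply, LinearMap.mulLeft_apply, star_sum, eta_apply, Finset.sum_mul,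
    map_sum, ← Algebra.smul_def, map_smul, wd_tmul]
  simpa [Algebra.TensorProduct.tmul_mul_tmul] using this

lemma AbsL.eqL' {p q : H →ₗ[k] B} (h : AbsL Q p q) (r : X →ₗ[k] B) :
    EqL (wd p (wd q r)) (star (reg Q) (inl (H ⊗[k] X) (AlgHom.id k H))
      (inr H (inl X (AlgHom.id k H)))) (eta Q (H ⊗[k] (H ⊗[k] X))) := by
  refine EqL.of_linearMap fun x => TensorProduct.ext (LinearMap.ext fun u =>
    TensorProduct.ext' fun v y => ?_)
  have := congrArg (· * r y) (h x u v)
  simp only [Finset.sum_mul, smul_mul_assoc, mul_assoc] at this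
  simp only [LinearMap.comp_apply, LinearMap.mulLeft_apply, star_sum, eta_apply, Finset.sum_mul,
    map_sum, ← Algebra.smul_def, map_smul, wd_tmul, LinearMap.compr₂_apply,
    TensorProduct.mk_apply, LinearMap.compr₂ₛₗ_apply]
  simpa [Algebra.TensorProduct.tmul_mul_tmul] using this

lemma AbsR.eqR {p q : H →ₗ[k] B} (h : AbsR Q p q) :
    EqR (wd p q) (star (reg Q) (inl H (AlgHom.id k H)) (inr H (AlgHom.id k H)))
      (eta Q (H ⊗[k] H)) := by
  refine EqR.of_linearMap fun x => TensorProduct.ext' fun u v => ?_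
  have := h x u v
  simp only [LinearMap.comp_apply, LinearMap.mulRight_apply, star_sum, eta_apply, mul_sum,
    map_sum, ← Algebra.commutes, ← Algebra.smul_def, map_smul, wd_tmul]
  simpa [Algebra.TensorProduct.tmul_mul_tmul] using this

lemma AbsR.eqR' {p q : H →ₗ[k] B} (h : AbsR Q p q) (r : X →ₗ[k] B) :
    EqR (wd p (wd q r)) (star (reg Q) (inl (H ⊗[k] X) (AlgHom.id k H))
      (inr H (inl X (AlgHom.id k H)))) (eta Q (H ⊗[k] (H ⊗[k] X))) := by
  refine EqR.of_linearMap fun x => TensorProduct.ext (LinearMap.ext fun u =>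
    TensorProduct.ext' fun v y => ?_)
  have := congrArg (· * r y) (h x u v)
  simp only [Finset.sum_mul, smul_mul_assoc, mul_assoc] at this
  simp only [LinearMap.comp_apply, LinearMap.mulRight_apply, star_sum, eta_apply, mul_sum,
    map_sum, ← Algebra.commutes, ← Algebra.smul_def, map_smul, wd_tmul, LinearMap.compr₂_apply,
    TensorProduct.mk_apply, LinearMap.compr₂ₛₗ_apply]
  simpa [Algebra.TensorProduct.tmul_mul_tmul] using this

lemma inr_star {Y : Type*} [Ring Y] [Algebra k Y] (C : Type*) [Ring C] [Algebra k C]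
    (f g : H →ₐ[k] Y) [CommH f g] :
    star (reg Q) (inr C f) (inr C g) = inr C (star (reg Q) f g) := (comp_star _ _ _).symm

lemma inl_star {Y : Type*} [Ring Y] [Algebra k Y] (C : Type*) [Ring C] [Algebra k C]
    (f g : H →ₐ[k] Y) [CommH f g] :
    star (reg Q) (inl C f) (inl C g) = inl C (star (reg Q) f g) := (comp_star _ _ _).symm

lemma EqL.inr {q : X →ₗ[k] B} {f : H →ₐ[k] X} (h : EqL q f (eta Q X)) (p : H →ₗ[k] B) :
    EqL (wd p q) (inr H f) (eta Q (H ⊗[k] X)) := by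
  refine EqL.of_linearMap fun x => TensorProduct.ext' fun u v => ?_
  have := h x v
  simp only [eta_apply, ← Algebra.smul_def, map_smul] at this
  simp [eta_apply, ← Algebra.smul_def, this]

lemma EqR.inr {q : X →ₗ[k] B} {f : H →ₐ[k] X} (h : EqR q f (eta Q X)) (p : H →ₗ[k] B) :
    EqR (wd p q) (inr H f) (eta Q (H ⊗[k] X)) := by
  refine EqR.of_linearMap fun x => TensorProduct.ext' fun u v => ?_
  have := h x v
  simp only [eta_apply, ← Algebra.commutes, ← Algebra.smul_def, map_smul] at this
  simp [eta_apply, ← Algebra.commutes, ← Algebra.smul_def, this]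

section
variable {X Y M N : Type*} [Ring X] [Algebra k X] [Ring Y] [Algebra k Y] [AddCommGroup M]
  [Module k M] [AddCommGroup N] [Module k N]

lemma EqL.map_inl {p : X →ₗ[k] M} {f : H →ₐ[k] X} (h : EqL p f (eta Q X)) (q : Y →ₗ[k] N) :
    EqL (TensorProduct.map p q) (inl Y f) (eta Q (X ⊗[k] Y)) := by
  refine EqL.of_linearMap fun x => TensorProduct.ext' fun u v => ?_
  have := h x u
  simp only [eta_apply, ← Algebra.smul_def, map_smul] at this
  simp [eta_apply, ← Algebra.smul_def, this, smul_tmul']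

lemma EqL.map_inr {q : Y →ₗ[k] N} {f : H →ₐ[k] Y} (h : EqL q f (eta Q Y)) (p : X →ₗ[k] M) :
    EqL (TensorProduct.map p q) (QuasiHopf.inr X f) (eta Q (X ⊗[k] Y)) := by
  refine EqL.of_linearMap fun x => TensorProduct.ext' fun u v => ?_
  have := h x v
  simp only [eta_apply, ← Algebra.smul_def, map_smul] at this
  simp [eta_apply, ← Algebra.smul_def, this, smul_tmul']

lemma EqR.map_inl {p : X →ₗ[k] M} {f : H →ₐ[k] X} (h : EqR p f (eta Q X)) (q : Y →ₗ[k] N) :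
    EqR (TensorProduct.map p q) (inl Y f) (eta Q (X ⊗[k] Y)) := by
  refine EqR.of_linearMap fun x => TensorProduct.ext' fun u v => ?_
  have := h x u
  simp only [eta_apply, ← Algebra.commutes, ← Algebra.smul_def, map_smul] at this
  simp [eta_apply, ← Algebra.commutes, ← Algebra.smul_def, this, smul_tmul']

lemma EqR.map_inr {q : Y →ₗ[k] N} {f : H →ₐ[k] Y} (h : EqR q f (eta Q Y)) (p : X →ₗ[k] M) :
    EqR (TensorProduct.map p q) (QuasiHopf.inr X f) (eta Q (X ⊗[k] Y)) := by
  refine EqR.of_linearMap fun x => TensorProduct.ext' fun u v => ?_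
  have := h x v
  simp only [eta_apply, ← Algebra.commutes, ← Algebra.smul_def, map_smul] at this
  simp [eta_apply, ← Algebra.commutes, ← Algebra.smul_def, this, smul_tmul']
end

end Words
section Comparison

variable {k : Type*} [Field k] {H : Type*} [Ring H] [Algebra k H] {Q : QuasiBialgebra k H}
  {B : Type*} [Ring B] [Algebra k B]

variable (k H) in
/-- The first inclusion into a triple tensor power. -/
abbrev tri1 : H →ₐ[k] H ⊗[k] (H ⊗[k] H) := inl (H ⊗[k] H) (AlgHom.id k H)

variable (k H) in
/-- The second inclusion into a triple tensor power. -/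
abbrev tri2 : H →ₐ[k] H ⊗[k] (H ⊗[k] H) := inr H (inl H (AlgHom.id k H))

variable (k H) in
/-- The third inclusion into a triple tensor power. -/
abbrev tri3 : H →ₐ[k] H ⊗[k] (H ⊗[k] H) := inr H (inr H (AlgHom.id k H))

lemma Psi_tri : Psi (reg Q) (tri1 k H) (tri2 k H) (tri3 k H) = psi Q := by
  rw [Psi_sum, psi]; simp [Algebra.TensorProduct.tmul_mul_tmul]

lemma Phi_tri : Phi (reg Q) (tri1 k H) (tri2 k H) (tri3 k H) = phi Q := by
  rw [Phi_sum, phi]; simp [Algebra.TensorProduct.tmul_mul_tmul]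

/-- An antipode datum `(T, a, b)` relative to an algebra map `i`. -/
structure Antipode (Q : QuasiBialgebra k H) (i : H →ₐ[k] B) where
  T : H →ₗ[k] B
  T_mul : ∀ g h, T (g * h) = T h * T g
  T_one : T 1 = 1
  a : B
  b : B
  left : ∀ h, ∑ j ∈ range Q.nD, T (Q.D1 h j) * a * i (Q.D2 h j) = Q.counit h • a
  right : ∀ h, ∑ j ∈ range Q.nD, i (Q.D1 h j) * b * T (Q.D2 h j) = Q.counit h • b
  zig : ∑ s ∈ range Q.nP, i (Q.X1 s) * b * T (Q.X2 s) * a * i (Q.X3 s) = 1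

namespace Antipode

variable {i : H →ₐ[k] B} (V W : Antipode Q i)

lemma absL (x : B) : AbsL Q (pre x V.T) (pre V.a i.toLinearMap) := by
  intro h u v
  have := congrArg (fun t => x * V.T u * t * i v) (V.left h)
  simp only [mul_sum, Finset.sum_mul, mul_smul_comm, smul_mul_assoc] at this
  simpa [V.T_mul, mul_assoc] using this

lemma absR (x : B) : AbsR Q (pre x i.toLinearMap) (pre V.b V.T) := by
  intro h u v
  have := congrArg (fun t => x * i u * t * V.T v) (V.right h)
  simp only [mul_sum, Finset.sum_mul, mul_smul_comm, smul_mul_assoc] at this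
  simpa [V.T_mul, mul_assoc] using this

/-- The word `u ⊗ v ⊗ w ↦ T'(u) a' i(v) b T(w)`. -/
def word : H ⊗[k] (H ⊗[k] H) →ₗ[k] B :=
  wd (pre 1 W.T) (wd (pre W.a i.toLinearMap) (pre V.b V.T))

lemma word_tmul (u v w : H) :
    word V W (u ⊗ₜ (v ⊗ₜ w)) = W.T u * W.a * i v * V.b * V.T w := by
  simp [word, mul_assoc]

/-- The element comparing two antipode data. -/
def compare : B := word V W (psi Q)

lemma word_mul_tri1 (h : H) (z : H ⊗[k] (H ⊗[k] H)) :
    word V W (z * tri1 k H h) = W.T h * word V W z := by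
  have : word V W ∘ₗ LinearMap.mulRight k (tri1 k H h) =
      LinearMap.mulLeft k (W.T h) ∘ₗ word V W := by
    ext u v w
    simp [word_tmul, W.T_mul, mul_assoc]
  exact LinearMap.congr_fun this z

lemma word_tri3_mul (h : H) (z : H ⊗[k] (H ⊗[k] H)) :
    word V W (tri3 k H h * z) = word V W z * V.T h := by
  have : word V W ∘ₗ LinearMap.mulLeft k (tri3 k H h) =
      LinearMap.mulRight k (V.T h) ∘ₗ word V W := by
    ext u v w
    simp [word_tmul, V.T_mul, mul_assoc]
  exact LinearMap.congr_fun this z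

lemma compare_mul_T (h : H) : compare V W * V.T h = W.T h * compare V W := by
  have e := congrArg (word V W) (Psi_intertw (reg Q) (tri1 k H) (tri2 k H) (tri3 k H) h)
  have hR : EqR (word V W) (star (reg Q) (tri2 k H) (tri3 k H)) (eta Q _) := by
    rw [inr_star]; exact ((V.absR W.a).eqR).inr _
  have hL : EqL (word V W) (star (reg Q) (tri1 k H) (tri2 k H)) (eta Q _) :=
    (W.absL 1).eqL' _
  rw [hR.star_absorb_right (CA := reg Q), hL.star_absorb_left, word_mul_tri1, word_tri3_mul,
    Psi_tri] at e
  exact e.symm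

section Four

variable (k H) in
/-- The inclusions into a fourfold tensor power. -/
abbrev quad1 : H →ₐ[k] H ⊗[k] (H ⊗[k] (H ⊗[k] H)) := inl (H ⊗[k] (H ⊗[k] H)) (AlgHom.id k H)

lemma compare_mul_a : compare V W * V.a = W.a := by
  set E : H ⊗[k] (H ⊗[k] (H ⊗[k] H)) →ₗ[k] B :=
    wd (pre 1 W.T) (wd (pre W.a i.toLinearMap) (wd (pre V.b V.T) (pre V.a i.toLinearMap))) with hE
  have p := pentagon_inv (reg Q) (quad1 k H) (inr H (tri1 k H)) (inr H (tri2 k H))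
    (inr H (tri3 k H))
  have p' := congrArg (fun t => E (t * Phi (reg Q) (inr H (tri1 k H)) (inr H (tri2 k H))
    (inr H (tri3 k H)))) p
  simp only [mul_assoc, Psi_mul_Phi, mul_one] at p'
  have h12 : EqL E (star (reg Q) (quad1 k H) (inr H (tri1 k H))) (eta Q _) := (W.absL 1).eqL' _
  have h23 : EqR E (star (reg Q) (inr H (tri1 k H)) (inr H (tri2 k H))) (eta Q _) := by
    rw [inr_star]; exact ((V.absR W.a).eqR' _).inr _
  have h34 : EqL E (star (reg Q) (inr H (tri2 k H)) (inr H (tri3 k H))) (eta Q _) := by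
    rw [inr_star, inr_star]; exact (((V.absL V.b).eqL).inr _).inr _
  rw [h23.Psi_absorb_mid (CA := reg Q), h12.Psi_absorb_left, h34.Psi_absorb_right (CA := reg Q)]
    at p'
  have e1 : E (Psi (reg Q) (quad1 k H) (inr H (tri1 k H)) (inr H (tri2 k H))) =
      compare V W * V.a := by
    rw [Psi_sum, compare, psi, map_sum, map_sum, Finset.sum_mul]
    refine sum_congr rfl fun s _ => ?_
    rw [word_tmul]
    simp [hE, Algebra.TensorProduct.tmul_mul_tmul, mul_assoc]
  have e2 : E (Phi (reg Q) (inr H (tri1 k H)) (inr H (tri2 k H)) (inr H (tri3 k H))) = W.a := by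
    have := congrArg (W.a * ·) V.zig
    simp only [mul_sum, mul_one] at this
    rw [Phi_sum, map_sum]
    refine Eq.trans (sum_congr rfl fun s _ => ?_) this
    simp [hE, Algebra.TensorProduct.tmul_mul_tmul, mul_assoc, W.T_one]
  rw [← e1, p', e2]

lemma b_mul_compare : W.b * compare V W = V.b := by
  set E : H ⊗[k] (H ⊗[k] (H ⊗[k] H)) →ₗ[k] B :=
    wd (pre 1 i.toLinearMap) (wd (pre W.b W.T) (wd (pre W.a i.toLinearMap) (pre V.b V.T))) with hE
  have p := pentagon (reg Q) (quad1 k H) (inr H (tri1 k H)) (inr H (tri2 k H))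
    (inr H (tri3 k H))
  have p' := congrArg (fun t => E (Psi (reg Q) (inr H (tri1 k H)) (inr H (tri2 k H))
    (inr H (tri3 k H)) * t)) p
  simp only [Psi_mul_Phi_mul] at p'
  have h12 : EqR E (star (reg Q) (quad1 k H) (inr H (tri1 k H))) (eta Q _) := (W.absR 1).eqR' _
  have h23 : EqL E (star (reg Q) (inr H (tri1 k H)) (inr H (tri2 k H))) (eta Q _) := by
    rw [inr_star]; exact ((W.absL W.b).eqL' _).inr _
  have h34 : EqR E (star (reg Q) (inr H (tri2 k H)) (inr H (tri3 k H))) (eta Q _) := by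
    rw [inr_star, inr_star]; exact (((V.absR W.a).eqR).inr _).inr _
  rw [h23.Phi_absorb_mid (CA := reg Q), ← mul_assoc, h12.Phi_absorb_left,
    h34.Phi_absorb_right (CA := reg Q)] at p'
  have e1 : E (Psi (reg Q) (inr H (tri1 k H)) (inr H (tri2 k H)) (inr H (tri3 k H))) =
      W.b * compare V W := by
    rw [Psi_sum, compare, psi, map_sum, map_sum, mul_sum]
    refine sum_congr rfl fun s _ => ?_
    rw [word_tmul]
    simp [hE, Algebra.TensorProduct.tmul_mul_tmul, mul_assoc]
  have e2 : E (Phi (reg Q) (quad1 k H) (inr H (tri1 k H)) (inr H (tri2 k H))) = V.b := by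
    have := congrArg (· * V.b) W.zig
    simp only [Finset.sum_mul, one_mul] at this
    rw [Phi_sum, map_sum]
    refine Eq.trans (sum_congr rfl fun s _ => ?_) this
    simp [hE, Algebra.TensorProduct.tmul_mul_tmul, mul_assoc, V.T_one]
  rw [← e1, ← p', e2]

end Four

/-- An element intertwining `T` with `T'` is determined by its product with `a`. -/
lemma unique (T' : H → B) (hzig : ∑ s ∈ range Q.nQ, V.T (Q.x1 s) * V.a * i (Q.x2 s) * V.b *
      V.T (Q.x3 s) = 1) {F F' : B} (hF : ∀ h, F * V.T h = T' h * F)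
    (hF' : ∀ h, F' * V.T h = T' h * F') (ha : F * V.a = F' * V.a) : F = F' := by
  have key : ∀ G : B, (∀ h, G * V.T h = T' h * G) → G = ∑ s ∈ range Q.nQ,
      T' (Q.x1 s) * (G * V.a) * (i (Q.x2 s) * V.b * V.T (Q.x3 s)) := by
    intro G hG
    conv_lhs => rw [← mul_one G, ← hzig, mul_sum]
    refine sum_congr rfl fun s _ => ?_
    rw [← mul_assoc (T' _), ← hG]
    simp only [mul_assoc]
  rw [key F hF, key F' hF', ha]

/-- Transport along an algebra map. -/
def map {C : Type*} [Ring C] [Algebra k C] (p : B →ₐ[k] C) : Antipode Q (p.comp i) where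
  T := p.toLinearMap ∘ₗ V.T
  T_mul g h := by simp [V.T_mul]
  T_one := by simp [V.T_one]
  a := p V.a
  b := p V.b
  left h := by
    have := congrArg p (V.left h)
    simpa using this
  right h := by
    have := congrArg p (V.right h)
    simpa using this
  zig := by
    have := congrArg p V.zig
    simpa using this

end Antipode

/-- The antipode of a quasi-Hopf algebra. -/
def base (QH : QuasiHopfAlgebra k H) : Antipode QH.toQuasiBialgebra (AlgHom.id k H) where
  T := QH.S
  T_mul := QH.S_mul
  T_one := QH.S_one
  a := QH.aE
  b := QH.bE
  left := QH.antip_l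
  right := QH.antip_r
  zig := QH.antip_X

end Comparison
section TwistCoherence

variable {k : Type*} [Field k] {H : Type*} [Ring H] [Algebra k H] {Q : QuasiBialgebra k H}
  {B : Type*} [Ring B] [Algebra k B] {N : Type*} [AddCommGroup N] [Module k N]

/-- The canonical map `((12)3)4 ⟵ (12)(34)` followed by `((12)3)4 ⟶ (1(23))4`. -/
def Amix (Q : QuasiBialgebra k H) (a b c d : H →ₐ[k] B) [CommH a b] [CommH a c] [CommH a d]
    [CommH b c] [CommH b d] [CommH c d] : B :=
  Phi (reg Q) a b c * Psi (reg Q) (star (reg Q) a b) c d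

/-- The canonical map `(1(23))4 ⟶ (12)(34)`. -/
def Bmix (Q : QuasiBialgebra k H) (a b c d : H →ₐ[k] B) [CommH a b] [CommH a c] [CommH a d]
    [CommH b c] [CommH b d] [CommH c d] : B :=
  Phi (reg Q) (star (reg Q) a b) c d * Psi (reg Q) a b c

section
variable (a b c d : H →ₐ[k] B) [CommH a b] [CommH a c] [CommH a d]
    [CommH b c] [CommH b d] [CommH c d]

lemma Amix_intertw : Intertw (Amix Q a b c d) (star (reg Q) (star (reg Q) a b) (star (reg Q) c d))
    (star (reg Q) (star (reg Q) a (star (reg Q) b c)) d) := by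
  intro x
  rw [Amix, mul_assoc, Psi_intertw, ← mul_assoc,
    (Intertw.star (Phi_intertw (reg Q) a b c) (Intertw.of_comm _ d)) x, mul_assoc]

lemma Bmix_intertw : Intertw (Bmix Q a b c d)
    (star (reg Q) (star (reg Q) a (star (reg Q) b c)) d)
    (star (reg Q) (star (reg Q) a b) (star (reg Q) c d)) := by
  intro x
  rw [Bmix, mul_assoc, (Intertw.star (Psi_intertw (reg Q) a b c) (Intertw.of_comm _ d)) x,
    ← mul_assoc, Phi_intertw, mul_assoc]

end

variable {E : B →ₗ[k] N} (u₁ v₂ w₁ u₂ v₁ w₂ : H →ₐ[k] B)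
  [CommH u₁ v₂] [CommH u₁ w₁] [CommH u₁ u₂] [CommH u₁ v₁] [CommH u₁ w₂]
  [CommH v₂ w₁] [CommH v₂ u₂] [CommH v₂ v₁] [CommH v₂ w₂]
  [CommH w₁ u₂] [CommH w₁ v₁] [CommH w₁ w₂]
  [CommH u₂ v₁] [CommH u₂ w₂] [CommH v₁ w₂]

lemma twist_zig_coherence
    (r₁ : EqR E (star (reg Q) u₁ v₂) (eta Q B)) (r₂ : EqR E (star (reg Q) u₂ v₁) (eta Q B))
    (l₁ : EqL E (star (reg Q) v₂ w₁) (eta Q B)) (l₂ : EqL E (star (reg Q) v₁ w₂) (eta Q B)) :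
    E (Amix Q v₁ v₂ w₁ w₂ *
      (Phi (reg Q) (star (reg Q) u₁ u₂) (star (reg Q) v₁ v₂) (star (reg Q) w₁ w₂) *
        Bmix Q u₁ u₂ v₁ v₂)) =
    E (Phi (reg Q) u₂ v₁ w₂ * Phi (reg Q) u₁ v₂ w₁) := by
  have p1 := pentagon (reg Q) (star (reg Q) u₁ u₂) v₁ v₂ (star (reg Q) w₁ w₂)
  have p2 := pentagon (reg Q) v₁ v₂ w₁ w₂
  have p3 := pentagon (reg Q) u₁ u₂ v₁ w₂
  have p4 := pentagon (reg Q) u₁ v₂ w₁ w₂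
  have q2 : Phi (reg Q) v₁ v₂ w₁ * (Psi (reg Q) (star (reg Q) v₁ v₂) w₁ w₂ *
      Psi (reg Q) v₁ v₂ (star (reg Q) w₁ w₂)) =
      Psi (reg Q) v₁ (star (reg Q) v₂ w₁) w₂ * Psi (reg Q) v₂ w₁ w₂ := by
    have := congrArg (fun t => Psi (reg Q) v₁ (star (reg Q) v₂ w₁) w₂ * (Psi (reg Q) v₂ w₁ w₂ *
      (t * (Psi (reg Q) (star (reg Q) v₁ v₂) w₁ w₂ *
        Psi (reg Q) v₁ v₂ (star (reg Q) w₁ w₂))))) p2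
    simpa only [mul_assoc, Psi_mul_Phi_mul, Phi_mul_Psi_mul, Phi_mul_Psi, mul_one] using this
  have q1 : Phi (reg Q) (star (reg Q) u₁ u₂) (star (reg Q) v₁ v₂) (star (reg Q) w₁ w₂) *
      Phi (reg Q) (star (reg Q) u₁ u₂) v₁ v₂ = Psi (reg Q) v₁ v₂ (star (reg Q) w₁ w₂) *
      (Phi (reg Q) (star (reg Q) u₁ u₂) v₁ (star (reg Q) v₂ (star (reg Q) w₁ w₂)) *
        Phi (reg Q) (star (reg Q) (star (reg Q) u₁ u₂) v₁) v₂ (star (reg Q) w₁ w₂)) := by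
    rw [← p1, Psi_mul_Phi_mul]
  have q3 : Phi (reg Q) (star (reg Q) u₁ u₂) v₁ w₂ * Psi (reg Q) u₁ u₂ v₁ =
      Psi (reg Q) u₁ u₂ (star (reg Q) v₁ w₂) *
        (Phi (reg Q) u₂ v₁ w₂ * Phi (reg Q) u₁ (star (reg Q) u₂ v₁) w₂) := by
    have := congrArg (fun t => Psi (reg Q) u₁ u₂ (star (reg Q) v₁ w₂) *
      (t * Psi (reg Q) u₁ u₂ v₁)) p3
    simp only [mul_assoc, Psi_mul_Phi_mul, Phi_mul_Psi, mul_one] at this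
    exact this.symm
  have q4 : Psi (reg Q) v₂ w₁ w₂ * Phi (reg Q) u₁ v₂ (star (reg Q) w₁ w₂) =
      Phi (reg Q) u₁ (star (reg Q) v₂ w₁) w₂ *
        (Phi (reg Q) u₁ v₂ w₁ * Psi (reg Q) (star (reg Q) u₁ v₂) w₁ w₂) := by
    have := congrArg (fun t => Psi (reg Q) v₂ w₁ w₂ *
      (t * Psi (reg Q) (star (reg Q) u₁ v₂) w₁ w₂)) p4
    simp only [mul_assoc, Psi_mul_Phi_mul, Phi_mul_Psi, mul_one] at this
    exact this.symm
  have n1 : Psi (reg Q) v₂ w₁ w₂ *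
      Phi (reg Q) (star (reg Q) u₁ u₂) v₁ (star (reg Q) v₂ (star (reg Q) w₁ w₂)) =
      Phi (reg Q) (star (reg Q) u₁ u₂) v₁ (star (reg Q) (star (reg Q) v₂ w₁) w₂) *
        Psi (reg Q) v₂ w₁ w₂ :=
    Intertw.Phi (Intertw.of_comm _ _) (Intertw.of_comm _ _) (Psi_intertw (reg Q) v₂ w₁ w₂)
  have n2 : Psi (reg Q) u₁ u₂ v₁ *
      Phi (reg Q) (star (reg Q) u₁ (star (reg Q) u₂ v₁)) v₂ (star (reg Q) w₁ w₂) =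
      Phi (reg Q) (star (reg Q) (star (reg Q) u₁ u₂) v₁) v₂ (star (reg Q) w₁ w₂) *
        Psi (reg Q) u₁ u₂ v₁ :=
    Intertw.Phi (Psi_intertw (reg Q) u₁ u₂ v₁) (Intertw.of_comm _ _) (Intertw.of_comm _ _)
  have n3 : Psi (reg Q) v₂ w₁ w₂ * Psi (reg Q) u₁ u₂ v₁ =
      Psi (reg Q) u₁ u₂ v₁ * Psi (reg Q) v₂ w₁ w₂ :=
    Intertw.Psi (Intertw.of_comm _ _) (Intertw.of_comm _ _) (Intertw.of_comm _ _)
  have l₁' := l₁.star_absorb_left (a := w₂)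
  have r₂' := r₂.star_absorb_right (CA := reg Q) (r := u₁)
  calc _ = E (Psi (reg Q) v₁ (star (reg Q) v₂ w₁) w₂ * (Phi (reg Q) (star (reg Q) u₁ u₂) v₁
          (star (reg Q) (star (reg Q) v₂ w₁) w₂) * (Psi (reg Q) v₂ w₁ w₂ *
          (Psi (reg Q) u₁ u₂ v₁ *
            Phi (reg Q) (star (reg Q) u₁ (star (reg Q) u₂ v₁)) v₂ (star (reg Q) w₁ w₂))))) := by
        rw [n2, ← mul_assoc (Psi (reg Q) v₂ w₁ w₂), ← mul_assoc (Phi (reg Q) _ _ _), ← mul_assoc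
          (Phi (reg Q) _ _ _), ← n1]
        rw [Amix, Bmix, ← mul_assoc (Phi (reg Q) _ _ _) (Phi (reg Q) _ _ _), q1]
        simp only [mul_assoc]
        rw [← mul_assoc (Psi (reg Q) _ _ _) (Psi (reg Q) _ _ _), ← mul_assoc (Phi (reg Q) _ _ _)
          (Psi (reg Q) _ _ _ * _), q2]
        simp only [mul_assoc]
    _ = E (Phi (reg Q) (star (reg Q) u₁ u₂) v₁ w₂ * (Psi (reg Q) u₁ u₂ v₁ *
          (Psi (reg Q) v₂ w₁ w₂ * Phi (reg Q) u₁ v₂ (star (reg Q) w₁ w₂)))) := by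
        rw [l₁.Psi_absorb_mid (CA := reg Q), l₁'.Phi_right (CA := reg Q)]
        simp only [← mul_assoc]
        rw [r₂'.Phi_left (CA := reg Q)]
        simp only [mul_assoc]
        rw [← mul_assoc (Psi (reg Q) _ _ _) (Psi (reg Q) _ _ _), n3, mul_assoc]
    _ = E (Phi (reg Q) u₂ v₁ w₂ * Phi (reg Q) u₁ (star (reg Q) u₂ v₁) w₂ *
          (Phi (reg Q) u₁ (star (reg Q) v₂ w₁) w₂ * Phi (reg Q) u₁ v₂ w₁)) := by
        rw [← mul_assoc, q3, q4, mul_assoc, l₂.Psi_absorb_right (CA := reg Q)]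
        simp only [← mul_assoc]
        rw [r₁.Psi_absorb_left]
    _ = E (Phi (reg Q) u₂ v₁ w₂ * (Phi (reg Q) u₁ (star (reg Q) v₂ w₁) w₂ *
          Phi (reg Q) u₁ v₂ w₁)) :=
        (r₂.mulRight (Phi (reg Q) u₁ (star (reg Q) v₂ w₁) w₂ *
          Phi (reg Q) u₁ v₂ w₁)).Phi_absorb_mid (CA := reg Q) _
    _ = _ := (l₁.mulLeft (Phi (reg Q) u₂ v₁ w₂)).Phi_absorb_mid (CA := reg Q) _

end TwistCoherence
section Twist

variable {k : Type*} [Field k] {H : Type*} [Ring H] [Algebra k H] (QH : QuasiHopfAlgebra k H)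

/-- The word `u ⊗ v ↦ S(u) α v`. -/
def evw : H ⊗[k] H →ₗ[k] H := wd (pre 1 QH.S) (pre QH.aE LinearMap.id)

/-- The word `u ⊗ v ↦ u β S(v)`. -/
def coevw : H ⊗[k] H →ₗ[k] H := wd (pre 1 LinearMap.id) (pre QH.bE QH.S)

@[simp] lemma evw_tmul (u v : H) : evw QH (u ⊗ₜ v) = QH.S u * (QH.aE * v) := by simp [evw]

@[simp] lemma coevw_tmul (u v : H) : coevw QH (u ⊗ₜ v) = u * (QH.bE * QH.S v) := by simp [coevw]

lemma evw_absorb : EqL (evw QH) (star (reg QH.toQuasiBialgebra) (inl H (AlgHom.id k H))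
    (inr H (AlgHom.id k H))) (eta QH.toQuasiBialgebra _) := ((base QH).absL 1).eqL

lemma coevw_absorb : EqR (coevw QH) (star (reg QH.toQuasiBialgebra) (inl H (AlgHom.id k H))
    (inr H (AlgHom.id k H))) (eta QH.toQuasiBialgebra _) := ((base QH).absR 1).eqR

variable (k H) in
/-- The tensor square of the tensor square of `H`. -/
abbrev Sq := (H ⊗[k] H) ⊗[k] (H ⊗[k] H)

variable (k H) in
/-- The first slot of `Sq`. -/
abbrev sq1 : H →ₐ[k] Sq k H := inl (H ⊗[k] H) (inl H (AlgHom.id k H))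

variable (k H) in
/-- The second slot of `Sq`. -/
abbrev sq2 : H →ₐ[k] Sq k H := inl (H ⊗[k] H) (inr H (AlgHom.id k H))

variable (k H) in
/-- The third slot of `Sq`. -/
abbrev sq3 : H →ₐ[k] Sq k H := inr (H ⊗[k] H) (inl H (AlgHom.id k H))

variable (k H) in
/-- The fourth slot of `Sq`. -/
abbrev sq4 : H →ₐ[k] Sq k H := inr (H ⊗[k] H) (inr H (AlgHom.id k H))

/-- The map `h ↦ S(h₂) ⊗ S(h₁)`. -/
def Sop : H →ₗ[k] H ⊗[k] H :=
  TensorProduct.map QH.S QH.S ∘ₗ (TensorProduct.comm k H H).toLinearMap ∘ₗ QH.comul.toLinearMap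

lemma Sop_sum (h : H) :
    Sop QH h = ∑ j ∈ range QH.nD, QH.S (QH.D2 h j) ⊗ₜ[k] QH.S (QH.D1 h j) := by
  simp [Sop, QH.hcomul]

/-- Two evaluations. -/
def ev2 : Sq k H →ₗ[k] H ⊗[k] H := TensorProduct.map (evw QH) (evw QH)

/-- Two coevaluations. -/
def coev2 : Sq k H →ₗ[k] H ⊗[k] H := TensorProduct.map (coevw QH) (coevw QH)

/-- The element `γ`. -/
def gam : H ⊗[k] H :=
  ev2 QH (Amix QH.toQuasiBialgebra (sq3 k H) (sq1 k H) (sq2 k H) (sq4 k H))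

/-- The element `δ`. -/
def del : H ⊗[k] H :=
  coev2 QH (Bmix QH.toQuasiBialgebra (sq1 k H) (sq3 k H) (sq4 k H) (sq2 k H))

lemma ev2_mul_sq1 (h : H) (z : Sq k H) : ev2 QH (z * sq1 k H h) = (QH.S h ⊗ₜ 1) * ev2 QH z := by
  have : ev2 QH ∘ₗ LinearMap.mulRight k (sq1 k H h) =
      LinearMap.mulLeft k (QH.S h ⊗ₜ 1) ∘ₗ ev2 QH := by
    ext u v w x
    simp [ev2, QH.S_mul, mul_assoc]
  exact LinearMap.congr_fun this z

lemma ev2_mul_sq3 (h : H) (z : Sq k H) : ev2 QH (z * sq3 k H h) = (1 ⊗ₜ QH.S h) * ev2 QH z := by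
  have : ev2 QH ∘ₗ LinearMap.mulRight k (sq3 k H h) =
      LinearMap.mulLeft k (1 ⊗ₜ QH.S h) ∘ₗ ev2 QH := by
    ext u v w x
    simp [ev2, QH.S_mul, mul_assoc]
  exact LinearMap.congr_fun this z

lemma ev2_mul_sq2 (h : H) (z : Sq k H) : ev2 QH (z * sq2 k H h) = ev2 QH z * (h ⊗ₜ 1) := by
  have : ev2 QH ∘ₗ LinearMap.mulRight k (sq2 k H h) =
      LinearMap.mulRight k (h ⊗ₜ 1) ∘ₗ ev2 QH := by
    ext u v w x
    simp [ev2, QH.S_mul, mul_assoc]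
  exact LinearMap.congr_fun this z

lemma ev2_mul_sq4 (h : H) (z : Sq k H) : ev2 QH (z * sq4 k H h) = ev2 QH z * (1 ⊗ₜ h) := by
  have : ev2 QH ∘ₗ LinearMap.mulRight k (sq4 k H h) =
      LinearMap.mulRight k (1 ⊗ₜ h) ∘ₗ ev2 QH := by
    ext u v w x
    simp [ev2, QH.S_mul, mul_assoc]
  exact LinearMap.congr_fun this z

lemma coev2_sq1_mul (h : H) (z : Sq k H) :
    coev2 QH (sq1 k H h * z) = (h ⊗ₜ 1) * coev2 QH z := by
  have : coev2 QH ∘ₗ LinearMap.mulLeft k (sq1 k H h) =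
      LinearMap.mulLeft k (h ⊗ₜ 1) ∘ₗ coev2 QH := by
    ext u v w x
    simp [coev2, mul_assoc]
  exact LinearMap.congr_fun this z

lemma coev2_sq3_mul (h : H) (z : Sq k H) :
    coev2 QH (sq3 k H h * z) = (1 ⊗ₜ h) * coev2 QH z := by
  have : coev2 QH ∘ₗ LinearMap.mulLeft k (sq3 k H h) =
      LinearMap.mulLeft k (1 ⊗ₜ h) ∘ₗ coev2 QH := by
    ext u v w x
    simp [coev2, mul_assoc]
  exact LinearMap.congr_fun this z

lemma coev2_sq2_mul (h : H) (z : Sq k H) :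
    coev2 QH (sq2 k H h * z) = coev2 QH z * (QH.S h ⊗ₜ 1) := by
  have : coev2 QH ∘ₗ LinearMap.mulLeft k (sq2 k H h) =
      LinearMap.mulRight k (QH.S h ⊗ₜ 1) ∘ₗ coev2 QH := by
    ext u v w x
    simp [coev2, QH.S_mul, mul_assoc]
  exact LinearMap.congr_fun this z

lemma coev2_sq4_mul (h : H) (z : Sq k H) :
    coev2 QH (sq4 k H h * z) = coev2 QH z * (1 ⊗ₜ QH.S h) := by
  have : coev2 QH ∘ₗ LinearMap.mulLeft k (sq4 k H h) =
      LinearMap.mulRight k (1 ⊗ₜ QH.S h) ∘ₗ coev2 QH := by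
    ext u v w x
    simp [coev2, QH.S_mul, mul_assoc]
  exact LinearMap.congr_fun this z

local notation "ρ" => reg QH.toQuasiBialgebra

lemma ev2_mul_star31 (h : H) (z : Sq k H) :
    ev2 QH (z * star ρ (sq3 k H) (sq1 k H) h) = Sop QH h * ev2 QH z := by
  simp only [star_sum, mul_sum, map_sum, ← mul_assoc, ev2_mul_sq1, ev2_mul_sq3, Sop_sum,
    Finset.sum_mul, Algebra.TensorProduct.tmul_mul_tmul, one_mul, mul_one]
  rfl

lemma ev2_mul_star24 (h : H) (z : Sq k H) :
    ev2 QH (z * star ρ (sq2 k H) (sq4 k H) h) = ev2 QH z * QH.comul h := by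
  simp only [star_sum, mul_sum, map_sum, ← mul_assoc, ev2_mul_sq2, ev2_mul_sq4, QH.hcomul]
  simp [mul_assoc]

lemma coev2_star13_mul (h : H) (z : Sq k H) :
    coev2 QH (star ρ (sq1 k H) (sq3 k H) h * z) = QH.comul h * coev2 QH z := by
  simp only [star_sum, Finset.sum_mul, map_sum, mul_assoc, coev2_sq1_mul, coev2_sq3_mul, QH.hcomul]
  simp [← mul_assoc]

lemma coev2_star42_mul (h : H) (z : Sq k H) :
    coev2 QH (star ρ (sq4 k H) (sq2 k H) h * z) = coev2 QH z * Sop QH h := by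
  simp only [star_sum, Finset.sum_mul, map_sum, mul_assoc, coev2_sq2_mul, coev2_sq4_mul, Sop_sum,
    mul_sum, Algebra.TensorProduct.tmul_mul_tmul, one_mul, mul_one]
  rfl

lemma ev2_absorb12 : EqL (ev2 QH) (star ρ (sq1 k H) (sq2 k H)) (eta QH.toQuasiBialgebra _) := by
  rw [inl_star]; exact (evw_absorb QH).map_inl _

lemma ev2_absorb34 : EqL (ev2 QH) (star ρ (sq3 k H) (sq4 k H)) (eta QH.toQuasiBialgebra _) := by
  rw [inr_star]; exact (evw_absorb QH).map_inr _

lemma coev2_absorb12 : EqR (coev2 QH) (star ρ (sq1 k H) (sq2 k H)) (eta QH.toQuasiBialgebra _) := by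
  rw [inl_star]; exact (coevw_absorb QH).map_inl _

lemma coev2_absorb34 : EqR (coev2 QH) (star ρ (sq3 k H) (sq4 k H)) (eta QH.toQuasiBialgebra _) := by
  rw [inr_star]; exact (coevw_absorb QH).map_inr _

lemma gam_left (h : H) : ∑ j ∈ range QH.nD, Sop QH (QH.D1 h j) * gam QH * QH.comul (QH.D2 h j) =
    QH.counit h • gam QH := by
  have e := congrArg (ev2 QH) (Amix_intertw (Q := QH.toQuasiBialgebra) (sq3 k H) (sq1 k H)
    (sq2 k H) (sq4 k H) h)
  have l1 := (ev2_absorb12 QH).star_absorb_right (CA := ρ) (r := sq3 k H)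
  rw [l1.star_left (CA := ρ) (a := sq4 k H), (ev2_absorb34 QH), eta_apply, ← Algebra.smul_def,
    map_smul] at e
  rw [gam, ← e, star_sum, mul_sum, map_sum]
  refine sum_congr rfl fun j _ => ?_
  rw [← mul_assoc, ev2_mul_star24, ev2_mul_star31]
  rfl

lemma del_right (h : H) : ∑ j ∈ range QH.nD, QH.comul (QH.D1 h j) * del QH * Sop QH (QH.D2 h j) =
    QH.counit h • del QH := by
  have e := congrArg (coev2 QH) (Bmix_intertw (Q := QH.toQuasiBialgebra) (sq1 k H) (sq3 k H)
    (sq4 k H) (sq2 k H) h)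
  have l1 := (coev2_absorb34 QH).star_absorb_right (CA := ρ) (r := sq1 k H)
  rw [l1.star_left (CA := ρ) (a := sq2 k H), (coev2_absorb12 QH), eta_apply, ← Algebra.commutes,
    ← Algebra.smul_def, map_smul] at e
  rw [del, e, star_sum, Finset.sum_mul, map_sum]
  refine sum_congr rfl fun j _ => ?_
  rw [mul_assoc (star _ _ _ _), coev2_star13_mul, coev2_star42_mul, mul_assoc]
  rfl

end Twist
section TwistZig

variable {k : Type*} [Field k] {H : Type*} [Ring H] [Algebra k H] (QH : QuasiHopfAlgebra k H)

lemma map_Amix {Q : QuasiBialgebra k H} {B C : Type*} [Ring B] [Algebra k B] [Ring C] [Algebra k C]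
    (p : B →ₐ[k] C) (a b c d : H →ₐ[k] B) [CommH a b] [CommH a c] [CommH a d]
    [CommH b c] [CommH b d] [CommH c d] :
    p (Amix Q a b c d) = Amix Q (p.comp a) (p.comp b) (p.comp c) (p.comp d) := by
  simp only [Amix, map_mul, map_Phi, map_Psi]
  congr 2
  exact comp_star _ _ _

lemma map_Bmix {Q : QuasiBialgebra k H} {B C : Type*} [Ring B] [Algebra k B] [Ring C] [Algebra k C]
    (p : B →ₐ[k] C) (a b c d : H →ₐ[k] B) [CommH a b] [CommH a c] [CommH a d]
    [CommH b c] [CommH b d] [CommH c d] :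
    p (Bmix Q a b c d) = Bmix Q (p.comp a) (p.comp b) (p.comp c) (p.comp d) := by
  simp only [Bmix, map_mul, map_Phi, map_Psi]
  congr 2
  exact comp_star _ _ _

lemma Phi_inl {Q : QuasiBialgebra k H} {B : Type*} [Ring B] [Algebra k B] (C : Type*) [Ring C]
    [Algebra k C] (a b c : H →ₐ[k] B) [CommH a b] [CommH a c] [CommH b c] :
    Phi (reg Q) (inl C a) (inl C b) (inl C c) = Phi (reg Q) a b c ⊗ₜ 1 :=
  (map_Phi Algebra.TensorProduct.includeLeft a b c).symm

lemma Phi_inr {Q : QuasiBialgebra k H} {B : Type*} [Ring B] [Algebra k B] (C : Type*) [Ring C]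
    [Algebra k C] (a b c : H →ₐ[k] B) [CommH a b] [CommH a c] [CommH b c] :
    Phi (reg Q) (inr C a) (inr C b) (inr C c) = 1 ⊗ₜ Phi (reg Q) a b c :=
  (map_Phi (Algebra.TensorProduct.includeRight : B →ₐ[k] C ⊗[k] B) a b c).symm

/-- The word `u ⊗ v ⊗ w ↦ u β S(v) α w`. -/
def zigw : H ⊗[k] (H ⊗[k] H) →ₗ[k] H :=
  wd (pre 1 LinearMap.id) (wd (pre QH.bE QH.S) (pre QH.aE LinearMap.id))

@[simp] lemma zigw_tmul (u v w : H) :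
    zigw QH (u ⊗ₜ (v ⊗ₜ w)) = u * (QH.bE * (QH.S v * (QH.aE * w))) := by simp [zigw, mul_assoc]

/-- The map `u ⊗ v ↦ S(v) ⊗ S(u)`. -/
def Sflip : H ⊗[k] H →ₗ[k] H ⊗[k] H :=
  TensorProduct.map QH.S QH.S ∘ₗ (TensorProduct.comm k H H).toLinearMap

@[simp] lemma Sflip_tmul (u v : H) : Sflip QH (u ⊗ₜ v) = QH.S v ⊗ₜ QH.S u := rfl

local notation "u₁" => inl (H ⊗[k] (H ⊗[k] H)) (tri1 k H)
local notation "v₂" => inl (H ⊗[k] (H ⊗[k] H)) (tri2 k H)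
local notation "w₁" => inl (H ⊗[k] (H ⊗[k] H)) (tri3 k H)
local notation "u₂" => inr (H ⊗[k] (H ⊗[k] H)) (tri1 k H)
local notation "v₁" => inr (H ⊗[k] (H ⊗[k] H)) (tri2 k H)
local notation "w₂" => inr (H ⊗[k] (H ⊗[k] H)) (tri3 k H)

set_option maxHeartbeats 1000000 in
lemma zigw_word (X Y Z : H ⊗[k] H) (p q : Sq k H) :
    TensorProduct.map (zigw QH) (zigw QH) (lift2 (lift2 v₂ w₁) (lift2 v₁ w₂) p *
      (lift2 u₁ u₂ X * (lift2 v₁ v₂ Y * lift2 w₁ w₂ Z) *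
        lift2 (lift2 u₁ v₂) (lift2 u₂ v₁) q)) =
    X * coev2 QH q * Sflip QH Y * ev2 QH p * Z := by
  induction X with
  | zero => simp
  | add a b ha hb => simp only [map_add, add_mul, mul_add, ha, hb]
  | tmul x1 x2 =>
  induction Y with
  | zero => simp
  | add a b ha hb => simp only [map_add, add_mul, mul_add, ha, hb]
  | tmul y1 y2 =>
  induction Z with
  | zero => simp
  | add a b ha hb => simp only [map_add, mul_add, add_mul, ha, hb]
  | tmul z1 z2 =>
  induction p using TensorProduct.induction_on with
  | zero => simp
  | add a b ha hb => simp only [map_add, add_mul, mul_add, ha, hb]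
  | tmul p p' =>
  induction p with
  | zero => simp
  | add a b ha hb => simp only [add_tmul, map_add, add_mul, mul_add, ha, hb]
  | tmul p1 p2 =>
  induction p' with
  | zero => simp
  | add a b ha hb => simp only [tmul_add, map_add, add_mul, mul_add, ha, hb]
  | tmul p3 p4 =>
  induction q using TensorProduct.induction_on with
  | zero => simp
  | add a b ha hb => simp only [map_add, add_mul, mul_add, ha, hb]
  | tmul q q' =>
  induction q with
  | zero => simp
  | add a b ha hb => simp only [add_tmul, map_add, add_mul, mul_add, ha, hb]
  | tmul q1 q2 =>
  induction q' with
  | zero => simp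
  | add a b ha hb => simp only [tmul_add, map_add, add_mul, mul_add, ha, hb]
  | tmul q3 q4 =>
  simp [coev2, ev2, QH.S_mul, mul_assoc]

local notation "ρ" => reg QH.toQuasiBialgebra

set_option maxHeartbeats 1000000 in
lemma del_gam_zig : ∑ s ∈ range QH.nP, QH.comul (QH.X1 s) * del QH * Sop QH (QH.X2 s) * gam QH *
    QH.comul (QH.X3 s) = 1 := by
  have hA : lift2 (lift2 v₂ w₁) (lift2 v₁ w₂)
      (Amix QH.toQuasiBialgebra (sq3 k H) (sq1 k H) (sq2 k H) (sq4 k H)) =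
      Amix QH.toQuasiBialgebra v₁ v₂ w₁ w₂ := by
    rw [map_Amix]; congr 1 <;> ext x <;> simp
  have hB : lift2 (lift2 u₁ v₂) (lift2 u₂ v₁)
      (Bmix QH.toQuasiBialgebra (sq1 k H) (sq3 k H) (sq4 k H) (sq2 k H)) =
      Bmix QH.toQuasiBialgebra u₁ u₂ v₁ v₂ := by
    rw [map_Bmix]; congr 1 <;> ext x <;> simp [Algebra.TensorProduct.one_def]
  have zR : EqR (zigw QH) (star ρ (tri1 k H) (tri2 k H)) (eta QH.toQuasiBialgebra _) :=
    ((base QH).absR 1).eqR' _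
  have zL : EqL (zigw QH) (star ρ (tri2 k H) (tri3 k H)) (eta QH.toQuasiBialgebra _) := by
    rw [inr_star]; exact ((base QH).absL QH.bE).eqL.inr _
  have key := twist_zig_coherence (Q := QH.toQuasiBialgebra)
    (E := TensorProduct.map (zigw QH) (zigw QH)) u₁ v₂ w₁ u₂ v₁ w₂
    (by rw [inl_star]; exact zR.map_inl _) (by rw [inr_star]; exact zR.map_inr _)
    (by rw [inl_star]; exact zL.map_inl _) (by rw [inr_star]; exact zL.map_inr _)
  have hz : zigw QH (phi QH.toQuasiBialgebra) = 1 := by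
    simp only [phi, map_sum, zigw_tmul, ← mul_assoc]
    exact QH.antip_X
  have e2 : TensorProduct.map (zigw QH) (zigw QH) (Phi ρ u₂ v₁ w₂ * Phi ρ u₁ v₂ w₁) = 1 := by
    rw [Phi_inl, Phi_inr, Phi_tri, Algebra.TensorProduct.tmul_mul_tmul, one_mul, mul_one,
      TensorProduct.map_tmul, hz]
    rfl
  rw [e2, ← hA, ← hB, Phi_sum] at key
  rw [← key]
  simp only [Finset.sum_mul, mul_sum, map_sum]
  refine sum_congr rfl fun s _ => ?_
  exact (zigw_word QH _ _ _ _ _).symm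

/-- The antipode datum `h ↦ S(h₂) ⊗ S(h₁)` for the comultiplication. -/
def twistAntipode : Antipode QH.toQuasiBialgebra QH.comul where
  T := Sop QH
  T_mul g h := by
    have : ∀ x y : H ⊗[k] H, Sflip QH (x * y) = Sflip QH y * Sflip QH x := by
      intro x y
      induction x with
      | zero => simp
      | add a b ha hb => simp only [map_add, add_mul, mul_add, ha, hb]
      | tmul x1 x2 =>
      induction y with
      | zero => simp
      | add a b ha hb => simp only [map_add, add_mul, mul_add, ha, hb]
      | tmul y1 y2 => simp [QH.S_mul]
    have e := this (QH.comul g) (QH.comul h)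
    rw [← map_mul] at e
    exact e
  T_one := by
    simp [Sop, Algebra.TensorProduct.one_def, QH.S_one]
  a := gam QH
  b := del QH
  left := gam_left QH
  right := del_right QH
  zig := del_gam_zig QH

/-- The antipode datum `h ↦ Δ(S(h))` for the comultiplication. -/
def comulAntipode : Antipode QH.toQuasiBialgebra QH.comul := (base QH).map QH.comul

variable {QH} (DT : DrinfeldTwist QH)

/-- The Drinfeld twist as an element of `H ⊗ H`. -/
def fE : H ⊗[k] H := ∑ t ∈ range DT.nf, DT.f1 t ⊗ₜ[k] DT.f2 t

/-- The inverse of the Drinfeld twist. -/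
def gE : H ⊗[k] H := ∑ t ∈ range DT.nf, DT.g1 t ⊗ₜ[k] DT.g2 t

lemma fE_mul_gE : fE DT * gE DT = 1 := by
  rw [fE, gE, sum_mul_sum]
  simp only [Algebra.TensorProduct.tmul_mul_tmul]
  exact DT.f_inv

lemma gE_mul_fE : gE DT * fE DT = 1 := by
  rw [fE, gE, sum_mul_sum]
  simp only [Algebra.TensorProduct.tmul_mul_tmul]
  exact DT.inv_f

lemma gam_sum : gam QH = ∑ p ∈ range QH.nP, ∑ j ∈ range QH.nQ, ∑ l ∈ range QH.nD,
    (QH.S (QH.X2 p * QH.D2 (QH.x1 j) l) * (QH.aE * (QH.X3 p * QH.x2 j))) ⊗ₜ[k]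
      (QH.S (QH.X1 p * QH.D1 (QH.x1 j) l) * (QH.aE * QH.x3 j)) := by
  rw [gam, Amix, Phi_sum, Psi_sum, sum_mul_sum]
  simp only [star_sum, Finset.sum_mul, mul_sum, map_sum, reg_nP, reg_nQ, reg_nR]
  refine sum_congr rfl fun p _ => sum_congr rfl fun j _ => sum_congr rfl fun l _ => ?_
  simp [ev2]

lemma fE_eq : fE DT = Antipode.compare (comulAntipode QH) (twistAntipode QH) := by
  rw [fE, DT.h_f, Antipode.compare, psi, map_sum]
  refine sum_congr rfl fun j _ => ?_
  rw [Antipode.word_tmul]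
  change _ = Sop QH _ * gam QH * QH.comul _ * QH.comul QH.bE * QH.comul (QH.S _)
  rw [mul_assoc _ (QH.comul _), ← map_mul, mul_assoc _ (QH.comul _), ← map_mul, Sop_sum, gam_sum,
    QH.hcomul (_ * _)]
  rw [Finset.sum_mul, Finset.sum_mul]
  refine sum_congr rfl fun l _ => ?_
  simp only [mul_sum _ _ (QH.S (QH.D2 (QH.x1 j) l) ⊗ₜ[k] QH.S (QH.D1 (QH.x1 j) l))]
  simp only [Finset.sum_mul]
  simp only [mul_sum, Algebra.TensorProduct.tmul_mul_tmul, mul_assoc]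

lemma fE_comul_S (h : H) : fE DT * QH.comul (QH.S h) = Sop QH h * fE DT := by
  rw [fE_eq]; exact Antipode.compare_mul_T (comulAntipode QH) (twistAntipode QH) h

lemma fE_comul_a : fE DT * QH.comul QH.aE = gam QH := by
  rw [fE_eq]; exact Antipode.compare_mul_a (comulAntipode QH) (twistAntipode QH)

lemma del_mul_fE : del QH * fE DT = QH.comul QH.bE := by
  rw [fE_eq]; exact Antipode.b_mul_compare (comulAntipode QH) (twistAntipode QH)

end TwistZig
lemma mul_mul_of_mul_eq {B : Type*} [Semigroup B] {x y w : B} (h : x * y = w) (z : B) :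
    x * (y * z) = w * z := by rw [← mul_assoc, h]

section HigherCoherence

variable {k : Type*} [Field k] {H : Type*} [Ring H] [Algebra k H] {Q : QuasiBialgebra k H}
  {B : Type*} [Ring B] [Algebra k B] {N : Type*} [AddCommGroup N] [Module k N]

local infixl:75 "⊛" => star (reg Q)
local notation "Φᵣ" => Phi (reg Q)
local notation "Ψᵣ" => Psi (reg Q)

lemma pentagon_fill (a b c d : H →ₐ[k] B) [CommH a b] [CommH a c] [CommH a d]
    [CommH b c] [CommH b d] [CommH c d] : Φᵣ a (b ⊛ c) d * (Φᵣ a b c * Ψᵣ (a ⊛ b) c d) =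
    Ψᵣ b c d * Φᵣ a b (c ⊛ d) := by
  have := congrArg (fun t => Ψᵣ b c d * (t * Ψᵣ (a ⊛ b) c d)) (pentagon (reg Q) a b c d)
  simpa only [mul_assoc, Psi_mul_Phi_mul, Phi_mul_Psi, mul_one] using this

section Cocycle

variable {E : B →ₗ[k] N} (s₁ s₂ s₃ s₄ s₅ s₆ : H →ₐ[k] B)
  [CommH s₁ s₂] [CommH s₁ s₃] [CommH s₁ s₄] [CommH s₁ s₅] [CommH s₁ s₆]
  [CommH s₂ s₃] [CommH s₂ s₄] [CommH s₂ s₅] [CommH s₂ s₆]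
  [CommH s₃ s₄] [CommH s₃ s₅] [CommH s₃ s₆] [CommH s₄ s₅] [CommH s₄ s₆] [CommH s₅ s₆]

lemma cocycle_coherence (l : EqL E (s₃ ⊛ s₄) (eta Q B)) :
    E (Amix Q s₂ s₃ s₄ s₅ * Amix Q s₁ (s₂ ⊛ s₃) (s₄ ⊛ s₅) s₆) =
    E (Amix Q s₁ s₂ s₅ s₆ * (Amix Q (s₁ ⊛ s₂) s₃ s₄ (s₅ ⊛ s₆) *
      (Ψᵣ s₁ s₂ s₃ * Φᵣ s₄ s₅ s₆))) := by
  have h34 := l.star_absorb_right (CA := reg Q) (r := s₂)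
  have h134 := h34.star_right (CA := reg Q) (r := s₁)
  have expand : ∀ w, E (Amix Q s₁ s₂ s₅ s₆ * w) =
      E (Amix Q s₁ (s₂ ⊛ (s₃ ⊛ s₄)) s₅ s₆ * (Φᵣ s₁ s₂ (s₃ ⊛ s₄) * w)) := by
    intro w
    rw [Amix, Amix, mul_assoc, mul_assoc, h34.Phi_mid (CA := reg Q)]
    have e1 := ((l.mulLeft (Φᵣ s₁ s₂ s₅)).star_absorb_right (CA := reg Q) (r := s₂)).star_right
      (CA := reg Q) (r := s₁)
    have e2 := e1.Psi_left (CA := reg Q) (a := s₅) (b := s₆) (Φᵣ s₁ s₂ (s₃ ⊛ s₄) * w)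
    simp only [LinearMap.comp_apply, LinearMap.mulLeft_apply] at e2
    rw [e2]
    have e3 := (l.mulLeft (Φᵣ s₁ s₂ s₅ * Ψᵣ (s₁ ⊛ s₂) s₅ s₆)).Phi_absorb_right (CA := reg Q)
      (r := s₁) (a := s₂) w
    simp only [LinearMap.comp_apply, LinearMap.mulLeft_apply, mul_assoc] at e3
    rw [e3]
  rw [expand]
  congr 1
  have p1 := (pentagon (reg Q) s₁ s₂ s₃ s₄).symm
  have i1 : Φᵣ s₁ s₂ s₃ * Ψᵣ (s₁ ⊛ s₂ ⊛ s₃) s₄ (s₅ ⊛ s₆) =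
      Ψᵣ (s₁ ⊛ (s₂ ⊛ s₃)) s₄ (s₅ ⊛ s₆) * Φᵣ s₁ s₂ s₃ :=
    Intertw.Psi (Phi_intertw (reg Q) s₁ s₂ s₃) (Intertw.of_comm _ _) (Intertw.of_comm _ _)
  have i2 : Ψᵣ (s₁ ⊛ (s₂ ⊛ (s₃ ⊛ s₄))) s₅ s₆ * Φᵣ s₂ s₃ s₄ =
      Φᵣ s₂ s₃ s₄ * Ψᵣ (s₁ ⊛ (s₂ ⊛ s₃ ⊛ s₄)) s₅ s₆ :=
    (Intertw.Psi (Intertw.star (Intertw.of_comm _ _) (Phi_intertw (reg Q) s₂ s₃ s₄))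
      (Intertw.of_comm _ _) (Intertw.of_comm _ _)).symm
  have i3 : Φᵣ s₁ (s₂ ⊛ (s₃ ⊛ s₄)) s₅ * Φᵣ s₂ s₃ s₄ =
      Φᵣ s₂ s₃ s₄ * Φᵣ s₁ (s₂ ⊛ s₃ ⊛ s₄) s₅ :=
    (Intertw.Phi (Intertw.of_comm _ _) (Phi_intertw (reg Q) s₂ s₃ s₄) (Intertw.of_comm _ _)).symm
  have i4 : Ψᵣ (s₁ ⊛ (s₂ ⊛ s₃ ⊛ s₄)) s₅ s₆ * Φᵣ s₁ (s₂ ⊛ s₃) s₄ =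
      Φᵣ s₁ (s₂ ⊛ s₃) s₄ * Ψᵣ (s₁ ⊛ (s₂ ⊛ s₃) ⊛ s₄) s₅ s₆ :=
    (Intertw.Psi (Phi_intertw (reg Q) s₁ (s₂ ⊛ s₃) s₄) (Intertw.of_comm _ _)
      (Intertw.of_comm _ _)).symm
  have p2 : Ψᵣ (s₁ ⊛ (s₂ ⊛ s₃) ⊛ s₄) s₅ s₆ * (Ψᵣ (s₁ ⊛ (s₂ ⊛ s₃)) s₄ (s₅ ⊛ s₆) *
      Φᵣ s₄ s₅ s₆) = Ψᵣ (s₁ ⊛ (s₂ ⊛ s₃)) s₄ s₅ * Ψᵣ (s₁ ⊛ (s₂ ⊛ s₃)) (s₄ ⊛ s₅) s₆ := by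
    have := congrArg (· * Φᵣ s₄ s₅ s₆) (pentagon_inv (reg Q) (s₁ ⊛ (s₂ ⊛ s₃)) s₄ s₅ s₆)
    simp only [mul_assoc, Psi_mul_Phi, mul_one] at this
    exact this.symm
  have p3 := pentagon_fill (Q := Q) s₁ (s₂ ⊛ s₃) s₄ s₅
  simp only [Amix, mul_assoc]
  rw [mul_mul_of_mul_eq p1]
  simp only [mul_assoc]
  rw [mul_mul_of_mul_eq i1]
  simp only [mul_assoc, Phi_mul_Psi_mul]
  rw [mul_mul_of_mul_eq i2, mul_assoc, mul_mul_of_mul_eq i3, mul_assoc, mul_mul_of_mul_eq i4,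
    mul_assoc, p2, ← mul_assoc (Φᵣ s₁ (s₂ ⊛ s₃) s₄), mul_mul_of_mul_eq p3]
  simp only [mul_assoc]

end Cocycle

section Unit

variable {E : B →ₗ[k] N} (s₁ s₂ s₃ s₄ s₅ : H →ₐ[k] B)
  [CommH s₁ s₂] [CommH s₁ s₃] [CommH s₁ s₄] [CommH s₁ s₅]
  [CommH s₂ s₃] [CommH s₂ s₄] [CommH s₂ s₅]
  [CommH s₃ s₄] [CommH s₃ s₅] [CommH s₄ s₅]

lemma evaluation_coherence (l : EqL E (s₃ ⊛ s₄) (eta Q B)) :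
    E (Φᵣ s₁ s₂ s₅ * (Φᵣ (s₁ ⊛ s₂) s₃ s₄ * Ψᵣ s₁ s₂ s₃)) =
    E (Amix Q s₂ s₃ s₄ s₅ * (Φᵣ s₁ (s₂ ⊛ s₃) (s₄ ⊛ s₅) * Φᵣ (s₁ ⊛ (s₂ ⊛ s₃)) s₄ s₅)) := by
  have h345 := l.star_absorb_left (a := s₅)
  have expand : ∀ w, E (Φᵣ s₁ s₂ s₅ * w) =
      E (Φᵣ s₁ s₂ (s₃ ⊛ s₄ ⊛ s₅) * (Φᵣ (s₁ ⊛ s₂) (s₃ ⊛ s₄) s₅ * w)) := by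
    intro w
    rw [h345.Phi_right (CA := reg Q)]
    have e3 := (l.mulLeft (Φᵣ s₁ s₂ s₅)).Phi_absorb_mid (CA := reg Q) (r := s₁ ⊛ s₂) (b := s₅) w
    simp only [LinearMap.comp_apply, LinearMap.mulLeft_apply] at e3
    rw [e3]
  rw [expand, ← l.Phi_absorb_mid (CA := reg Q) (r := s₂) (b := s₅) (Amix Q _ _ _ _ * _)]
  congr 1
  have p1 := pentagon_fill (Q := Q) s₂ s₃ s₄ s₅
  have p2 : Φᵣ (s₁ ⊛ s₂) (s₃ ⊛ s₄) s₅ * Φᵣ (s₁ ⊛ s₂) s₃ s₄ = Ψᵣ s₃ s₄ s₅ *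
      (Φᵣ (s₁ ⊛ s₂) s₃ (s₄ ⊛ s₅) * Φᵣ (s₁ ⊛ s₂ ⊛ s₃) s₄ s₅) := by
    rw [← pentagon, Psi_mul_Phi_mul]
  have i1 : Φᵣ s₁ s₂ (s₃ ⊛ s₄ ⊛ s₅) * Ψᵣ s₃ s₄ s₅ = Ψᵣ s₃ s₄ s₅ * Φᵣ s₁ s₂ (s₃ ⊛ (s₄ ⊛ s₅)) :=
    (Intertw.Phi (Intertw.of_comm _ _) (Intertw.of_comm _ _) (Psi_intertw (reg Q) s₃ s₄ s₅)).symm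
  have p3 := (pentagon (reg Q) s₁ s₂ s₃ (s₄ ⊛ s₅)).symm
  have i2 : Φᵣ s₁ s₂ s₃ * Φᵣ (s₁ ⊛ s₂ ⊛ s₃) s₄ s₅ = Φᵣ (s₁ ⊛ (s₂ ⊛ s₃)) s₄ s₅ * Φᵣ s₁ s₂ s₃ :=
    Intertw.Phi (Phi_intertw (reg Q) s₁ s₂ s₃) (Intertw.of_comm _ _) (Intertw.of_comm _ _)
  rw [mul_mul_of_mul_eq p2]
  simp only [Amix, mul_assoc]
  rw [mul_mul_of_mul_eq i1]
  simp only [mul_assoc]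
  rw [mul_mul_of_mul_eq p3]
  simp only [mul_assoc]
  rw [mul_mul_of_mul_eq i2]
  simp only [mul_assoc, Phi_mul_Psi, mul_one]
  rw [← mul_assoc (Φᵣ s₂ s₃ s₄), mul_mul_of_mul_eq p1]
  simp only [mul_assoc]

end Unit

section Comodule

variable {A : Type*} [Ring A] [Algebra k A] (CA : RightComoduleAlgebra Q A)
  {E : B →ₗ[k] N} (r : A →ₐ[k] B) (u v w z : H →ₐ[k] B)
  [CommH r u] [CommH r v] [CommH r w] [CommH r z]
  [CommH u v] [CommH u w] [CommH u z] [CommH v w] [CommH v z] [CommH w z]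

lemma coevaluation_coherence (h₁ : EqR E (v ⊛ w) (eta Q B)) (b : A) :
    E (Psi CA (star CA r u) v w * (star CA r u b * Psi CA r u z)) =
    E (Psi CA r u v * (star CA (star CA r (u ⊛ v)) w b *
      (Psi CA (star CA r (u ⊛ v)) w z * (Psi CA r (u ⊛ v) (w ⊛ z) * Bmix Q u v w z)))) := by
  have hu := h₁.star_absorb_right (CA := reg Q) (r := u)
  have e1 : E (Psi CA (star CA r u) v w * (star CA r u b * Psi CA r u z)) =
      E (Psi CA (star CA r u) v w * (Psi CA r u (v ⊛ w) * (star CA r (u ⊛ (v ⊛ w)) b *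
        Psi CA r (u ⊛ (v ⊛ w)) z))) := by
    have c1 := (hu.Psi_mid (CA := CA) (r := r) (b := z)
      (Psi CA (star CA r u) v w * (Psi CA r u (v ⊛ w) * star CA r (u ⊛ (v ⊛ w)) b)))
    have c2 := ((h₁.mulRight (Psi CA r u z)).star_absorb_right (CA := reg Q) (r := u)).star_right
      (CA := CA) (r := r) b (Psi CA (star CA r u) v w * Psi CA r u (v ⊛ w))
    have i0 : CommW (v ⊛ w) (star CA r u b * Psi CA r u z) := inferInstance
    have i1 : CommW (eta Q B) (star CA r u b * Psi CA r u z) := inferInstance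
    have c3 := (h₁.mulRight (star CA r u b * Psi CA r u z)).Psi_absorb_right (CA := CA) (r := r)
      (a := u) (Psi CA (star CA r u) v w)
    simp only [LinearMap.comp_apply, LinearMap.mulRight_apply, mul_assoc] at c1 c2 c3
    rw [c1, c2, c3]
  rw [e1]
  congr 1
  have q1 := (pentagon_inv CA r u v w).symm
  have j1 : Psi CA r u (v ⊛ w) * star CA r (u ⊛ (v ⊛ w)) b =
      star CA (star CA r u) (v ⊛ w) b * Psi CA r u (v ⊛ w) := Psi_intertw CA r u (v ⊛ w) b
  have j2 : Psi CA (star CA r u) v w * star CA (star CA r u) (v ⊛ w) b =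
      star CA (star CA (star CA r u) v) w b * Psi CA (star CA r u) v w :=
    Psi_intertw CA (star CA r u) v w b
  have j3 : Psi CA r u v * star CA (star CA r (u ⊛ v)) w b =
      star CA (star CA (star CA r u) v) w b * Psi CA r u v :=
    Intertw.star (Psi_intertw CA r u v) (Intertw.of_comm _ _) b
  have j4 : Ψᵣ u v w * Psi CA r (u ⊛ (v ⊛ w)) z = Psi CA r (u ⊛ v ⊛ w) z * Ψᵣ u v w :=
    Intertw.Psi (Intertw.of_comm _ _) (Psi_intertw (reg Q) u v w) (Intertw.of_comm _ _)
  have q2 : Psi CA r (u ⊛ v) w * Psi CA r (u ⊛ v ⊛ w) z =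
      Psi CA (star CA r (u ⊛ v)) w z * (Psi CA r (u ⊛ v) (w ⊛ z) * Φᵣ (u ⊛ v) w z) := by
    have := congrArg (· * Φᵣ (u ⊛ v) w z) (pentagon_inv CA r (u ⊛ v) w z)
    simpa only [mul_assoc, Psi_mul_Phi, mul_one] using this
  rw [mul_mul_of_mul_eq j1, mul_assoc, mul_mul_of_mul_eq j2, mul_assoc, mul_mul_of_mul_eq j3,
    mul_assoc]
  congr 1
  rw [mul_mul_of_mul_eq q1, Bmix]
  simp only [mul_assoc]
  rw [j4, mul_mul_of_mul_eq q2]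
  simp only [mul_assoc]

end Comodule

end HigherCoherence
section Slots

variable {k : Type*} [Field k] {H : Type*} [Ring H] [Algebra k H] (QH : QuasiHopfAlgebra k H)
  {B : Type*} [Ring B] [Algebra k B] {C : Type*} [Ring C] [Algebra k C]

/-- Right multiplication by the slot `s` becomes left multiplication by `t ∘ S`. -/
def SlotL (E : B →ₗ[k] C) (s : H →ₐ[k] B) (t : H →ₐ[k] C) : Prop :=
  ∀ x z, E (z * s x) = t (QH.S x) * E z

/-- Right multiplication by the slot `s` becomes right multiplication by `t`. -/
def SlotR {G : Type*} [Ring G] [Algebra k G] (E : B →ₗ[k] C) (s : G →ₐ[k] B)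
    (t : G →ₐ[k] C) : Prop :=
  ∀ x z, E (z * s x) = E z * t x

/-- The map `u ⊗ v ⊗ w ↦ S(w) ⊗ S(v) ⊗ S(u)`. -/
def Sflip3 : H ⊗[k] (H ⊗[k] H) →ₗ[k] H ⊗[k] (H ⊗[k] H) :=
  (TensorProduct.assoc k H H H).toLinearMap ∘ₗ TensorProduct.map (Sflip QH) QH.S ∘ₗ
    (TensorProduct.comm k H (H ⊗[k] H)).toLinearMap

@[simp] lemma Sflip3_tmul (u v w : H) :
    Sflip3 QH (u ⊗ₜ (v ⊗ₜ w)) = QH.S w ⊗ₜ (QH.S v ⊗ₜ QH.S u) := rfl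

lemma Sflip_mul (x y : H ⊗[k] H) : Sflip QH (x * y) = Sflip QH y * Sflip QH x := by
  induction x with
  | zero => simp
  | add a b ha hb => rw [add_mul, map_add, map_add, mul_add, ha, hb]
  | tmul a b =>
    induction y with
    | zero => simp
    | add c d hc hd => rw [mul_add, map_add, map_add, add_mul, hc, hd]
    | tmul c d => simp [QH.S_mul]

lemma Sflip3_mul (x y : H ⊗[k] (H ⊗[k] H)) :
    Sflip3 QH (x * y) = Sflip3 QH y * Sflip3 QH x := by
  have : (LinearMap.mul k _).compr₂ (Sflip3 QH) =
      ((LinearMap.mul k _).flip.compl₂ (Sflip3 QH)) ∘ₗ (Sflip3 QH) := by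
    ext a b c d e f
    simp [QH.S_mul]
  exact LinearMap.congr_fun (LinearMap.congr_fun this x) y

variable {QH} {E : B →ₗ[k] C}

lemma SlotL.lift2 {s s' : H →ₐ[k] B} {t t' : H →ₐ[k] C} [CommH s s'] [CommH t' t]
    (h : SlotL QH E s t) (h' : SlotL QH E s' t') (X : H ⊗[k] H) (z : B) :
    E (z * QuasiHopf.lift2 s s' X) = QuasiHopf.lift2 t' t (Sflip QH X) * E z := by
  induction X with
  | zero => simp
  | add a b ha hb => simp only [map_add, mul_add, add_mul, ha, hb]
  | tmul a b => rw [lift2_tmul, Sflip_tmul, lift2_tmul, ← mul_assoc, h', h, mul_assoc]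

lemma SlotL.star {s s' : H →ₐ[k] B} {t t' : H →ₐ[k] C} [CommH s s'] [CommH t' t]
    (h : SlotL QH E s t) (h' : SlotL QH E s' t') (x : H) (z : B) :
    E (z * QuasiHopf.star (reg QH.toQuasiBialgebra) s s' x) =
      QuasiHopf.lift2 t' t (Sop QH x) * E z := h.lift2 h' _ z

lemma SlotR.lift2 {G G' : Type*} [Ring G] [Algebra k G] [Ring G'] [Algebra k G']
    {s : G →ₐ[k] B} {s' : G' →ₐ[k] B} {t : G →ₐ[k] C} {t' : G' →ₐ[k] C} [CommH s s'] [CommH t t']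
    (h : SlotR E s t) (h' : SlotR E s' t') :
    SlotR E (QuasiHopf.lift2 s s') (QuasiHopf.lift2 t t') := by
  intro X z
  induction X with
  | zero => simp
  | add a b ha hb => simp only [map_add, mul_add, ha, hb]
  | tmul a b => rw [lift2_tmul, lift2_tmul, ← mul_assoc, h', h, mul_assoc]

lemma SlotR.star {s s' : H →ₐ[k] B} {t t' : H →ₐ[k] C} [CommH s s'] [CommH t t']
    (h : SlotR E s t) (h' : SlotR E s' t') :
    SlotR E (QuasiHopf.star (reg QH.toQuasiBialgebra) s s')
      (QuasiHopf.star (reg QH.toQuasiBialgebra) t t') := fun _ z => h.lift2 h' _ z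

end Slots

section Words

variable {k : Type*} [Field k] {H : Type*} [Ring H] [Algebra k H] (QH : QuasiHopfAlgebra k H)
  {Y : Type*} [Ring Y] [Algebra k Y] (g : Y →ₗ[k] H)

variable (k H Y) in
/-- The source of `ev3`. -/
abbrev Ev3 := (H ⊗[k] H) ⊗[k] ((H ⊗[k] H) ⊗[k] Y)

/-- Two evaluations followed by `g`. -/
def ev3 : Ev3 k H Y →ₗ[k] H ⊗[k] (H ⊗[k] H) :=
  TensorProduct.map (evw QH) (TensorProduct.map (evw QH) g)

variable (k H Y) in
/-- The slot of `ev3` holding the second letter. -/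
abbrev e2 : H →ₐ[k] Ev3 k H Y :=
  inr (H ⊗[k] H) (inl Y (inl H (AlgHom.id k H)))

variable (k H Y) in
/-- The slot of `ev3` holding the third letter. -/
abbrev e3 : H →ₐ[k] Ev3 k H Y :=
  inl ((H ⊗[k] H) ⊗[k] Y) (inl H (AlgHom.id k H))

variable (k H Y) in
/-- The slot of `ev3` holding the fourth letter. -/
abbrev e4 : H →ₐ[k] Ev3 k H Y :=
  inl ((H ⊗[k] H) ⊗[k] Y) (inr H (AlgHom.id k H))

variable (k H Y) in
/-- The slot of `ev3` holding the fifth letter. -/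
abbrev e5 : H →ₐ[k] Ev3 k H Y :=
  inr (H ⊗[k] H) (inl Y (inr H (AlgHom.id k H)))

/-- The slots of `ev3` in the last factor. -/
abbrev eY {G : Type*} [Ring G] [Algebra k G] (j : G →ₐ[k] Y) :
    G →ₐ[k] Ev3 k H Y :=
  inr (H ⊗[k] H) (inr (H ⊗[k] H) j)

local notation "t₁" => tri1 k H
local notation "t₂" => tri2 k H
local notation "t₃" => tri3 k H
local notation "ρ" => reg QH.toQuasiBialgebra

lemma ev3_e3 : SlotL (B := Ev3 k H Y) QH (ev3 QH g) (e3 k H Y) t₁ := by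
  intro x z
  have : ev3 QH g ∘ₗ LinearMap.mulRight k (e3 k H Y x) =
      LinearMap.mulLeft k (t₁ (QH.S x)) ∘ₗ ev3 QH g := by
    ext u v w y l
    simp [ev3, QH.S_mul, mul_assoc]
  exact LinearMap.congr_fun this z

lemma ev3_e2 : SlotL (B := Ev3 k H Y) QH (ev3 QH g) (e2 k H Y) t₂ := by
  intro x z
  have : ev3 QH g ∘ₗ LinearMap.mulRight k (e2 k H Y x) =
      LinearMap.mulLeft k (t₂ (QH.S x)) ∘ₗ ev3 QH g := by
    ext u v w y l
    simp [ev3, QH.S_mul, mul_assoc]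
  exact LinearMap.congr_fun this z

lemma ev3_e4 : SlotR (B := Ev3 k H Y) (ev3 QH g) (e4 k H Y) t₁ := by
  intro x z
  have : ev3 QH g ∘ₗ LinearMap.mulRight k (e4 k H Y x) =
      LinearMap.mulRight k (t₁ x) ∘ₗ ev3 QH g := by
    ext u v w y l
    simp [ev3, mul_assoc]
  exact LinearMap.congr_fun this z

lemma ev3_e5 : SlotR (B := Ev3 k H Y) (ev3 QH g) (e5 k H Y) t₂ := by
  intro x z
  have : ev3 QH g ∘ₗ LinearMap.mulRight k (e5 k H Y x) =
      LinearMap.mulRight k (t₂ x) ∘ₗ ev3 QH g := by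
    ext u v w y l
    simp [ev3, mul_assoc]
  exact LinearMap.congr_fun this z

variable {QH g} in
lemma ev3_eY_left {j : H →ₐ[k] Y} (hj : ∀ x y, g (y * j x) = QH.S x * g y) :
    SlotL (B := Ev3 k H Y) QH (ev3 QH g) (eY j) t₃ := by
  intro x z
  have : ev3 QH g ∘ₗ LinearMap.mulRight k (eY j x) =
      LinearMap.mulLeft k (t₃ (QH.S x)) ∘ₗ ev3 QH g := by
    ext u v w y l
    simp [ev3, hj]
  exact LinearMap.congr_fun this z

variable {QH g} in
lemma ev3_eY_right {j : H →ₐ[k] Y} (hj : ∀ x y, g (y * j x) = g y * x) :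
    SlotR (B := Ev3 k H Y) (ev3 QH g) (eY j) t₃ := by
  intro x z
  have : ev3 QH g ∘ₗ LinearMap.mulRight k (eY j x) =
      LinearMap.mulRight k (t₃ x) ∘ₗ ev3 QH g := by
    ext u v w y l
    simp [ev3, hj]
  exact LinearMap.congr_fun this z

lemma ev3_absorb : EqL (B := Ev3 k H Y) (ev3 QH g) (star ρ (e3 k H Y) (e4 k H Y))
    (eta (B := Ev3 k H Y) QH.toQuasiBialgebra) := by
  rw [inl_star]; exact (evw_absorb QH).map_inl _

lemma ev3_word (a b c d : H) (y : Y) :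
    ev3 QH g (e3 k H Y a * e4 k H Y b * (e2 k H Y c * e5 k H Y d) * eY (AlgHom.id k Y) y) =
      t₁ (evw QH (a ⊗ₜ b)) * t₂ (evw QH (c ⊗ₜ d)) * t₃ (g y) := by
  simp [ev3]

end Words

section EvalData

variable {k : Type*} [Field k] {H : Type*} [Ring H] [Algebra k H] (QH : QuasiHopfAlgebra k H)
  {Y : Type*} [Ring Y] [Algebra k Y] (g : Y →ₗ[k] H)
  {B : Type*} [Ring B] [Algebra k B]

/-- The behaviour of two nested evaluations followed by `g` on slots of an algebra. -/
structure EvalData (E : B →ₗ[k] H ⊗[k] (H ⊗[k] H)) (s₂ s₃ s₄ s₅ : H →ₐ[k] B)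
    (sY : Y →ₐ[k] B) [CommH s₃ s₄] : Prop where
  slot₂ : SlotL QH E s₂ (tri2 k H)
  slot₃ : SlotL QH E s₃ (tri1 k H)
  slot₄ : SlotR E s₄ (tri1 k H)
  slot₅ : SlotR E s₅ (tri2 k H)
  absorb : EqL E (star (reg QH.toQuasiBialgebra) s₃ s₄) (eta QH.toQuasiBialgebra _)
  left : ∀ {j : H →ₐ[k] Y}, (∀ x y, g (y * j x) = QH.S x * g y) →
    SlotL QH E (sY.comp j) (tri3 k H)
  right : ∀ {j : H →ₐ[k] Y}, (∀ x y, g (y * j x) = g y * x) → SlotR E (sY.comp j) (tri3 k H)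
  word : ∀ a b c d y, E (s₃ a * s₄ b * (s₂ c * s₅ d) * sY y) =
    tri1 k H (evw QH (a ⊗ₜ b)) * tri2 k H (evw QH (c ⊗ₜ d)) * tri3 k H (g y)

lemma ev3_data : EvalData (B := Ev3 k H Y) QH g (ev3 QH g) (e2 k H Y) (e3 k H Y) (e4 k H Y)
    (e5 k H Y) (eY (AlgHom.id k Y)) where
  slot₂ := ev3_e2 QH g
  slot₃ := ev3_e3 QH g
  slot₄ := ev3_e4 QH g
  slot₅ := ev3_e5 QH g
  absorb := ev3_absorb QH g
  left := fun hj => ev3_eY_left hj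
  right := fun hj => ev3_eY_right hj
  word := ev3_word QH g

end EvalData
section EvalLemmas

variable {k : Type*} [Field k] {H : Type*} [Ring H] [Algebra k H] {QH : QuasiHopfAlgebra k H}
  {Y : Type*} [Ring Y] [Algebra k Y] {g : Y →ₗ[k] H}
  {B : Type*} [Ring B] [Algebra k B] {E : B →ₗ[k] H ⊗[k] (H ⊗[k] H)}
  {s₂ s₃ s₄ s₅ : H →ₐ[k] B} {sY : Y →ₐ[k] B}
  [CommH s₂ s₃] [CommH s₂ s₄] [CommH s₂ s₅] [CommH s₂ sY] [CommH s₃ s₄] [CommH s₃ s₅]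
  [CommH s₃ sY] [CommH s₄ s₅] [CommH s₄ sY] [CommH s₅ sY]

local notation "t₁" => tri1 k H
local notation "t₂" => tri2 k H
local notation "t₃" => tri3 k H
local notation "ρ" => reg QH.toQuasiBialgebra

lemma EvalData.word_left (D : EvalData QH g E s₂ s₃ s₄ s₅ sY) (p : Sq k H) (y : Y) :
    E (lift2 (lift2 s₃ s₄) (lift2 s₂ s₅) p * sY y) =
      lift2 t₁ t₂ (ev2 QH p) * t₃ (g y) := by
  have : E ∘ₗ LinearMap.mulRight k (sY y) ∘ₗ (lift2 (lift2 s₃ s₄) (lift2 s₂ s₅)).toLinearMap =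
      LinearMap.mulRight k (t₃ (g y)) ∘ₗ (lift2 t₁ t₂).toLinearMap ∘ₗ ev2 QH := by
    ext u v w x
    simp [-evw_tmul, D.word, ev2]
  exact LinearMap.congr_fun this p

lemma EvalData.word_right (D : EvalData QH g E s₂ s₃ s₄ s₅ sY) (p : (H ⊗[k] H) ⊗[k] Y)
    (e : H ⊗[k] H) :
    E (lift2 (lift2 s₂ s₅) sY p * lift2 s₃ s₄ e) =
      t₁ (evw QH e) * lift2 t₂ t₃ (TensorProduct.map (evw QH) g p) := by
  induction p with
  | zero => simp
  | add a b ha hb => simp only [map_add, mul_add, add_mul, ha, hb]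
  | tmul p y =>
    induction p with
    | zero => simp
    | add a b ha hb => simp only [map_add, mul_add, add_mul, add_tmul, ha, hb]
    | tmul u v =>
      induction e with
      | zero => simp
      | add a b ha hb => simp only [map_add, mul_add, add_mul, ha, hb]
      | tmul a b =>
        have h : lift2 (lift2 s₂ s₅) sY (u ⊗ₜ v ⊗ₜ y) * lift2 s₃ s₄ (a ⊗ₜ b) =
            s₃ a * s₄ b * (s₂ u * s₅ v) * sY y := by
          have := (inferInstance : CommH (lift2 (lift2 s₂ s₅) sY) (lift2 s₃ s₄)).comm
            (u ⊗ₜ v ⊗ₜ y) (a ⊗ₜ b)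
          rw [this.eq]
          simp only [lift2_tmul, mul_assoc]
        rw [h, D.word, map_tmul, lift2_tmul, mul_assoc]

/-- Multiplying a nested evaluation by the Drinfeld twist on the left factors. -/
lemma EvalData.twist_left (D : EvalData QH g E s₂ s₃ s₄ s₅ sY) (DT : DrinfeldTwist QH)
    (q : (H ⊗[k] H) ⊗[k] Y) :
    lift2 t₁ t₂ (fE DT) * lift2 (star ρ t₁ t₂) t₃ (TensorProduct.map (evw QH) g q) =
      E (Amix QH.toQuasiBialgebra s₂ s₃ s₄ s₅ *
        lift2 (lift2 (star ρ s₂ s₃) (star ρ s₄ s₅)) sY q) := by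
  induction q with
  | zero => simp
  | add a b ha hb => simp only [map_add, mul_add, ha, hb]
  | tmul p y =>
    induction p with
    | zero => simp
    | add a b ha hb => simp only [map_add, mul_add, add_mul, add_tmul, ha, hb]
    | tmul u v =>
      have hA : Amix QH.toQuasiBialgebra s₂ s₃ s₄ s₅ = lift2 (lift2 s₃ s₄) (lift2 s₂ s₅)
          (Amix QH.toQuasiBialgebra (sq3 k H) (sq1 k H) (sq2 k H) (sq4 k H)) := by
        rw [map_Amix]; congr 1 <;> ext x <;> simp [Algebra.TensorProduct.one_def]
      have hR : Amix QH.toQuasiBialgebra s₂ s₃ s₄ s₅ *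
          lift2 (lift2 (star ρ s₂ s₃) (star ρ s₄ s₅)) sY (u ⊗ₜ v ⊗ₜ y) =
          Amix QH.toQuasiBialgebra s₂ s₃ s₄ s₅ * sY y * star ρ s₄ s₅ v * star ρ s₂ s₃ u := by
        rw [lift2_tmul, lift2_tmul, mul_assoc, mul_assoc,
          CommH.swap (star ρ s₂ s₃) (star ρ s₄ s₅), mul_assoc (Amix _ _ _ _ _) (sY y),
          CommH.swap_mul (star ρ s₂ s₃) sY, CommH.swap (star ρ s₄ s₅) sY]
      have hf : fE DT * QH.comul (QH.S u * (QH.aE * v)) =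
          Sop QH u * gam QH * QH.comul v := by
        rw [map_mul, map_mul, ← mul_assoc, fE_comul_S, mul_assoc, ← mul_assoc (fE DT),
          fE_comul_a, mul_assoc]
      rw [hR, D.slot₂.star D.slot₃, D.slot₄.star D.slot₅, hA, D.word_left, map_tmul, lift2_tmul,
        evw_tmul, ← mul_assoc]
      change lift2 t₁ t₂ (fE DT) * lift2 t₁ t₂ (QH.comul _) * _ = _
      rw [← map_mul, hf, map_mul, map_mul, mul_assoc, mul_assoc, mul_assoc,
        CommH.swap (star ρ t₁ t₂) t₃]
      rfl

end EvalLemmas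
section Cocycle

variable {k : Type*} [Field k] {H : Type*} [Ring H] [Algebra k H] {QH : QuasiHopfAlgebra k H}
  {B : Type*} [Ring B] [Algebra k B] {E : B →ₗ[k] H ⊗[k] (H ⊗[k] H)}

local notation "t₁" => tri1 k H
local notation "t₂" => tri2 k H
local notation "t₃" => tri3 k H
local notation "ρ" => reg QH.toQuasiBialgebra
local notation "Q" => QH.toQuasiBialgebra

lemma SlotL.lift3 {s₁ s₂ s₃ : H →ₐ[k] B} [CommH s₁ s₂] [CommH s₁ s₃] [CommH s₂ s₃]
    (h₁ : SlotL QH E s₁ t₃) (h₂ : SlotL QH E s₂ t₂) (h₃ : SlotL QH E s₃ t₁)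
    (X : H ⊗[k] (H ⊗[k] H)) (z : B) :
    E (z * QuasiHopf.lift2 s₁ (QuasiHopf.lift2 s₂ s₃) X) = Sflip3 QH X * E z := by
  induction X with
  | zero => simp
  | add a b ha hb => simp only [map_add, mul_add, add_mul, ha, hb]
  | tmul u X =>
    induction X with
    | zero => simp
    | add a b ha hb => simp only [map_add, mul_add, add_mul, tmul_add, ha, hb]
    | tmul v w =>
      rw [lift2_tmul, lift2_tmul, ← mul_assoc, ← mul_assoc, h₃, h₂, h₁, ← mul_assoc, ← mul_assoc,
        Sflip3_tmul]
      simp [Algebra.TensorProduct.one_def]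

lemma SlotR.lift3 {s₁ s₂ s₃ : H →ₐ[k] B} [CommH s₁ s₂] [CommH s₁ s₃] [CommH s₂ s₃]
    (h₁ : SlotR E s₁ t₁) (h₂ : SlotR E s₂ t₂) (h₃ : SlotR E s₃ t₃)
    (X : H ⊗[k] (H ⊗[k] H)) (z : B) :
    E (z * QuasiHopf.lift2 s₁ (QuasiHopf.lift2 s₂ s₃) X) = E z * X := by
  have : QuasiHopf.lift2 t₁ (QuasiHopf.lift2 t₂ t₃) = AlgHom.id k (H ⊗[k] (H ⊗[k] H)) := by
    ext x <;> simp
  rw [h₁.lift2 (h₂.lift2 h₃), this]; rfl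

variable (DT : DrinfeldTwist QH)

lemma twist_flip_left (X : H ⊗[k] H) :
    lift2 t₁ t₂ (fE DT) * lift2 (star ρ t₁ t₂) t₃ (Sflip QH X) =
      Sflip3 QH (lift2 t₁ (star ρ t₂ t₃) X) * lift2 t₁ t₂ (fE DT) := by
  induction X with
  | zero => simp
  | add a b ha hb => simp only [map_add, mul_add, add_mul, ha, hb]
  | tmul u v =>
    have h : Sflip3 QH (lift2 t₁ (star ρ t₂ t₃) (u ⊗ₜ v)) =
        lift2 t₁ t₂ (Sop QH v) * t₃ (QH.S u) := by
      rw [lift2_tmul, star_sum, Sop_sum]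
      simp [mul_sum, Finset.sum_mul, Algebra.TensorProduct.one_def]
    rw [h, Sflip_tmul, lift2_tmul, ← mul_assoc, mul_assoc _ (t₃ _), CommH.swap (lift2 t₁ t₂) t₃,
      ← mul_assoc, ← map_mul, ← fE_comul_S, map_mul]
    rfl

lemma twist_flip_right (X : H ⊗[k] H) :
    lift2 t₂ t₃ (fE DT) * lift2 t₁ (star ρ t₂ t₃) (Sflip QH X) =
      Sflip3 QH (lift2 (star ρ t₁ t₂) t₃ X) * lift2 t₂ t₃ (fE DT) := by
  induction X with
  | zero => simp
  | add a b ha hb => simp only [map_add, mul_add, add_mul, ha, hb]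
  | tmul u v =>
    have h : Sflip3 QH (lift2 (star ρ t₁ t₂) t₃ (u ⊗ₜ v)) =
        t₁ (QH.S v) * lift2 t₂ t₃ (Sop QH u) := by
      rw [lift2_tmul, star_sum, Sop_sum]
      simp [mul_sum, Finset.sum_mul, Algebra.TensorProduct.one_def]
    rw [h, Sflip_tmul, lift2_tmul, CommH.swap_mul t₁ (lift2 t₂ t₃), mul_assoc, ← map_mul,
      ← fE_comul_S, map_mul]
    rfl

variable {s₁ s₂ s₃ s₄ s₅ s₆ : H →ₐ[k] B} {sY : H ⊗[k] H →ₐ[k] B}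
  [CommH s₂ s₃] [CommH s₂ s₄] [CommH s₂ s₅] [CommH s₂ sY] [CommH s₃ s₄] [CommH s₃ s₅]
  [CommH s₃ sY] [CommH s₄ s₅] [CommH s₄ sY] [CommH s₅ sY]

lemma evw_left (x : H) (y : H ⊗[k] H) :
    evw QH (y * inl H (AlgHom.id k H) x) = QH.S x * evw QH y := by
  induction y with
  | zero => simp
  | add a b ha hb => simp only [map_add, mul_add, add_mul, ha, hb]
  | tmul u v => simp [QH.S_mul, mul_assoc]

lemma evw_right (x : H) (y : H ⊗[k] H) :
    evw QH (y * inr H (AlgHom.id k H) x) = evw QH y * x := by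
  induction y with
  | zero => simp
  | add a b ha hb => simp only [map_add, mul_add, add_mul, ha, hb]
  | tmul u v => simp [mul_assoc]

lemma EvalData.twist_right (D : EvalData QH (evw QH) E s₂ s₃ s₄ s₅ sY)
    (h₁ : sY.comp (inl H (AlgHom.id k H)) = s₁) (h₆ : sY.comp (inr H (AlgHom.id k H)) = s₆)
    [CommH s₁ s₂] [CommH s₁ s₃] [CommH s₁ s₄] [CommH s₁ s₅] [CommH s₁ s₆] [CommH s₂ s₆]
    [CommH s₃ s₆] [CommH s₄ s₆] [CommH s₅ s₆] (q : Sq k H) :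
    lift2 t₂ t₃ (fE DT) * lift2 t₁ (star ρ t₂ t₃) (ev2 QH q) =
      E (Amix Q s₁ s₂ s₅ s₆ * lift2 (lift2 s₃ s₄) (lift2 (star ρ s₁ s₂) (star ρ s₅ s₆)) q) := by
  induction q using TensorProduct.induction_on with
  | zero => simp
  | add a b ha hb => simp only [map_add, mul_add, ha, hb]
  | tmul e p =>
    induction p with
    | zero => simp
    | add a b ha hb => simp only [map_add, mul_add, add_mul, tmul_add, ha, hb]
    | tmul u v =>
      have hA : Amix Q s₁ s₂ s₅ s₆ = lift2 (lift2 s₂ s₅) sY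
          (Amix Q (sq3 k H) (sq1 k H) (sq2 k H) (sq4 k H)) := by
        subst h₁ h₆
        rw [map_Amix]; congr 1 <;> ext x <;>
          simp [← Algebra.TensorProduct.one_def]
      have hs₁ : SlotL QH E s₁ t₃ := h₁ ▸ D.left evw_left
      have hs₆ : SlotR E s₆ t₃ := h₆ ▸ D.right evw_right
      have hf : fE DT * QH.comul (QH.S u * (QH.aE * v)) =
          Sop QH u * gam QH * QH.comul v := by
        rw [map_mul, map_mul, ← mul_assoc, fE_comul_S, mul_assoc, ← mul_assoc (fE DT),
          fE_comul_a, mul_assoc]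
      rw [lift2_tmul, lift2_tmul, CommH.swap (star ρ s₅ s₆) (star ρ s₁ s₂), ← mul_assoc,
        ← mul_assoc, hs₁.star D.slot₂, D.slot₅.star hs₆, hA, D.word_right]
      change _ * (t₁ (evw QH e) * lift2 t₂ t₃ (QH.comul (evw QH (u ⊗ₜ v)))) =
        _ * (_ * lift2 t₂ t₃ (gam QH) * lift2 t₂ t₃ (QH.comul v))
      rw [evw_tmul, CommH.swap_mul t₁ (lift2 t₂ t₃), ← map_mul, hf, mul_assoc (t₁ _),
        CommH.swap_mul t₁ (lift2 t₂ t₃), ← map_mul, ← map_mul, mul_assoc]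

end Cocycle
section Cocycle

variable {k : Type*} [Field k] {H : Type*} [Ring H] [Algebra k H] {QH : QuasiHopfAlgebra k H}

local notation "t₁" => tri1 k H
local notation "t₂" => tri2 k H
local notation "t₃" => tri3 k H
local notation "ρ" => reg QH.toQuasiBialgebra
local notation "Q" => QH.toQuasiBialgebra

lemma EvalData.cocycle {B : Type*} [Ring B] [Algebra k B] {E : B →ₗ[k] H ⊗[k] (H ⊗[k] H)}
    {s₁ s₂ s₃ s₄ s₅ s₆ : H →ₐ[k] B} {sY : H ⊗[k] H →ₐ[k] B}
    [CommH s₂ s₃] [CommH s₂ s₄] [CommH s₂ s₅] [CommH s₂ sY] [CommH s₃ s₄] [CommH s₃ s₅]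
    [CommH s₃ sY] [CommH s₄ s₅] [CommH s₄ sY] [CommH s₅ sY]
    (D : EvalData QH (evw QH) E s₂ s₃ s₄ s₅ sY)
    (h₁ : sY.comp (inl H (AlgHom.id k H)) = s₁) (h₆ : sY.comp (inr H (AlgHom.id k H)) = s₆)
    [CommH s₁ s₂] [CommH s₁ s₃] [CommH s₁ s₄] [CommH s₁ s₅] [CommH s₁ s₆] [CommH s₂ s₆]
    [CommH s₃ s₆] [CommH s₄ s₆] [CommH s₅ s₆] (DT : DrinfeldTwist QH) :
    lift2 t₁ t₂ (fE DT) * lift2 (star ρ t₁ t₂) t₃ (gam QH) =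
      Sflip3 QH (psi Q) * (lift2 t₂ t₃ (fE DT) * lift2 t₁ (star ρ t₂ t₃) (gam QH)) * phi Q := by
  have hs₁ : SlotL QH E s₁ t₃ := h₁ ▸ D.left evw_left
  have hs₆ : SlotR E s₆ t₃ := h₆ ▸ D.right evw_right
  have e := cocycle_coherence s₁ s₂ s₃ s₄ s₅ s₆ D.absorb
  have hl := D.twist_left DT (Amix Q (sq3 k H) (sq1 k H) (sq2 k H) (sq4 k H))
  have hr := D.twist_right DT h₁ h₆ (Amix Q (sq3 k H) (sq1 k H) (sq2 k H) (sq4 k H))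
  have hA : lift2 (lift2 (star ρ s₂ s₃) (star ρ s₄ s₅)) sY
      (Amix Q (sq3 k H) (sq1 k H) (sq2 k H) (sq4 k H)) =
      Amix Q s₁ (star ρ s₂ s₃) (star ρ s₄ s₅) s₆ := by
    subst h₁ h₆
    rw [map_Amix]; congr 1 <;> ext x <;> simp [← Algebra.TensorProduct.one_def]
  have hA' : lift2 (lift2 s₃ s₄) (lift2 (star ρ s₁ s₂) (star ρ s₅ s₆))
      (Amix Q (sq3 k H) (sq1 k H) (sq2 k H) (sq4 k H)) =
      Amix Q (star ρ s₁ s₂) s₃ s₄ (star ρ s₅ s₆) := by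
    rw [map_Amix]; congr 1 <;> ext x <;> simp [← Algebra.TensorProduct.one_def]
  rw [hA, e, ← mul_assoc, ← mul_assoc, ← hA'] at hl
  refine hl.trans ?_
  erw [D.slot₄.lift3 D.slot₅ hs₆, hs₁.lift3 D.slot₂ D.slot₃, ← hr]
  rfl

variable (DT : DrinfeldTwist QH)

lemma twist_cocycle : lift2 t₁ t₂ (fE DT) * lift2 (star ρ t₁ t₂) t₃ (fE DT) =
    Sflip3 QH (psi Q) * (lift2 t₂ t₃ (fE DT) * lift2 t₁ (star ρ t₂ t₃) (fE DT)) * phi Q := by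
  have hphi : ∀ h, phi Q * star ρ (star ρ t₁ t₂) t₃ h = star ρ t₁ (star ρ t₂ t₃) h * phi Q := by
    intro h
    have := Phi_intertw ρ t₁ t₂ t₃ h
    rwa [Phi_tri] at this
  have hpsi : ∀ h, psi Q * star ρ t₁ (star ρ t₂ t₃) h = star ρ (star ρ t₁ t₂) t₃ h * psi Q := by
    intro h
    have := Psi_intertw ρ t₁ t₂ t₃ h
    rwa [Psi_tri] at this
  refine Antipode.unique ((base QH).map (star ρ (star ρ t₁ t₂) t₃))
    (fun h => Sflip3 QH (star ρ t₁ (star ρ t₂ t₃) h)) ?_ ?_ ?_ ?_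
  · have := congrArg (star ρ (star ρ t₁ t₂) t₃) QH.antip_x
    simp only [map_sum, map_mul, map_one] at this
    exact this
  · intro h
    change _ * lift2 (star ρ t₁ t₂) t₃ (QH.comul (QH.S h)) = _
    rw [mul_assoc, ← map_mul, fE_comul_S, map_mul, ← mul_assoc]
    change _ * lift2 (star ρ t₁ t₂) t₃ (Sflip QH (QH.comul h)) * _ = _
    rw [twist_flip_left, mul_assoc]
    rfl
  · intro h
    change _ * star ρ (star ρ t₁ t₂) t₃ (QH.S h) = _
    rw [mul_assoc, hphi]
    change _ * (lift2 t₁ (star ρ t₂ t₃) (QH.comul (QH.S h)) * phi Q) = _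
    rw [← mul_assoc, mul_assoc _ _ (lift2 t₁ (star ρ t₂ t₃) (QH.comul (QH.S h))), mul_assoc (lift2 t₂ t₃ _),
      ← map_mul, fE_comul_S, map_mul, ← mul_assoc (lift2 t₂ t₃ _)]
    change _ * (_ * lift2 t₁ (star ρ t₂ t₃) (Sflip QH (QH.comul h)) * _) * _ = _
    rw [twist_flip_right, mul_assoc (Sflip3 QH (lift2 _ _ _)), ← mul_assoc (Sflip3 QH (psi Q)),
      ← Sflip3_mul]
    change Sflip3 QH (star ρ (star ρ t₁ t₂) t₃ h * psi Q) * _ * _ = _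
    rw [← hpsi, Sflip3_mul]
    simp only [mul_assoc]
  · change _ * star ρ (star ρ t₁ t₂) t₃ QH.aE = _ * star ρ (star ρ t₁ t₂) t₃ QH.aE
    rw [mul_assoc (_ * _) (phi Q), hphi]
    change _ * lift2 (star ρ t₁ t₂) t₃ (QH.comul QH.aE) =
      _ * (lift2 t₁ (star ρ t₂ t₃) (QH.comul QH.aE) * phi Q)
    rw [mul_assoc, ← map_mul, fE_comul_a, ← mul_assoc, mul_assoc _ _ (lift2 t₁ (star ρ t₂ t₃) (QH.comul QH.aE)),
      mul_assoc (lift2 t₂ t₃ _), ← map_mul, fE_comul_a]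
    exact (ev3_data QH (evw QH)).cocycle (s₁ := eY (inl H (AlgHom.id k H)))
      (s₆ := eY (inr H (AlgHom.id k H))) rfl rfl DT

end Cocycle
section ElementU

variable {k : Type*} [Field k] {H : Type*} [Ring H] [Algebra k H] (QH : QuasiHopfAlgebra k H)

local notation "t₁" => tri1 k H
local notation "t₂" => tri2 k H
local notation "t₃" => tri3 k H
local notation "ρ" => reg QH.toQuasiBialgebra
local notation "Q" => QH.toQuasiBialgebra

variable (k H) in
/-- The first slot of `(H ⊗ H) ⊗ H`. -/
abbrev sl1 : H →ₐ[k] (H ⊗[k] H) ⊗[k] H := inl H (inl H (AlgHom.id k H))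

variable (k H) in
/-- The second slot of `(H ⊗ H) ⊗ H`. -/
abbrev sl2 : H →ₐ[k] (H ⊗[k] H) ⊗[k] H := inl H (inr H (AlgHom.id k H))

variable (k H) in
/-- The third slot of `(H ⊗ H) ⊗ H`. -/
abbrev sl3 : H →ₐ[k] (H ⊗[k] H) ⊗[k] H := inr (H ⊗[k] H) (AlgHom.id k H)

/-- The map `u ⊗ v ⊗ w ↦ S(u)αv ⊗ S(w)`. -/
def evS : (H ⊗[k] H) ⊗[k] H →ₗ[k] H ⊗[k] H := TensorProduct.map (evw QH) QH.S

/-- The element `∑ S(X²)αX³ ⊗ S(X¹)`. -/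
def vE : H ⊗[k] H := evS QH (Phi ρ (sl3 k H) (sl1 k H) (sl2 k H))

lemma evS_sl1 : SlotL QH (evS QH) (sl1 k H) (inl H (AlgHom.id k H)) := by
  intro x z
  have : evS QH ∘ₗ LinearMap.mulRight k (sl1 k H x) =
      LinearMap.mulLeft k (inl H (AlgHom.id k H) (QH.S x)) ∘ₗ evS QH := by
    ext u v w
    simp [evS, QH.S_mul, mul_assoc]
  exact LinearMap.congr_fun this z

lemma evS_sl2 : SlotR (evS QH) (sl2 k H) (inl H (AlgHom.id k H)) := by
  intro x z
  have : evS QH ∘ₗ LinearMap.mulRight k (sl2 k H x) =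
      LinearMap.mulRight k (inl H (AlgHom.id k H) x) ∘ₗ evS QH := by
    ext u v w
    simp [evS, mul_assoc]
  exact LinearMap.congr_fun this z

lemma evS_sl3 : SlotL QH (evS QH) (sl3 k H) (inr H (AlgHom.id k H)) := by
  intro x z
  have : evS QH ∘ₗ LinearMap.mulRight k (sl3 k H x) =
      LinearMap.mulLeft k (inr H (AlgHom.id k H) (QH.S x)) ∘ₗ evS QH := by
    ext u v w
    simp [evS, QH.S_mul]
  exact LinearMap.congr_fun this z

lemma evS_sl3_mul (x : H) (z : (H ⊗[k] H) ⊗[k] H) :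
    evS QH (sl3 k H x * z) = evS QH z * (1 ⊗ₜ QH.S x) := by
  have : evS QH ∘ₗ LinearMap.mulLeft k (sl3 k H x) =
      LinearMap.mulRight k ((1 : H) ⊗ₜ QH.S x) ∘ₗ evS QH := by
    ext u v w
    simp [evS, QH.S_mul]
  exact LinearMap.congr_fun this z

lemma lift2_inl_inr (X : H ⊗[k] H) :
    lift2 (inl H (AlgHom.id k H)) (inr H (AlgHom.id k H)) X = X := by
  have : lift2 (inl H (AlgHom.id k H)) (inr H (AlgHom.id k H)) = AlgHom.id k (H ⊗[k] H) := by
    ext x <;> simp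
  rw [this]; rfl

lemma Sop_mul_vE (x : H) : Sop QH x * vE QH =
    evS QH (Phi ρ (sl3 k H) (sl1 k H) (sl2 k H) * star ρ (sl3 k H) (sl1 k H) x) := by
  rw [(evS_sl3 QH).star (evS_sl1 QH), lift2_inl_inr, vE]

lemma vE_shift (h : H) :
    ∑ i ∈ range QH.nD, Sop QH (QH.D1 h i) * vE QH * (QH.D2 h i ⊗ₜ 1) =
      vE QH * (1 ⊗ₜ QH.S h) := by
  have e : ∑ i ∈ range QH.nD, Sop QH (QH.D1 h i) * vE QH * (QH.D2 h i ⊗ₜ 1) =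
      evS QH (Phi ρ (sl3 k H) (sl1 k H) (sl2 k H) *
        star ρ (star ρ (sl3 k H) (sl1 k H)) (sl2 k H) h) := by
    rw [star_sum ρ (star ρ _ _), mul_sum, map_sum]
    refine sum_congr rfl fun i _ => ?_
    rw [← mul_assoc, evS_sl2, Sop_mul_vE]
    rfl
  have ab : EqL (evS QH) (star ρ (sl1 k H) (sl2 k H)) (eta Q _) := by
    rw [inl_star]; exact (evw_absorb QH).map_inl _
  rw [e, Phi_intertw, ab.star_absorb_right (CA := ρ), evS_sl3_mul]
  rfl

variable {QH} (DT : DrinfeldTwist QH)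

/-- The element `U`. -/
def uE : H ⊗[k] H := gE DT * vE QH

lemma fE_mul_uE : fE DT * uE DT = vE QH := by
  rw [uE, ← mul_assoc, fE_mul_gE, one_mul]

lemma fE_comul_S_uE (x : H) : fE DT * (QH.comul (QH.S x) * uE DT) = Sop QH x * vE QH := by
  rw [← mul_assoc, fE_comul_S, mul_assoc, fE_mul_uE]

lemma uE_shift (h : H) :
    ∑ i ∈ range QH.nD, QH.comul (QH.S (QH.D1 h i)) * uE DT * (QH.D2 h i ⊗ₜ 1) =
      uE DT * (1 ⊗ₜ QH.S h) := by
  have hg : ∀ x, QH.comul (QH.S x) * uE DT = gE DT * (Sop QH x * vE QH) := by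
    intro x
    rw [← fE_comul_S_uE DT, ← mul_assoc (gE DT), gE_mul_fE, one_mul]
  simp only [hg, mul_assoc (gE DT)]
  rw [← mul_sum, vE_shift, uE, mul_assoc]

lemma EvalData.u_right {B : Type*} [Ring B] [Algebra k B] {E : B →ₗ[k] H ⊗[k] (H ⊗[k] H)}
    {s₁ s₂ s₃ s₄ s₅ : H →ₐ[k] B}
    [CommH s₁ s₂] [CommH s₁ s₃] [CommH s₁ s₄] [CommH s₁ s₅]
    [CommH s₂ s₃] [CommH s₂ s₄] [CommH s₂ s₅] [CommH s₃ s₄] [CommH s₃ s₅] [CommH s₄ s₅]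
    (D : EvalData QH QH.S E s₂ s₃ s₄ s₅ s₁) (hs₁ : SlotL QH E s₁ t₃)
    (q : (H ⊗[k] H) ⊗[k] H) :
    lift2 t₂ t₃ (fE DT) * (lift2 t₁ (star ρ t₂ t₃) (evS QH q) * lift2 t₂ t₃ (uE DT)) =
      E (Phi ρ s₁ s₂ s₅ * lift2 (lift2 s₃ s₄) (star ρ s₁ s₂) q) := by
  induction q with
  | zero => simp
  | add a b ha hb => simp only [map_add, mul_add, add_mul, ha, hb]
  | tmul e y =>
    have hP : Phi ρ s₁ s₂ s₅ = lift2 (lift2 s₂ s₅) s₁ (Phi ρ (sl3 k H) (sl1 k H) (sl2 k H)) := by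
      rw [map_Phi]; congr 1 <;> ext x <;> simp [← Algebra.TensorProduct.one_def]
    rw [lift2_tmul, ← mul_assoc (Phi ρ s₁ s₂ s₅), hs₁.star D.slot₂, hP, D.word_right]
    change lift2 t₂ t₃ (fE DT) * (t₁ (evw QH e) * lift2 t₂ t₃ (QH.comul (QH.S y)) * _) =
      _ * (_ * lift2 t₂ t₃ (vE QH))
    rw [mul_assoc (t₁ _), CommH.swap_mul t₁ (lift2 t₂ t₃), CommH.swap_mul t₁ (lift2 t₂ t₃),
      ← map_mul, ← map_mul, ← map_mul, fE_comul_S_uE]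

lemma EvalData.u_left {B : Type*} [Ring B] [Algebra k B] {E : B →ₗ[k] H ⊗[k] (H ⊗[k] H)}
    {s₁ s₂ s₃ s₄ s₅ : H →ₐ[k] B}
    [CommH s₁ s₂] [CommH s₁ s₃] [CommH s₁ s₄] [CommH s₁ s₅]
    [CommH s₂ s₃] [CommH s₂ s₄] [CommH s₂ s₅] [CommH s₃ s₄] [CommH s₃ s₅] [CommH s₄ s₅]
    (D : EvalData QH QH.S E s₂ s₃ s₄ s₅ s₁) :
    lift2 t₁ t₂ (fE DT) * (lift2 (star ρ t₁ t₂) t₃ (fE DT) * ∑ s ∈ range QH.nP,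
      lift2 (star ρ t₁ t₂) t₃ (QH.comul (QH.S (QH.X1 s)) * uE DT) *
        (t₁ (QH.X2 s) * t₂ (QH.X3 s))) =
    E (Amix Q s₂ s₃ s₄ s₅ * (Phi ρ s₁ (star ρ s₂ s₃) (star ρ s₄ s₅) *
      Phi ρ (star ρ s₁ (star ρ s₂ s₃)) s₄ s₅)) := by
  rw [Phi_sum ρ (star ρ s₁ _), mul_sum, mul_sum, mul_sum, mul_sum, map_sum]
  refine sum_congr rfl fun s _ => ?_
  have hP : Phi ρ s₁ (star ρ s₂ s₃) (star ρ s₄ s₅) * star ρ s₁ (star ρ s₂ s₃) (QH.X1 s) =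
      lift2 (lift2 (star ρ s₂ s₃) (star ρ s₄ s₅)) s₁
        (Phi ρ (sl3 k H) (sl1 k H) (sl2 k H) * star ρ (sl3 k H) (sl1 k H) (QH.X1 s)) := by
    rw [map_mul, map_Phi, ← AlgHom.comp_apply, comp_star]
    congr 1
    · congr 1 <;> ext x <;> simp [← Algebra.TensorProduct.one_def]
    · congr 2 <;> ext x <;> simp [← Algebra.TensorProduct.one_def]
  have hX := D.twist_left DT
    (Phi ρ (sl3 k H) (sl1 k H) (sl2 k H) * star ρ (sl3 k H) (sl1 k H) (QH.X1 s))
  rw [← hP] at hX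
  change _ * lift2 _ _ (evS QH _) = _ at hX
  rw [← Sop_mul_vE, ← fE_comul_S_uE DT, map_mul] at hX
  rw [← mul_assoc, ← mul_assoc, mul_assoc (lift2 t₁ t₂ _), hX]
  simp only [reg_P1, reg_P2, reg_P3]
  have assoc : ∀ a b c d e : B, a * (b * (c * (d * e))) = a * (b * c) * d * e := by
    intros; simp only [mul_assoc]
  rw [assoc, D.slot₅, D.slot₄, ← mul_assoc]

lemma EvalData.u_cocycle {B : Type*} [Ring B] [Algebra k B] {E : B →ₗ[k] H ⊗[k] (H ⊗[k] H)}
    {s₁ s₂ s₃ s₄ s₅ : H →ₐ[k] B}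
    [CommH s₁ s₂] [CommH s₁ s₃] [CommH s₁ s₄] [CommH s₁ s₅]
    [CommH s₂ s₃] [CommH s₂ s₄] [CommH s₂ s₅] [CommH s₃ s₄] [CommH s₃ s₅] [CommH s₄ s₅]
    (D : EvalData QH QH.S E s₂ s₃ s₄ s₅ s₁) :
    Sflip3 QH (psi Q) * (lift2 t₂ t₃ (fE DT) *
      (lift2 t₁ (star ρ t₂ t₃) (vE QH) * lift2 t₂ t₃ (uE DT))) =
    lift2 t₁ t₂ (fE DT) * (lift2 (star ρ t₁ t₂) t₃ (fE DT) * ∑ s ∈ range QH.nP,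
      lift2 (star ρ t₁ t₂) t₃ (QH.comul (QH.S (QH.X1 s)) * uE DT) *
        (t₁ (QH.X2 s) * t₂ (QH.X3 s))) := by
  have hs₁ : SlotL QH E s₁ t₃ := D.left (j := AlgHom.id k H) fun x y => QH.S_mul y x
  rw [D.u_left, ← evaluation_coherence s₁ s₂ s₃ s₄ s₅ D.absorb, vE, D.u_right DT hs₁]
  have hP : lift2 (lift2 s₃ s₄) (star ρ s₁ s₂) (Phi ρ (sl3 k H) (sl1 k H) (sl2 k H)) =
      Phi ρ (star ρ s₁ s₂) s₃ s₄ := by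
    rw [map_Phi]; congr 1 <;> ext x <;> simp [← Algebra.TensorProduct.one_def]
  rw [hP, ← mul_assoc (Phi ρ s₁ s₂ s₅)]
  exact (hs₁.lift3 D.slot₂ D.slot₃ (psi Q) _).symm

/-- The cocycle property of the element `U`. -/
lemma uE_cocycle : psi Q * (lift2 t₁ (star ρ t₂ t₃) (uE DT) * lift2 t₂ t₃ (uE DT)) =
    ∑ s ∈ range QH.nP, lift2 (star ρ t₁ t₂) t₃ (QH.comul (QH.S (QH.X1 s)) * uE DT) *
        (t₁ (QH.X2 s) * t₂ (QH.X3 s)) := by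
  have cancel : ∀ {R T : H ⊗[k] (H ⊗[k] H)},
      lift2 t₁ t₂ (fE DT) * (lift2 (star ρ t₁ t₂) t₃ (fE DT) * R) =
        lift2 t₁ t₂ (fE DT) * (lift2 (star ρ t₁ t₂) t₃ (fE DT) * T) → R = T := by
    intro R T h
    have := congrArg (fun z => lift2 (star ρ t₁ t₂) t₃ (gE DT) * (lift2 t₁ t₂ (gE DT) * z)) h
    simpa only [← mul_assoc (lift2 t₁ t₂ (gE DT)), ← map_mul, gE_mul_fE, map_one, one_mul,
      ← mul_assoc (lift2 (star ρ t₁ t₂) t₃ (gE DT))] using this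
  apply cancel
  rw [← (ev3_data QH QH.S).u_cocycle DT, ← fE_mul_uE DT, map_mul, ← mul_assoc, twist_cocycle,
    mul_assoc _ (phi Q), ← mul_assoc (phi Q), phi_mul_psi, one_mul]
  simp only [mul_assoc]

end ElementU
section ElementP

variable {k : Type*} [Field k] {H : Type*} [Ring H] [Algebra k H] {QH : QuasiHopfAlgebra k H}
  (DT : DrinfeldTwist QH) {A : Type*} [Ring A] [Algebra k A]
  (CA : RightComoduleAlgebra QH.toQuasiBialgebra A)

local notation "ρ" => reg QH.toQuasiBialgebra
local notation "Q" => QH.toQuasiBialgebra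

variable (A QH) in
/-- The map `a ⊗ x ⊗ y ↦ a ⊗ xβS(y)`. -/
def coevA : A ⊗[k] (H ⊗[k] H) →ₗ[k] A ⊗[k] H := TensorProduct.map LinearMap.id (coevw QH)

/-- The element `p̃_ρ`. -/
def pE : A ⊗[k] H := coevA QH A (cpsi CA)

lemma comul_S_gE (y : H) : QH.comul (QH.S y) * gE DT = gE DT * Sop QH y := by
  have := congrArg (fun z => gE DT * z * gE DT) (fE_comul_S DT y)
  simpa only [← mul_assoc, gE_mul_fE, one_mul, mul_assoc _ (fE DT) (gE DT), fE_mul_gE,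
    mul_one] using this

lemma comul_coevw_gE (x y : H) : QH.comul (coevw QH (x ⊗ₜ y)) * gE DT =
    QH.comul x * del QH * Sop QH y := by
  have hb : del QH = QH.comul QH.bE * gE DT := by
    rw [← del_mul_fE DT, mul_assoc, fE_mul_gE, mul_one]
  rw [coevw_tmul, map_mul, map_mul, hb, mul_assoc, mul_assoc (QH.comul QH.bE), comul_S_gE]
  simp only [mul_assoc]

variable {B C : Type*} [Ring B] [Algebra k B] [Ring C] [Algebra k C]

variable (QH) in
/-- Two nested coevaluations on commuting slots `r, u, v, w, z`, producing `r, uβS(z), vβS(w)`. -/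
structure CoevalData (E : B →ₗ[k] C) (r : A →ₐ[k] B) (u v w z : H →ₐ[k] B)
    (R : A →ₐ[k] C) (U V : H →ₐ[k] C) [CommH u v] [CommH u w] [CommH u z] [CommH v w]
    [CommH v z] [CommH w z] [CommH U V] : Prop where
  slot_r : ∀ a t, E (r a * t) = R a * E t
  slot_u : ∀ x t, E (u x * t) = U x * E t
  slot_v : ∀ x t, E (v x * t) = V x * E t
  slot_w : ∀ x t, E (w x * t) = E t * V (QH.S x)
  slot_z : ∀ x t, E (z x * t) = E t * U (QH.S x)
  absorb : EqR E (star (reg QH.toQuasiBialgebra) v w) (eta QH.toQuasiBialgebra _)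
  one : E 1 = U QH.bE * V QH.bE
  mix : E (Bmix QH.toQuasiBialgebra u v w z) = lift2 U V (del QH)

section
variable {E : B →ₗ[k] C} {r : A →ₐ[k] B} {u v w z : H →ₐ[k] B}
  {R : A →ₐ[k] C} {U V : H →ₐ[k] C} [CommH r u] [CommH r v] [CommH r w] [CommH r z]
  [CommH u v] [CommH u w] [CommH u z] [CommH v w] [CommH v z] [CommH w z]
  [CommH R U] [CommH R V] [CommH U V]

lemma CoevalData.star_ru (D : CoevalData QH E r u v w z R U V)
    (a : A) (t : B) : E (star CA r u a * t) = star CA R U a * E t := by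
  simp only [star_sum, sum_mul, map_sum, mul_assoc, D.slot_r, D.slot_u]

lemma CoevalData.star_uv (D : CoevalData QH E r u v w z R U V)
    (x : H) (t : B) : E (star ρ u v x * t) = star ρ U V x * E t := by
  simp only [star_sum, sum_mul, map_sum, mul_assoc, D.slot_u, D.slot_v]

lemma CoevalData.star_ruv (D : CoevalData QH E r u v w z R U V)
    (a : A) (t : B) :
    E (star CA r (star ρ u v) a * t) = star CA R (star ρ U V) a * E t := by
  simp only [star_sum CA, sum_mul, map_sum, mul_assoc, D.slot_r, D.star_uv]

lemma CoevalData.star_wz (D : CoevalData QH E r u v w z R U V)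
    (x : H) (t : B) : E (star ρ w z x * t) = E t * lift2 U V (Sop QH x) := by
  simp only [star_sum, sum_mul, map_sum, mul_assoc, D.slot_w, D.slot_z, Sop_sum, mul_sum,
    lift2_tmul]
  rfl

lemma CoevalData.pair (D : CoevalData QH E r u v w z R U V) (b : A) (q q' : A ⊗[k] (H ⊗[k] H)) :
    E (lift2 (star CA r u) (lift2 v w) q * (star CA r u b * lift2 r (lift2 u z) q')) =
      lift2 (star CA R U) V (coevA QH A q) * (star CA R U b * lift2 R U (coevA QH A q')) := by
  have base : E (lift2 r (lift2 u z) q') = lift2 R U (coevA QH A q') * V QH.bE := by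
    induction q' with
    | zero => simp
    | add a b ha hb => simp only [map_add, add_mul, ha, hb]
    | tmul a q =>
      induction q with
      | zero => simp
      | add x y hx hy => simp only [map_add, add_mul, tmul_add, hx, hy]
      | tmul x y =>
        have := D.slot_z y 1
        rw [mul_one] at this
        simp only [lift2_tmul, D.slot_r, D.slot_u, this, D.one, coevA, map_tmul, LinearMap.id_apply,
          coevw_tmul, map_mul, mul_assoc, CommH.swap U V]
  induction q with
  | zero => simp
  | add a b ha hb => simp only [map_add, add_mul, ha, hb]
  | tmul a q =>
    induction q with
    | zero => simp
    | add x y hx hy => simp only [map_add, add_mul, tmul_add, hx, hy]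
    | tmul x y =>
      simp only [lift2_tmul, mul_assoc, D.star_ru, D.slot_v, D.slot_w, base, coevA, map_tmul,
        LinearMap.id_apply, coevw_tmul, map_mul]
      have h1 : ∀ (X : A ⊗[k] H) c, lift2 R U X * V c = V c * lift2 R U X :=
        fun X c => CommH.swap V (lift2 R U) c X
      rw [← map_mul, h1, map_mul]
      simp only [mul_assoc, CommH.swap_mul V (star CA R U)]

lemma CoevalData.tail (D : CoevalData QH E r u v w z R U V) (q : A ⊗[k] (H ⊗[k] H)) :
    E (lift2 r (lift2 (star ρ u v) (star ρ w z)) q * Bmix Q u v w z) =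
      lift2 R (star ρ U V) (coevA QH A q) * lift2 U V (gE DT) := by
  induction q with
  | zero => simp
  | add a b ha hb => simp only [map_add, add_mul, ha, hb]
  | tmul a q =>
    induction q with
    | zero => simp
    | add x y hx hy => simp only [map_add, add_mul, tmul_add, hx, hy]
    | tmul x y =>
      have := congrArg (lift2 U V) (comul_coevw_gE DT x y)
      rw [map_mul, map_mul, map_mul] at this
      simp only [lift2_tmul, mul_assoc, D.slot_r, D.star_uv, D.star_wz, D.mix, coevA, map_tmul,
        LinearMap.id_apply]
      change _ = R a * (lift2 U V (QH.comul (coevw QH (x ⊗ₜ y))) * _)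
      rw [this, mul_assoc]
      rfl

lemma CoevalData.p_coherence (D : CoevalData QH E r u v w z R U V) (b : A) :
    lift2 (star CA R U) V (pE CA) * (star CA R U b * lift2 R U (pE CA)) =
    Psi CA R U V * ∑ i ∈ range CA.nR, ∑ j ∈ range CA.nQ,
      lift2 R (star ρ U V) (CA.rho (CA.r0 b i * CA.Q1 j) * pE CA) *
        lift2 U V (gE DT * (QH.S (CA.Q3 j) ⊗ₜ QH.S (CA.r1 b i * CA.Q2 j))) := by
  rw [pE, ← D.pair]
  refine (coevaluation_coherence CA r u v w z D.absorb b).trans ?_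
  have hPsi : ∀ t, E (Psi CA r u v * t) = Psi CA R U V * E t := by
    intro t
    simp only [Psi_sum, sum_mul, map_sum, mul_assoc, D.slot_r, D.slot_u, D.slot_v]
  have ht : E (Psi CA r (star ρ u v) (star ρ w z) * Bmix Q u v w z) = _ := D.tail DT (cpsi CA)
  rw [hPsi, star_sum CA (star CA r _), Psi_sum CA (star CA r _)]
  congr 1
  simp only [sum_mul, mul_sum, map_sum]
  rw [sum_comm]
  refine sum_congr rfl fun i _ => sum_congr rfl fun j _ => ?_
  simp only [mul_assoc]
  rw [D.star_ruv, D.slot_w, D.star_ruv, D.slot_w, D.slot_z, ht]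
  simp only [map_mul, lift2_tmul, star_apply, QH.S_mul, mul_assoc]

end

end ElementP
section ElementP

variable {k : Type*} [Field k] {H : Type*} [Ring H] [Algebra k H] (QH : QuasiHopfAlgebra k H)
  (A : Type*) [Ring A] [Algebra k A]

local notation "ρ" => reg QH.toQuasiBialgebra
local notation "Q" => QH.toQuasiBialgebra

variable (k H) in
/-- The first slot of `A ⊗ (H ⊗ H)`. -/
abbrev ca : A →ₐ[k] A ⊗[k] (H ⊗[k] H) := inl (H ⊗[k] H) (AlgHom.id k A)

variable (k H) in
/-- The second slot of `A ⊗ (H ⊗ H)`. -/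
abbrev cu : H →ₐ[k] A ⊗[k] (H ⊗[k] H) := inr A (inl H (AlgHom.id k H))

variable (k H) in
/-- The third slot of `A ⊗ (H ⊗ H)`. -/
abbrev cv : H →ₐ[k] A ⊗[k] (H ⊗[k] H) := inr A (inr H (AlgHom.id k H))

/-- Two coevaluations next to `A`. -/
def coevA2 : A ⊗[k] Sq k H →ₗ[k] A ⊗[k] (H ⊗[k] H) := TensorProduct.map LinearMap.id (coev2 QH)

lemma coevA2_inl_mul (a : A) (t : A ⊗[k] Sq k H) :
    coevA2 QH A (inl (Sq k H) (AlgHom.id k A) a * t) = ca k H A a * coevA2 QH A t := by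
  induction t using TensorProduct.induction_on with
  | zero => simp
  | add x y hx hy => simp only [mul_add, map_add, hx, hy]
  | tmul x y => simp [coevA2]

lemma coevA2_left {s : H →ₐ[k] Sq k H} {t : H →ₐ[k] H ⊗[k] H}
    (h : ∀ x y, coev2 QH (s x * y) = t x * coev2 QH y) (x : H) (y : A ⊗[k] Sq k H) :
    coevA2 QH A (inr A s x * y) = inr A t x * coevA2 QH A y := by
  induction y using TensorProduct.induction_on with
  | zero => simp
  | add x y hx hy => simp only [mul_add, map_add, hx, hy]
  | tmul x y => simp [coevA2, h]

lemma coevA2_right {s : H →ₐ[k] Sq k H} {t : H →ₐ[k] H ⊗[k] H}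
    (h : ∀ x y, coev2 QH (s x * y) = coev2 QH y * t (QH.S x)) (x : H) (y : A ⊗[k] Sq k H) :
    coevA2 QH A (inr A s x * y) = coevA2 QH A y * inr A t (QH.S x) := by
  induction y using TensorProduct.induction_on with
  | zero => simp
  | add x y hx hy => simp only [mul_add, add_mul, map_add, hx, hy]
  | tmul x y => simp [coevA2, h]

lemma coevA2_data : CoevalData (B := A ⊗[k] Sq k H) QH (coevA2 QH A)
    (inl (Sq k H) (AlgHom.id k A)) (inr A (sq1 k H)) (inr A (sq3 k H)) (inr A (sq4 k H))
    (inr A (sq2 k H)) (ca k H A) (cu k H A) (cv k H A) where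
  slot_r := coevA2_inl_mul QH A
  slot_u := coevA2_left QH A (coev2_sq1_mul QH)
  slot_v := coevA2_left QH A (coev2_sq3_mul QH)
  slot_w := coevA2_right QH A (coev2_sq4_mul QH)
  slot_z := coevA2_right QH A (coev2_sq2_mul QH)
  absorb := by
    rw [inr_star]; exact (coev2_absorb34 QH).map_inr _
  one := by
    simp [coevA2, coev2, Algebra.TensorProduct.one_def, QH.S_one]
  mix := by
    have h : Bmix Q (inr A (sq1 k H)) (inr A (sq3 k H)) (inr A (sq4 k H)) (inr A (sq2 k H)) =
        (1 : A) ⊗ₜ[k] Bmix Q (sq1 k H) (sq3 k H) (sq4 k H) (sq2 k H) :=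
      (map_Bmix (Algebra.TensorProduct.includeRight (A := A)) _ _ _ _).symm
    rw [h, coevA2, map_tmul]
    change 1 ⊗ₜ[k] del QH = _
    generalize del QH = d
    induction d with
    | zero => simp
    | add x y hx hy => simp only [tmul_add, map_add, hx, hy]
    | tmul x y => simp

variable {QH A} (DT : DrinfeldTwist QH) (CA : RightComoduleAlgebra QH.toQuasiBialgebra A)

/-- The cocycle property of the element `p̃_ρ`. -/
lemma pE_cocycle (a b : A) :
    lift2 (star CA (ca k H A) (cu k H A)) (cv k H A) (CA.rho a * pE CA) *
      lift2 (ca k H A) (cu k H A) (CA.rho b * pE CA) =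
    cpsi CA * ∑ i ∈ range CA.nR, ∑ j ∈ range CA.nQ,
      lift2 (ca k H A) (star ρ (cu k H A) (cv k H A)) (CA.rho (a * CA.r0 b i * CA.Q1 j) * pE CA) *
        lift2 (cu k H A) (cv k H A)
          (gE DT * (QH.S (CA.Q3 j) ⊗ₜ QH.S (CA.r1 b i * CA.Q2 j))) := by
  have hc : Psi CA (ca k H A) (cu k H A) (cv k H A) = cpsi CA := by
    simp [Psi_sum, cpsi]
  have h := (coevA2_data QH A).p_coherence DT CA b
  have hi := Psi_intertw CA (ca k H A) (cu k H A) (cv k H A) a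
  rw [map_mul, map_mul, mul_assoc]
  change star CA (star CA (ca k H A) (cu k H A)) (cv k H A) a * (_ * (star CA _ _ b * _)) = _
  rw [h, ← mul_assoc, ← hi, hc, mul_assoc, mul_sum]
  congr 1
  refine sum_congr rfl fun i _ => ?_
  rw [mul_sum]
  refine sum_congr rfl fun j _ => ?_
  rw [mul_assoc a, map_mul CA.rho a, mul_assoc (CA.rho a), map_mul (lift2 _ _) (CA.rho a),
    mul_assoc (lift2 _ _ (CA.rho a))]
  rfl

end ElementP
section Counit

variable {k : Type*} [Field k] {H : Type*} [Ring H] [Algebra k H] (QH : QuasiHopfAlgebra k H)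

local notation "ρ" => reg QH.toQuasiBialgebra
local notation "Q" => QH.toQuasiBialgebra

lemma counit_aE_ne_zero : QH.counit QH.aE ≠ 0 := by
  intro h
  have := congrArg QH.counit QH.antip_X
  simp [h] at this

lemma counit_S (x : H) : QH.counit (QH.S x) = QH.counit x := by
  have h := congrArg QH.counit (QH.antip_l x)
  have hx := congrArg (fun z => QH.counit (QH.S z)) (QH.counit_r x)
  simp only [map_sum, map_mul, map_smul, smul_eq_mul] at h hx
  have e : QH.counit (QH.S x) * QH.counit QH.aE = QH.counit x * QH.counit QH.aE := by
    rw [← h, ← hx, sum_mul]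
    exact sum_congr rfl fun i _ => by ring
  exact mul_right_cancel₀ (counit_aE_ne_zero QH) e

lemma counit_Sinv (x : H) : QH.counit (QH.Sinv x) = QH.counit x := by
  rw [← counit_S, QH.S_Sinv]

lemma counit_phi : ∑ s ∈ range QH.nP,
    QH.counit (QH.X1 s) * QH.counit (QH.X2 s) * QH.counit (QH.X3 s) = 1 := by
  have : CommH QH.counit QH.counit := ⟨fun _ _ => Commute.all _ _⟩
  have h := congrArg (lift2 QH.counit QH.counit) QH.normal
  simp only [map_sum, map_smul, lift2_tmul, map_one, smul_eq_mul, mul_one] at h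
  rw [← h]
  exact sum_congr rfl fun i _ => by ring

lemma counit_aE_mul_bE : QH.counit QH.aE * QH.counit QH.bE = 1 := by
  have h := congrArg QH.counit QH.antip_X
  simp only [map_sum, map_mul, map_one, counit_S] at h
  rw [← h, ← mul_one (_ * _), ← counit_phi QH, mul_sum]
  exact sum_congr rfl fun i _ => by ring

/-- The map `id ⊗ ε`. -/
def epsR : H ⊗[k] H →ₐ[k] H := lift2 (AlgHom.id k H) (eta Q H)

/-- The map `ε ⊗ id`. -/
def epsL : H ⊗[k] H →ₐ[k] H := lift2 (eta Q H) (AlgHom.id k H)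

lemma epsR_comul (x : H) : epsR QH (QH.comul x) = x := by
  have h := QH.counit_r x
  rw [QH.hcomul, map_sum]
  simpa [epsR, eta_apply, ← Algebra.commutes (R := k), ← Algebra.smul_def] using h

lemma epsL_comul (x : H) : epsL QH (QH.comul x) = x := by
  have h := QH.counit_l x
  rw [QH.hcomul, map_sum]
  simpa [epsL, eta_apply, ← Algebra.smul_def] using h

lemma epsR_Sop (x : H) : epsR QH (Sop QH x) = QH.S x := by
  have h := congrArg QH.S (QH.counit_l x)
  rw [Sop_sum, map_sum]
  simpa [epsR, eta_apply, ← Algebra.commutes (R := k), ← Algebra.smul_def, counit_S] using h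

lemma epsL_Sop (x : H) : epsL QH (Sop QH x) = QH.S x := by
  have h := congrArg QH.S (QH.counit_r x)
  rw [Sop_sum, map_sum]
  simpa [epsL, eta_apply, ← Algebra.smul_def, counit_S] using h

lemma mul_eta {B : Type*} [Ring B] [Algebra k B] (b : B) (x : H) :
    b * eta Q B x = QH.counit x • b := by
  rw [eta_apply, ← Algebra.commutes, ← Algebra.smul_def]

lemma epsR_ev2 (z : Sq k H) : epsR QH (ev2 QH z) = QH.counit QH.aE •
    evw QH (lift2 (AlgHom.id k (H ⊗[k] H)) (lift2 (eta Q _) (eta Q _)) z) := by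
  have : (epsR QH).toLinearMap ∘ₗ ev2 QH = QH.counit QH.aE • evw QH ∘ₗ
      (lift2 (AlgHom.id k (H ⊗[k] H)) (lift2 (eta Q _) (eta Q _))).toLinearMap := by
    ext u v w x
    simp [epsR, ev2, mul_eta, counit_S, smul_smul]
    congr 1; ring
  exact LinearMap.congr_fun this z

lemma epsL_ev2 (z : Sq k H) : epsL QH (ev2 QH z) = QH.counit QH.aE •
    evw QH (lift2 (lift2 (eta Q _) (eta Q _)) (AlgHom.id k (H ⊗[k] H)) z) := by
  have : (epsL QH).toLinearMap ∘ₗ ev2 QH = QH.counit QH.aE • evw QH ∘ₗ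
      (lift2 (lift2 (eta Q _) (eta Q _)) (AlgHom.id k (H ⊗[k] H))).toLinearMap := by
    ext u v w x
    simp [epsL, ev2, eta_apply, counit_S, ← Algebra.smul_def,
      smul_smul, Algebra.TensorProduct.one_def]
    congr 1; ring
  exact LinearMap.congr_fun this z

lemma evw_one : evw QH 1 = QH.aE := by
  simp [Algebra.TensorProduct.one_def, QH.S_one]

lemma Amix_eta_outer {B : Type*} [Ring B] [Algebra k B] (a b c d : H →ₐ[k] B) [CommH a b]
    [CommH a c] [CommH a d] [CommH b c] [CommH b d] [CommH c d] (ha : a = eta Q B)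
    (hd : d = eta Q B) : Amix Q a b c d = 1 := by
  subst ha hd
  rw [Amix, Phi_eta_left, Psi_eta_right, mul_one]

lemma Amix_eta_inner {B : Type*} [Ring B] [Algebra k B] (a b c d : H →ₐ[k] B) [CommH a b]
    [CommH a c] [CommH a d] [CommH b c] [CommH b d] [CommH c d] (hb : b = eta Q B)
    (hc : c = eta Q B) : Amix Q a b c d = 1 := by
  subst hb hc
  rw [Amix, Phi_eta_mid, Psi_eta_mid, mul_one]

lemma epsR_gam : epsR QH (gam QH) = QH.counit QH.aE • QH.aE := by
  rw [gam, epsR_ev2, map_Amix, Amix_eta_outer, evw_one] <;> ext x <;> simp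

lemma epsL_gam : epsL QH (gam QH) = QH.counit QH.aE • QH.aE := by
  rw [gam, epsL_ev2, map_Amix, Amix_eta_inner, evw_one] <;> ext x <;> simp

variable {QH}

lemma eq_of_central_mul_aE {F : H} (hc : ∀ x, F * QH.S x = QH.S x * F)
    (ha : F * QH.aE = QH.counit QH.aE • QH.aE) : F = algebraMap k H (QH.counit QH.aE) := by
  have hc' : ∀ x, F * x = x * F := fun x => by simpa [QH.S_Sinv] using hc (QH.Sinv x)
  calc F = F * ∑ s ∈ range QH.nP, QH.X1 s * QH.bE * QH.S (QH.X2 s) * QH.aE * QH.X3 s := by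
        rw [QH.antip_X, mul_one]
    _ = ∑ s ∈ range QH.nP, QH.counit QH.aE •
          (QH.X1 s * QH.bE * QH.S (QH.X2 s) * QH.aE * QH.X3 s) := by
        rw [mul_sum]
        refine sum_congr rfl fun s _ => ?_
        rw [mul_assoc _ QH.aE, ← mul_assoc F, hc', mul_assoc, ← mul_assoc F, ha]
        simp [mul_assoc]
    _ = _ := by rw [← smul_sum, QH.antip_X, Algebra.algebraMap_eq_smul_one]

variable (DT : DrinfeldTwist QH)

lemma epsR_fE : epsR QH (fE DT) = algebraMap k H (QH.counit QH.aE) := by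
  refine eq_of_central_mul_aE (fun x => ?_) ?_
  · have := congrArg (epsR QH) (fE_comul_S DT x)
    rwa [map_mul, map_mul, epsR_comul, epsR_Sop] at this
  · have := congrArg (epsR QH) (fE_comul_a DT)
    rwa [map_mul, epsR_comul, epsR_gam] at this

lemma epsL_fE : epsL QH (fE DT) = algebraMap k H (QH.counit QH.aE) := by
  refine eq_of_central_mul_aE (fun x => ?_) ?_
  · have := congrArg (epsL QH) (fE_comul_S DT x)
    rwa [map_mul, map_mul, epsL_comul, epsL_Sop] at this
  · have := congrArg (epsL QH) (fE_comul_a DT)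
    rwa [map_mul, epsL_comul, epsL_gam] at this

lemma epsL_vE : epsL QH (vE QH) = algebraMap k H (QH.counit QH.aE) := by
  have h1 := congrArg (lift2 (AlgHom.id k H) (eta Q H)) QH.normal
  have h : ∑ s ∈ range QH.nP, (QH.counit (QH.X2 s) * QH.counit (QH.X3 s)) • QH.X1 s = 1 := by
    simpa [eta_apply, ← Algebra.commutes (R := k), ← Algebra.smul_def, smul_smul] using h1
  have h' := congrArg QH.S h
  simp only [map_sum, map_smul, QH.S_one] at h'
  rw [vE, Phi_sum, map_sum, map_sum, Algebra.algebraMap_eq_smul_one, ← h', smul_sum]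
  refine sum_congr rfl fun s _ => ?_
  simp [epsL, evS, eta_apply, ← Algebra.smul_def, counit_S, smul_smul]
  congr 1; ring

lemma epsL_uE : epsL QH (uE DT) = 1 := by
  have h := congrArg (epsL QH) (fE_mul_uE DT)
  rw [map_mul, epsL_fE, epsL_vE, ← Algebra.smul_def, Algebra.algebraMap_eq_smul_one] at h
  exact smul_right_injective H (counit_aE_ne_zero QH) h

end Counit
section Actions

variable {k : Type*} [Field k] {H : Type*} [Ring H] [Algebra k H]
  {Q : QuasiBialgebra k H} {A : Type*} [Ring A] [Algebra k A] {CA : RightComoduleAlgebra Q A}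
  {M : Type*} [AddCommGroup M] [Module k M] (T : TwoSidedHopfModule Q CA M)
  {K : Type*} [Ring K] [Algebra k K]

/-- The left action of `H ⊗ K` on `M ⊗ K`. -/
def lact : H ⊗[k] K →ₗ[k] M ⊗[k] K →ₗ[k] M ⊗[k] K :=
  TensorProduct.homTensorHomMap (RingHom.id k) M K M K ∘ₗ TensorProduct.map T.ha (LinearMap.mul k K)

/-- The right action of `A ⊗ K` on `M ⊗ K`. -/
def ract : A ⊗[k] K →ₗ[k] M ⊗[k] K →ₗ[k] M ⊗[k] K :=
  TensorProduct.homTensorHomMap (RingHom.id k) M K M K ∘ₗ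
    TensorProduct.map T.ra (LinearMap.mul k K).flip

@[simp] lemma lact_tmul (h : H) (x : K) (m : M) (y : K) :
    lact T (h ⊗ₜ x) (m ⊗ₜ y) = T.ha h m ⊗ₜ[k] (x * y) := rfl

@[simp] lemma ract_tmul (a : A) (x : K) (m : M) (y : K) :
    ract T (a ⊗ₜ x) (m ⊗ₜ y) = T.ra a m ⊗ₜ[k] (y * x) := rfl

lemma lact_eq_map (h : H) (x : K) :
    lact T (h ⊗ₜ x) = TensorProduct.map (T.ha h) (LinearMap.mulLeft k x) := rfl

lemma ract_eq_map (a : A) (x : K) :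
    ract T (a ⊗ₜ x) = TensorProduct.map (T.ra a) (LinearMap.mulRight k x) := rfl

lemma lact_one (n : M ⊗[k] K) : lact T 1 n = n := by
  induction n with
  | zero => simp
  | add x y hx hy => rw [map_add, hx, hy]
  | tmul m y => simp [Algebra.TensorProduct.one_def, T.ha_one]

lemma ract_one (n : M ⊗[k] K) : ract T 1 n = n := by
  induction n with
  | zero => simp
  | add x y hx hy => rw [map_add, hx, hy]
  | tmul m y => simp [Algebra.TensorProduct.one_def, T.ra_one]

lemma lact_mul (X Y : H ⊗[k] K) (n : M ⊗[k] K) : lact T (X * Y) n = lact T X (lact T Y n) := by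
  induction X with
  | zero => simp
  | add a b ha hb => simp only [map_add, add_mul, LinearMap.add_apply, ha, hb]
  | tmul a b =>
    induction Y with
    | zero => simp
    | add a b ha hb => simp only [map_add, mul_add, LinearMap.add_apply, ha, hb]
    | tmul c d =>
      induction n with
      | zero => simp
      | add a b ha hb => simp only [map_add, ha, hb]
      | tmul m y => simp [T.ha_mul, mul_assoc]

lemma ract_mul (X Y : A ⊗[k] K) (n : M ⊗[k] K) : ract T (X * Y) n = ract T Y (ract T X n) := by
  induction X with
  | zero => simp
  | add a b ha hb => simp only [map_add, add_mul, LinearMap.add_apply, ha, hb]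
  | tmul a b =>
    induction Y with
    | zero => simp
    | add a b ha hb => simp only [map_add, mul_add, LinearMap.add_apply, ha, hb]
    | tmul c d =>
      induction n with
      | zero => simp
      | add a b ha hb => simp only [map_add, ha, hb]
      | tmul m y => simp [T.ra_mul, mul_assoc]

lemma lact_ract (X : H ⊗[k] K) (Y : A ⊗[k] K) (n : M ⊗[k] K) :
    lact T X (ract T Y n) = ract T Y (lact T X n) := by
  induction X with
  | zero => simp
  | add a b ha hb => simp only [map_add, LinearMap.add_apply, ha, hb]
  | tmul a b =>
    induction Y with
    | zero => simp
    | add a b ha hb => simp only [map_add, LinearMap.add_apply, ha, hb]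
    | tmul c d =>
      induction n with
      | zero => simp
      | add a b ha hb => simp only [map_add, ha, hb]
      | tmul m y => simp [T.ha_ra, mul_assoc]

lemma rho_ha (h : H) (m : M) : T.rho (T.ha h m) = lact T (Q.comul h) (T.rho m) := by
  rw [T.colin_l, Q.hcomul, map_sum, LinearMap.sum_apply]
  rfl

lemma rho_ra (a : A) (m : M) : T.rho (T.ra a m) = ract T (CA.rho a) (T.rho m) := by
  rw [T.colin_r, CA.hrho, map_sum, LinearMap.sum_apply]
  rfl

/-- The map `ρ ⊗ id`. -/
def rhoL : M ⊗[k] H →ₗ[k] M ⊗[k] (H ⊗[k] H) :=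
  (TensorProduct.assoc k M H H).toLinearMap ∘ₗ TensorProduct.map T.rho LinearMap.id

variable (M) in
/-- The map `id ⊗ Δ`. -/
def comulR (Q : QuasiBialgebra k H) : M ⊗[k] H →ₗ[k] M ⊗[k] (H ⊗[k] H) :=
  TensorProduct.map LinearMap.id Q.comul.toLinearMap

lemma lact_phi_rhoL (m : M) :
    lact T (phi Q) (rhoL T (T.rho m)) = ract T (cphi CA) (comulR M Q (T.rho m)) := by
  rw [phi, cphi, map_sum, map_sum, LinearMap.sum_apply, LinearMap.sum_apply]
  refine (Eq.trans ?_ (T.coassoc_rho m)).trans ?_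
  · refine sum_congr rfl fun s _ => ?_
    rw [lact_eq_map]
    congr 2
    ext <;> simp
  · refine sum_congr rfl fun s _ => ?_
    rw [ract_eq_map]
    congr 2
    ext <;> simp

lemma ract_cpsi_rhoL (m : M) :
    ract T (cpsi CA) (rhoL T (T.rho m)) = lact T (psi Q) (comulR M Q (T.rho m)) := by
  have h := congrArg (fun n => lact T (psi Q) (ract T (cpsi CA) n)) (lact_phi_rhoL T m)
  simp only [← ract_mul, cphi_mul_cpsi, ract_one] at h
  rwa [lact_ract, ← lact_mul, psi_mul_phi, lact_one] at h

local notation "t₁" => tri1 k H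
local notation "t₂" => tri2 k H
local notation "t₃" => tri3 k H

lemma assoc_lact_tmul (X : H ⊗[k] H) (x y : H) (p : M ⊗[k] H) :
    TensorProduct.assoc k M H H (lact T X p ⊗ₜ (x * y)) =
      lact T (lift2 t₁ t₂ X * t₃ x) (TensorProduct.assoc k M H H (p ⊗ₜ y)) := by
  induction X with
  | zero => simp
  | add a b ha hb => simp only [map_add, add_mul, LinearMap.add_apply, add_tmul, ha, hb]
  | tmul c d =>
    induction p with
    | zero => simp
    | add a b ha hb => simp only [map_add, add_tmul, ha, hb]
    | tmul m z => simp

lemma assoc_ract_tmul (X : A ⊗[k] H) (x y : H) (p : M ⊗[k] H) :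
    TensorProduct.assoc k M H H (ract T X p ⊗ₜ (y * x)) =
      ract T (lift2 (ca k H A) (cu k H A) X * cv k H A x)
        (TensorProduct.assoc k M H H (p ⊗ₜ y)) := by
  induction X with
  | zero => simp
  | add a b ha hb => simp only [map_add, add_mul, LinearMap.add_apply, add_tmul, ha, hb]
  | tmul c d =>
    induction p with
    | zero => simp
    | add a b ha hb => simp only [map_add, add_tmul, ha, hb]
    | tmul m z => simp

lemma rhoL_lact (X : H ⊗[k] H) (n : M ⊗[k] H) :
    rhoL T (lact T X n) = lact T (lift2 (star (reg Q) t₁ t₂) t₃ X) (rhoL T n) := by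
  induction X with
  | zero => simp
  | add a b ha hb => simp only [map_add, LinearMap.add_apply, ha, hb]
  | tmul h x =>
    induction n with
    | zero => simp
    | add a b ha hb => simp only [map_add, ha, hb]
    | tmul m y =>
      rw [lact_tmul, lift2_tmul]
      change TensorProduct.assoc k M H H (T.rho (T.ha h m) ⊗ₜ (x * y)) =
        lact T (lift2 t₁ t₂ (Q.comul h) * t₃ x) (TensorProduct.assoc k M H H (T.rho m ⊗ₜ y))
      rw [rho_ha, assoc_lact_tmul]

lemma rhoL_ract (X : A ⊗[k] H) (n : M ⊗[k] H) :
    rhoL T (ract T X n) =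
      ract T (lift2 (star CA (ca k H A) (cu k H A)) (cv k H A) X) (rhoL T n) := by
  induction X with
  | zero => simp
  | add a b ha hb => simp only [map_add, LinearMap.add_apply, ha, hb]
  | tmul h x =>
    induction n with
    | zero => simp
    | add a b ha hb => simp only [map_add, ha, hb]
    | tmul m y =>
      rw [ract_tmul, lift2_tmul]
      change TensorProduct.assoc k M H H (T.rho (T.ra h m) ⊗ₜ (y * x)) =
        ract T (lift2 (ca k H A) (cu k H A) (CA.rho h) * cv k H A x)
          (TensorProduct.assoc k M H H (T.rho m ⊗ₜ y))
      rw [rho_ra, assoc_ract_tmul]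

lemma lift2_inr_inl_inr (R : Type*) [Ring R] [Algebra k R] (X : H ⊗[k] H) :
    lift2 (inr R (inl H (AlgHom.id k H))) (inr R (inr H (AlgHom.id k H))) X = (1 : R) ⊗ₜ X := by
  induction X with
  | zero => simp
  | add a b ha hb => simp only [map_add, tmul_add, ha, hb]
  | tmul h x => simp

lemma comulR_lact (X : H ⊗[k] H) (n : M ⊗[k] H) :
    comulR M Q (lact T X n) = lact T (lift2 t₁ (star (reg Q) t₂ t₃) X) (comulR M Q n) := by
  induction X with
  | zero => simp
  | add a b ha hb => simp only [map_add, LinearMap.add_apply, ha, hb]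
  | tmul h x =>
    induction n with
    | zero => simp
    | add a b ha hb => simp only [map_add, ha, hb]
    | tmul m y =>
      rw [lact_tmul, lift2_tmul]
      change T.ha h m ⊗ₜ Q.comul (x * y) = lact T (t₁ h * lift2 t₂ t₃ (Q.comul x)) (m ⊗ₜ Q.comul y)
      rw [lift2_inr_inl_inr]
      simp

lemma comulR_ract (X : A ⊗[k] H) (n : M ⊗[k] H) :
    comulR M Q (ract T X n) =
      ract T (lift2 (ca k H A) (star (reg Q) (cu k H A) (cv k H A)) X) (comulR M Q n) := by
  induction X with
  | zero => simp
  | add a b ha hb => simp only [map_add, LinearMap.add_apply, ha, hb]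
  | tmul h x =>
    induction n with
    | zero => simp
    | add a b ha hb => simp only [map_add, ha, hb]
    | tmul m y =>
      rw [ract_tmul, lift2_tmul]
      change T.ra h m ⊗ₜ Q.comul (y * x) =
        ract T (ca k H A h * lift2 (cu k H A) (cv k H A) (Q.comul x)) (m ⊗ₜ Q.comul y)
      rw [lift2_inr_inl_inr]
      simp

end Actions
section Contraction

variable {k : Type*} [Field k] {H : Type*} [Ring H] [Algebra k H] {QH : QuasiHopfAlgebra k H}
  {A : Type*} [Ring A] [Algebra k A] {CA : RightComoduleAlgebra QH.toQuasiBialgebra A}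
  {M : Type*} [AddCommGroup M] [Module k M]
  (T : TwoSidedHopfModule QH.toQuasiBialgebra CA M)

local notation "Q" => QH.toQuasiBialgebra
local notation "t₁" => tri1 k H
local notation "t₂" => tri2 k H
local notation "t₃" => tri3 k H

lemma Sinv_mul (x y : H) : QH.Sinv (x * y) = QH.Sinv y * QH.Sinv x := by
  rw [← QH.Sinv_S (QH.Sinv y * QH.Sinv x), QH.S_mul, QH.S_Sinv, QH.S_Sinv]

variable (QH) in
/-- The pairing `u, y ↦ φ(S⁻¹(y) u)`. -/
def spair (φ : Module.Dual k H) : H →ₗ[k] Module.Dual k H :=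
  (((LinearMap.mul k H).compr₂ φ).flip).compl₂ QH.Sinv

@[simp] lemma spair_apply (φ : Module.Dual k H) (u y : H) :
    spair QH φ u y = φ (QH.Sinv y * u) := rfl

/-- The contraction `(u ⊗ v, m ⊗ y) ↦ φ(S⁻¹(y) u) S(v) ≻ m`. -/
def gam1 (φ : Module.Dual k H) : H ⊗[k] H →ₗ[k] M ⊗[k] H →ₗ[k] M :=
  (LinearMap.compRight k (TensorProduct.rid k M).toLinearMap) ∘ₗ
    TensorProduct.homTensorHomMap (RingHom.id k) M H M k ∘ₗ
    TensorProduct.map (T.ha ∘ₗ QH.S) (spair QH φ) ∘ₗ (TensorProduct.comm k H H).toLinearMap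

@[simp] lemma gam1_tmul (φ : Module.Dual k H) (u v : H) (m : M) (y : H) :
    gam1 T φ (u ⊗ₜ v) (m ⊗ₜ y) = φ (QH.Sinv y * u) • T.ha (QH.S v) m := rfl

/-- The contraction
`(u ⊗ v ⊗ w, m ⊗ y ⊗ z) ↦ φ(S⁻¹(z) u) ψ(S⁻¹(y) v) S(w) ≻ m`. -/
def gam2 (φ ψ : Module.Dual k H) : H ⊗[k] (H ⊗[k] H) →ₗ[k] M ⊗[k] (H ⊗[k] H) →ₗ[k] M :=
  (LinearMap.compRight k (TensorProduct.rid k M).toLinearMap) ∘ₗ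
    TensorProduct.homTensorHomMap (RingHom.id k) M (H ⊗[k] H) M k ∘ₗ
    TensorProduct.map (T.ha ∘ₗ QH.S)
      (LinearMap.compRight k (TensorProduct.lid k k).toLinearMap ∘ₗ
        TensorProduct.homTensorHomMap (RingHom.id k) H H k k ∘ₗ
        TensorProduct.map (spair QH ψ) (spair QH φ)) ∘ₗ
    (TensorProduct.assoc k H H H).toLinearMap ∘ₗ
    TensorProduct.map (TensorProduct.comm k H H).toLinearMap LinearMap.id ∘ₗ
    (TensorProduct.comm k H (H ⊗[k] H)).toLinearMap

@[simp] lemma gam2_tmul (φ ψ : Module.Dual k H) (u v w : H) (m : M) (y z : H) :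
    gam2 T φ ψ (u ⊗ₜ (v ⊗ₜ w)) (m ⊗ₜ (y ⊗ₜ z)) =
      (ψ (QH.Sinv y * v) * φ (QH.Sinv z * u)) • T.ha (QH.S w) m := rfl

lemma gam1_lact (φ : Module.Dual k H) (V X : H ⊗[k] H) (n : M ⊗[k] H) :
    gam1 T φ V (lact T (Sflip QH X) n) = gam1 T φ (X * V) n := by
  induction X with
  | zero => simp
  | add a b ha hb => simp only [map_add, add_mul, LinearMap.add_apply, ha, hb]
  | tmul a b =>
    induction V with
    | zero => simp
    | add a b ha hb => simp only [map_add, mul_add, LinearMap.add_apply, ha, hb]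
    | tmul c d =>
      induction n with
      | zero => simp
      | add a b ha hb => simp only [map_add, ha, hb]
      | tmul m y => simp [QH.S_mul, T.ha_mul, Sinv_mul, QH.Sinv_S, mul_assoc]

lemma gam2_lact (φ ψ : Module.Dual k H) (V X : H ⊗[k] (H ⊗[k] H)) (n : M ⊗[k] (H ⊗[k] H)) :
    gam2 T φ ψ V (lact T (Sflip3 QH X) n) = gam2 T φ ψ (X * V) n := by
  induction X with
  | zero => simp
  | add a b ha hb => simp only [map_add, add_mul, LinearMap.add_apply, ha, hb]
  | tmul a X =>
    induction X with
    | zero => simp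
    | add a b ha hb => simp only [map_add, add_mul, tmul_add, LinearMap.add_apply, ha, hb]
    | tmul b c =>
      induction V with
      | zero => simp
      | add a b ha hb => simp only [map_add, mul_add, LinearMap.add_apply, ha, hb]
      | tmul u V =>
        induction V with
        | zero => simp
        | add a b ha hb => simp only [map_add, mul_add, tmul_add, LinearMap.add_apply, ha, hb]
        | tmul v w =>
          induction n with
          | zero => simp
          | add a b ha hb => simp only [map_add, ha, hb]
          | tmul m n =>
            induction n with
            | zero => simp
            | add a b ha hb => simp only [map_add, tmul_add, ha, hb]
            | tmul y z => simp [QH.S_mul, T.ha_mul, Sinv_mul, QH.Sinv_S, mul_assoc]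

lemma ha_gam1 (φ : Module.Dual k H) (h : H) (V : H ⊗[k] H) (n : M ⊗[k] H) :
    T.ha (QH.S h) (gam1 T φ V n) = gam1 T φ (V * (1 ⊗ₜ h)) n := by
  induction V with
  | zero => simp
  | add a b ha hb => simp only [map_add, add_mul, LinearMap.add_apply, ha, hb]
  | tmul c d =>
    induction n with
    | zero => simp
    | add a b ha hb => simp only [map_add, ha, hb]
    | tmul m y => simp [QH.S_mul, T.ha_mul]

lemma gam1_rA (φ : Module.Dual k H) (h : H) (V : H ⊗[k] H) (n : M ⊗[k] H) :
    gam1 T (rA k h φ) V n = gam1 T φ (V * (h ⊗ₜ 1)) n := by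
  induction V with
  | zero => simp
  | add a b ha hb => simp only [map_add, add_mul, LinearMap.add_apply, ha, hb]
  | tmul c d =>
    induction n with
    | zero => simp
    | add a b ha hb => simp only [map_add, ha, hb]
    | tmul m y => simp [rA, mul_assoc]

variable (DT : DrinfeldTwist QH)

lemma gam1_fE_rho_ha (φ : Module.Dual k H) (V : H ⊗[k] H) (Y : A ⊗[k] H) (h : H) (m : M) :
    gam1 T φ V (lact T (fE DT) (ract T Y (T.rho (T.ha (QH.S h) m)))) =
      gam1 T φ (QH.comul h * V) (lact T (fE DT) (ract T Y (T.rho m))) := by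
  rw [rho_ha, ← lact_ract, ← lact_mul, fE_comul_S, lact_mul]
  exact gam1_lact T φ V _ _

lemma gam2_assoc_tmul (φ ψ : Module.Dual k H) (u z : H) (V : H ⊗[k] H) (p : M ⊗[k] H) :
    gam2 T φ ψ (u ⊗ₜ V) (TensorProduct.assoc k M H H (p ⊗ₜ z)) =
      φ (QH.Sinv z * u) • gam1 T ψ V p := by
  induction V with
  | zero => simp
  | add a b ha hb => simp only [map_add, tmul_add, LinearMap.add_apply, ha, hb, smul_add]
  | tmul c d =>
    induction p with
    | zero => simp
    | add a b ha hb => simp only [map_add, add_tmul, ha, hb, smul_add]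
    | tmul m y => simp [smul_smul, mul_comm]

lemma gam1_rho_gam1 (φ ψ : Module.Dual k H) (V W : H ⊗[k] H) (Y : A ⊗[k] H) (n : M ⊗[k] H) :
    gam1 T ψ V (lact T (fE DT) (ract T Y (T.rho (gam1 T φ W n)))) =
      gam2 T φ ψ (lift2 t₁ (star (reg Q) t₂ t₃) W * lift2 t₂ t₃ V)
        (lact T (lift2 t₁ t₂ (fE DT)) (ract T (lift2 (ca k H A) (cu k H A) Y) (rhoL T n))) := by
  induction W with
  | zero => simp
  | add a b ha hb => simp only [map_add, add_mul, LinearMap.add_apply, ha, hb]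
  | tmul w w' =>
    induction n with
    | zero => simp
    | add a b ha hb => simp only [map_add, ha, hb]
    | tmul m z =>
      have h1 : ract T (lift2 (ca k H A) (cu k H A) Y) (rhoL T (m ⊗ₜ z)) =
          TensorProduct.assoc k M H H (ract T Y (T.rho m) ⊗ₜ z) := by
        have := assoc_ract_tmul T Y 1 z (T.rho m)
        rw [map_one, mul_one, mul_one] at this
        exact this.symm
      have h2 := assoc_lact_tmul T (fE DT) 1 z (ract T Y (T.rho m))
      rw [map_one, mul_one, one_mul] at h2
      have h3 : lift2 t₁ (star (reg Q) t₂ t₃) (w ⊗ₜ w') * lift2 t₂ t₃ V =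
          w ⊗ₜ (QH.comul w' * V) := by
        rw [lift2_tmul]
        change t₁ w * lift2 t₂ t₃ (QH.comul w') * _ = _
        rw [lift2_inr_inl_inr, lift2_inr_inl_inr]
        simp
      rw [h1, ← h2, h3, gam2_assoc_tmul, gam1_tmul, ← gam1_fE_rho_ha]
      simp only [map_smul]

lemma fE_comul_gE (y : H) : fE DT * QH.comul y * gE DT = Sflip QH (QH.comul (QH.Sinv y)) := by
  have h := fE_comul_S DT (QH.Sinv y)
  rw [QH.S_Sinv] at h
  rw [h, mul_assoc, fE_mul_gE, mul_one]
  rfl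

/-- The functional `φ ⊗ ψ`. -/
def dual2 (φ ψ : Module.Dual k H) : Module.Dual k (H ⊗[k] H) :=
  (TensorProduct.lid k k).toLinearMap ∘ₗ TensorProduct.map φ ψ

@[simp] lemma dual2_tmul (φ ψ : Module.Dual k H) (x y : H) :
    dual2 φ ψ (x ⊗ₜ y) = φ x * ψ y := rfl

lemma convC_apply (φ ψ : Module.Dual k H) (c c' x x' v : H) :
    convC QH.comul.toLinearMap (lA k c (rA k x φ)) (lA k c' (rA k x' ψ)) v =
      dual2 φ ψ ((c ⊗ₜ c') * QH.comul v * (x ⊗ₜ x')) := by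
  change dual2 (lA k c (rA k x φ)) (lA k c' (rA k x' ψ)) (QH.comul v) = _
  generalize QH.comul v = V
  induction V with
  | zero => simp
  | add a b ha hb => simp only [map_add, add_mul, mul_add, ha, hb]
  | tmul a b => simp [lA, rA]

lemma gam2_Sflip (φ ψ : Module.Dual k H) (V D : H ⊗[k] H) (w : H) (m : M) :
    gam2 T φ ψ (lift2 t₁ t₂ V * t₃ w) (m ⊗ₜ Sflip QH D) =
      dual2 φ ψ (D * V) • T.ha (QH.S w) m := by
  induction V with
  | zero => simp
  | add a b ha hb => simp only [map_add, add_mul, mul_add, LinearMap.add_apply, add_smul, ha, hb]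
  | tmul a b =>
    induction D with
    | zero => simp
    | add a b ha hb => simp only [map_add, add_mul, tmul_add, add_smul, ha, hb]
    | tmul c d => simp [QH.Sinv_S, mul_comm]

lemma gam1_convC (φ ψ : Module.Dual k H) (c c' x x' : H) (W : H ⊗[k] H) (n : M ⊗[k] H) :
    gam1 T (convC QH.comul.toLinearMap (lA k c (rA k x φ)) (lA k c' (rA k x' ψ))) W n =
      gam2 T φ ψ (lift2 (star (reg Q) t₁ t₂) t₃ W * (t₁ x * t₂ x'))
        (lact T (lift2 t₂ t₃ (fE DT))
          (ract T (lift2 (cu k H A) (cv k H A) (gE DT * (QH.S c' ⊗ₜ QH.S c)))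
            (comulR M Q n))) := by
  induction W with
  | zero => simp
  | add a b ha hb => simp only [map_add, add_mul, LinearMap.add_apply, ha, hb]
  | tmul w w' =>
    induction n with
    | zero => simp
    | add a b ha hb => simp only [map_add, ha, hb]
    | tmul m y =>
      have h1 : lact T (lift2 t₂ t₃ (fE DT))
          (ract T (lift2 (cu k H A) (cv k H A) (gE DT * (QH.S c' ⊗ₜ QH.S c)))
            (comulR M Q (m ⊗ₜ y))) =
          m ⊗ₜ Sflip QH ((c ⊗ₜ c') * QH.comul (QH.Sinv y)) := by
        rw [lift2_inr_inl_inr, lift2_inr_inl_inr, Sflip_mul, Sflip_tmul, ← fE_comul_gE DT]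
        change T.ha 1 (T.ra 1 m) ⊗ₜ (fE DT * (QH.comul y * (gE DT * _))) = _
        rw [T.ha_one, T.ra_one]
        simp only [mul_assoc]
      have h2 : lift2 (star (reg Q) t₁ t₂) t₃ (w ⊗ₜ w') * (t₁ x * t₂ x') =
          lift2 t₁ t₂ (QH.comul w * (x ⊗ₜ x')) * t₃ w' := by
        rw [lift2_tmul, map_mul, lift2_tmul, mul_assoc, mul_assoc]
        change lift2 t₁ t₂ (QH.comul w) * _ = _
        congr 1
        simp
      rw [h1, h2, gam2_Sflip, gam1_tmul, convC_apply, map_mul QH.comul]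
      simp only [mul_assoc]

lemma gam1_add_left (φ ψ : Module.Dual k H) (V : H ⊗[k] H) (n : M ⊗[k] H) :
    gam1 T (φ + ψ) V n = gam1 T φ V n + gam1 T ψ V n := by
  induction V with
  | zero => simp
  | add a b ha hb => simp only [map_add, LinearMap.add_apply, ha, hb]; abel
  | tmul c d =>
    induction n with
    | zero => simp
    | add a b ha hb => simp only [map_add, ha, hb]; abel
    | tmul m y => simp [add_smul]

lemma gam1_smul_left (c : k) (φ : Module.Dual k H) (V : H ⊗[k] H) (n : M ⊗[k] H) :
    gam1 T (c • φ) V n = c • gam1 T φ V n := by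
  induction V with
  | zero => simp
  | add a b ha hb => simp only [map_add, LinearMap.add_apply, ha, hb, smul_add]
  | tmul c d =>
    induction n with
    | zero => simp
    | add a b ha hb => simp only [map_add, ha, hb, smul_add]
    | tmul m y => simp [smul_smul]

end Contraction
section Functor

variable {k : Type*} [Field k] {H : Type*} [Ring H] [Algebra k H] {QH : QuasiHopfAlgebra k H}
  {A : Type*} [Ring A] [Algebra k A] {CA : RightComoduleAlgebra QH.toQuasiBialgebra A}
  {M : Type*} [AddCommGroup M] [Module k M]
  (T : TwoSidedHopfModule QH.toQuasiBialgebra CA M)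

local notation "Q" => QH.toQuasiBialgebra
local notation "t₁" => tri1 k H
local notation "t₂" => tri2 k H
local notation "t₃" => tri3 k H

variable (M) in
/-- The map `id ⊗ ε`. -/
def counitR (Q' : QuasiBialgebra k H) : M ⊗[k] H →ₗ[k] M :=
  (TensorProduct.rid k M).toLinearMap ∘ₗ TensorProduct.map LinearMap.id Q'.counit.toLinearMap

@[simp] lemma counitR_tmul (m : M) (y : H) : counitR M Q (m ⊗ₜ y) = QH.counit y • m := rfl

lemma gam1_counit (V : H ⊗[k] H) (n : M ⊗[k] H) :
    gam1 T QH.counit.toLinearMap V n = T.ha (QH.S (epsL QH V)) (counitR M Q n) := by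
  induction V with
  | zero => simp
  | add a b ha hb => simp only [map_add, LinearMap.add_apply, ha, hb]
  | tmul c d =>
    induction n with
    | zero => simp
    | add a b ha hb => simp only [map_add, ha, hb]
    | tmul m y => simp [epsL, eta_apply, ← Algebra.smul_def, counit_Sinv, smul_smul, mul_comm]

lemma counitR_lact (X : H ⊗[k] H) (n : M ⊗[k] H) :
    counitR M Q (lact T X n) = T.ha (epsR QH X) (counitR M Q n) := by
  induction X with
  | zero => simp
  | add a b ha hb => simp only [map_add, LinearMap.add_apply, ha, hb]
  | tmul c d =>
    induction n with
    | zero => simp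
    | add a b ha hb => simp only [map_add, ha, hb]
    | tmul m y => simp [epsR, mul_eta, smul_smul, mul_comm]

lemma counitR_ract (Y : A ⊗[k] H) (n : M ⊗[k] H) :
    counitR M Q (ract T Y n) =
      T.ra (lift2 (AlgHom.id k A) (eta Q A) Y) (counitR M Q n) := by
  induction Y with
  | zero => simp
  | add a b ha hb => simp only [map_add, LinearMap.add_apply, ha, hb]
  | tmul c d =>
    induction n with
    | zero => simp
    | add a b ha hb => simp only [map_add, ha, hb]
    | tmul m y => simp [mul_eta, smul_smul, mul_comm]

variable (CA) in
lemma epsA_pE : lift2 (AlgHom.id k A) (eta Q A) (pE CA) = algebraMap k A (QH.counit QH.bE) := by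
  have h := Psi_eta_mid CA (AlgHom.id k A) (eta Q A)
  rw [Psi_sum] at h
  rw [Algebra.algebraMap_eq_smul_one, ← h, pE, cpsi, map_sum, map_sum, smul_sum]
  refine sum_congr rfl fun j _ => ?_
  simp [coevA, mul_eta, counit_S, smul_smul]
  congr 1; ring

variable (DT : DrinfeldTwist QH)

/-- The right action of `a #̄ φ`, extended linearly. -/
def rbMap : A ⊗[k] Module.Dual k H →ₗ[k] M →ₗ[k] M :=
  TensorProduct.lift (LinearMap.mk₂ k
    (fun a φ => gam1 T φ (uE DT) ∘ₗ lact T (fE DT) ∘ₗ ract T (CA.rho a * pE CA) ∘ₗ T.rho)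
    (fun a b φ => by ext m; simp [add_mul])
    (fun c a φ => by ext m; simp)
    (fun a φ ψ => by ext m; simp [gam1_add_left])
    (fun c a φ => by ext m; simp [gam1_smul_left]))

lemma rbMap_tmul (a : A) (φ : Module.Dual k H) (m : M) :
    rbMap T DT (a ⊗ₜ φ) m =
      gam1 T φ (uE DT) (lact T (fE DT) (ract T (CA.rho a * pE CA) (T.rho m))) := rfl

lemma rbMap_one (m : M) :
    rbMap T DT ((1 : A) ⊗ₜ (QH.counit.toLinearMap : Module.Dual k H)) m = m := by
  rw [rbMap_tmul, map_one, one_mul, gam1_counit, counitR_lact, counitR_ract, epsL_uE, epsR_fE,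
    epsA_pE]
  have h : counitR M Q (T.rho m) = m := T.counit_rho m
  rw [h, QH.S_one, T.ha_one, Algebra.algebraMap_eq_smul_one, Algebra.algebraMap_eq_smul_one]
  simp [T.ha_one, T.ra_one, smul_smul, mul_comm (QH.counit QH.bE), counit_aE_mul_bE]

lemma ha_rbMap_tmul (h : H) (a : A) (φ : Module.Dual k H) (m : M) :
    T.ha (QH.S (QH.S h)) (rbMap T DT (a ⊗ₜ φ) m) = ∑ i ∈ range QH.nD,
      rbMap T DT (a ⊗ₜ rA k (QH.D2 h i) φ) (T.ha (QH.S (QH.S (QH.D1 h i))) m) := by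
  simp only [rbMap_tmul]
  rw [ha_gam1, ← uE_shift, map_sum, LinearMap.sum_apply]
  refine sum_congr rfl fun i _ => ?_
  rw [gam1_fE_rho_ha, gam1_rA]

lemma lact_ract_lact_ract (X X' : H ⊗[k] (H ⊗[k] H)) (Y Y' : A ⊗[k] (H ⊗[k] H))
    (n : M ⊗[k] (H ⊗[k] H)) :
    lact T X (ract T Y (lact T X' (ract T Y' n))) = lact T (X * X') (ract T (Y' * Y) n) := by
  rw [← lact_ract, ← lact_mul, ← ract_mul]

lemma rbMap_rbMap_tmul (a b : A) (φ ψ : Module.Dual k H) (m : M) :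
    rbMap T DT (b ⊗ₜ ψ) (rbMap T DT (a ⊗ₜ φ) m) = ∑ s ∈ range QH.nP,
      ∑ i ∈ range CA.nR, ∑ j ∈ range CA.nQ,
        rbMap T DT ((a * CA.r0 b i * CA.Q1 j) ⊗ₜ convC QH.comul.toLinearMap
          (lA k (CA.r1 b i * CA.Q2 j) (rA k (QH.X2 s) φ)) (lA k (CA.Q3 j) (rA k (QH.X3 s) ψ)))
          (T.ha (QH.S (QH.S (QH.X1 s))) m) := by
  simp only [rbMap_tmul]
  have hc : lift2 t₁ t₂ (fE DT) * lift2 (star (reg Q) t₁ t₂) t₃ (fE DT) * psi Q =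
      Sflip3 QH (psi Q) *
        (lift2 t₂ t₃ (fE DT) * lift2 t₁ (star (reg Q) t₂ t₃) (fE DT)) := by
    rw [twist_cocycle, mul_assoc, phi_mul_psi, mul_one]
  rw [gam1_rho_gam1, rhoL_lact, rhoL_ract, lact_ract_lact_ract, pE_cocycle, ract_mul,
    ract_cpsi_rhoL, ← lact_ract, ← lact_mul, hc, lact_mul, gam2_lact, uE_cocycle, map_sum,
    LinearMap.sum_apply]
  refine sum_congr rfl fun s _ => ?_
  simp only [map_sum, LinearMap.sum_apply]
  refine sum_congr rfl fun i _ => sum_congr rfl fun j _ => ?_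
  rw [gam1_fE_rho_ha, gam1_convC T DT, comulR_lact, comulR_ract, lact_ract_lact_ract]

lemma vE_eq_sum : vE QH = ∑ s ∈ range QH.nP,
    (QH.S (QH.X2 s) * (QH.aE * QH.X3 s)) ⊗ₜ QH.S (QH.X1 s) := by
  rw [vE, Phi_sum, map_sum]
  exact sum_congr rfl fun s _ => by simp [evS, reg]

lemma gam1_lact_ract_tmul (φ : Module.Dual k H) (a : A) (g g' f f' r x y z : H) (n : M ⊗[k] H) :
    gam1 T φ ((g ⊗ₜ g') * ((QH.S y * (QH.aE * z)) ⊗ₜ QH.S x))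
        (lact T (f ⊗ₜ f') (ract T (a ⊗ₜ r) n)) =
      TensorProduct.rid k M (TensorProduct.map (T.ra a ∘ₗ T.ha (QH.S (g' * QH.S x) * f))
        (φ ∘ₗ QH.Sinv ∘ₗ LinearMap.mulRight k r ∘ₗ
          LinearMap.mulLeft k (QH.S (g * QH.S (QH.Sinv (QH.aE * z) * y)) * f')) n) := by
  induction n with
  | zero => simp
  | add a b ha hb => simp only [map_add, ha, hb]
  | tmul m w => simp [T.ha_mul, T.ha_ra, QH.S_mul, QH.S_Sinv, Sinv_mul, QH.Sinv_S, mul_assoc]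

lemma rbMap_formula (a : A) (φ : Module.Dual k H) (m : M) :
    rbMap T DT (a ⊗ₜ φ) m =
      ∑ t' ∈ range DT.nf, ∑ t ∈ range DT.nf, ∑ s ∈ range QH.nP,
        ∑ r ∈ range CA.nR, ∑ j ∈ range CA.nQ,
        TensorProduct.rid k M (TensorProduct.map
          (T.ra (CA.r0 a r * CA.Q1 j) ∘ₗ T.ha (QH.S (DT.g2 t * QH.S (QH.X1 s)) * DT.f1 t'))
          (φ ∘ₗ QH.Sinv ∘ₗ
            LinearMap.mulRight k (CA.r1 a r * (CA.Q2 j * QH.bE * QH.S (CA.Q3 j))) ∘ₗ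
            LinearMap.mulLeft k
              (QH.S (DT.g1 t * QH.S (QH.Sinv (QH.aE * QH.X3 s) * QH.X2 s)) * DT.f2 t'))
          (T.rho m)) := by
  have hp : CA.rho a * pE CA = ∑ r ∈ range CA.nR, ∑ j ∈ range CA.nQ,
      (CA.r0 a r * CA.Q1 j) ⊗ₜ (CA.r1 a r * (CA.Q2 j * QH.bE * QH.S (CA.Q3 j))) := by
    rw [CA.hrho, pE, cpsi, map_sum, sum_mul_sum]
    simp [coevA, mul_assoc]
  rw [rbMap_tmul, hp, uE, gE, vE_eq_sum, fE, sum_mul_sum, map_sum (lact T), LinearMap.sum_apply,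
    map_sum]
  refine sum_congr rfl fun t' _ => ?_
  rw [map_sum (gam1 T φ), LinearMap.sum_apply]
  refine sum_congr rfl fun t _ => ?_
  rw [map_sum (gam1 T φ), LinearMap.sum_apply]
  refine sum_congr rfl fun s _ => ?_
  simp only [map_sum, LinearMap.sum_apply, gam1_lact_ract_tmul]

end Functor
end QuasiHopf

namespace QuasiHopf
section Main

variable {k : Type*} [Field k] {H : Type*} [Ring H] [Algebra k H] {QH : QuasiHopfAlgebra k H}
  {A : Type*} [Ring A] [Algebra k A] {CA : RightComoduleAlgebra QH.toQuasiBialgebra A}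
  {MA : LeftModuleAlgebra QH.toQuasiBialgebra (A ⊗[k] Module.Dual k H)}
  {M : Type*} [AddCommGroup M] [Module k M]

/-- The relative Hopf module attached to a two-sided Hopf module. -/
def toRelHopfModule (DT : DrinfeldTwist QH) (hMA : IsQuasiSmash QH.toQuasiBialgebra CA MA)
    (T : TwoSidedHopfModule QH.toQuasiBialgebra CA M) :
    RelHopfModule QH.toQuasiBialgebra MA M where
  hb := T.ha ∘ₗ QH.S ∘ₗ QH.S
  hb_one m := by simp [QH.S_one, T.ha_one]
  hb_mul g h m := by simp [QH.S_mul, T.ha_mul]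
  rb := rbMap T DT
  rb_one m := by rw [hMA.2.1, rbMap_one]
  rb_assoc m u v := by
    induction u with
    | zero => simp
    | add x y hx hy =>
      simp only [map_add, LinearMap.add_apply, hx, hy, sum_add_distrib]
    | tmul a φ =>
      induction v with
      | zero => simp
      | add x y hx hy =>
        simp only [map_add, LinearMap.add_apply, hx, hy, sum_add_distrib]
      | tmul b ψ =>
        rw [rbMap_rbMap_tmul]
        refine sum_congr rfl fun s _ => ?_
        rw [hMA.2.2, hMA.2.2, hMA.1]
        simp only [map_sum, LinearMap.sum_apply, LinearMap.comp_apply]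
  hb_rb h u m := by
    induction u with
    | zero => simp
    | add x y hx hy =>
      simp only [map_add, LinearMap.add_apply, hx, hy, sum_add_distrib]
    | tmul a φ =>
      simp only [hMA.2.2]
      exact ha_rbMap_tmul T DT h a φ m

lemma isFImage_toRelHopfModule (DT : DrinfeldTwist QH)
    (hMA : IsQuasiSmash QH.toQuasiBialgebra CA MA)
    (T : TwoSidedHopfModule QH.toQuasiBialgebra CA M) :
    IsFImage DT T (toRelHopfModule DT hMA T) :=
  ⟨fun _ _ => rfl, rbMap_formula T DT⟩

lemma map_rid_map {M' : Type*} [AddCommGroup M'] [Module k M'] (g : M →ₗ[k] M')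
    {p : M →ₗ[k] M} {p' : M' →ₗ[k] M'} (hp : ∀ m, g (p m) = p' (g m)) (φ : Module.Dual k H)
    (n : M ⊗[k] H) :
    g (TensorProduct.rid k M (TensorProduct.map p φ n)) =
      TensorProduct.rid k M' (TensorProduct.map p' φ (TensorProduct.map g LinearMap.id n)) := by
  induction n with
  | zero => simp
  | add a b ha hb => simp only [map_add, ha, hb]
  | tmul m w => simp [hp]

lemma IsFImage.map_rb {DT : DrinfeldTwist QH} {M' : Type*} [AddCommGroup M'] [Module k M']
    {T : TwoSidedHopfModule QH.toQuasiBialgebra CA M}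
    {T' : TwoSidedHopfModule QH.toQuasiBialgebra CA M'}
    {R : RelHopfModule QH.toQuasiBialgebra MA M} {R' : RelHopfModule QH.toQuasiBialgebra MA M'}
    (hR : IsFImage DT T R) (hR' : IsFImage DT T' R') (g : M →ₗ[k] M')
    (hha : ∀ h m, g (T.ha h m) = T'.ha h (g m)) (hra : ∀ a m, g (T.ra a m) = T'.ra a (g m))
    (hrho : ∀ m, T'.rho (g m) = TensorProduct.map g LinearMap.id (T.rho m))
    (u : A ⊗[k] Module.Dual k H) (m : M) : g (R.rb u m) = R'.rb u (g m) := by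
  induction u with
  | zero => simp
  | add x y hx hy => simp only [map_add, LinearMap.add_apply, hx, hy]
  | tmul a φ =>
    rw [hR.2, hR'.2]
    simp only [map_sum, hrho]
    refine sum_congr rfl fun t' _ => sum_congr rfl fun t _ => sum_congr rfl fun s _ =>
      sum_congr rfl fun r _ => sum_congr rfl fun j _ => ?_
    exact map_rid_map g (fun m => by simp [hha, hra]) _ _

end Main
end QuasiHopf

/-- Every two-sided `(𝔄,H)`-Hopf module becomes a right
`(H^*, 𝔄 #̄ H^*)`-Hopf module via `h • m = S²(h) ≻ m` and the stated action of
`𝔄 #̄ H^*`, and every morphism of two-sided Hopf modules is a morphism of the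
corresponding relative Hopf modules: this defines a functor
`F : _H𝓜^H_𝔄 → 𝓜^{H^*}_{𝔄 #̄ H^*}` which is the identity on underlying maps. -/
theorem functor_F_two_sided_to_relative
    {k : Type*} [Field k] {H : Type*} [Ring H] [Algebra k H] [FiniteDimensional k H]
    (QH : QuasiHopfAlgebra k H) (DT : DrinfeldTwist QH)
    {A : Type*} [Ring A] [Algebra k A]
    (CA : RightComoduleAlgebra QH.toQuasiBialgebra A)
    (MA : LeftModuleAlgebra QH.toQuasiBialgebra (A ⊗[k] Module.Dual k H))
    (hMA : IsQuasiSmash QH.toQuasiBialgebra CA MA)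
    {M : Type*} [AddCommGroup M] [Module k M]
    (T : TwoSidedHopfModule QH.toQuasiBialgebra CA M) :
    (∃ R : RelHopfModule QH.toQuasiBialgebra MA M, IsFImage DT T R) ∧
    (∀ (M' : Type*) [AddCommGroup M'] [Module k M']
      (T' : TwoSidedHopfModule QH.toQuasiBialgebra CA M')
      (R : RelHopfModule QH.toQuasiBialgebra MA M)
      (R' : RelHopfModule QH.toQuasiBialgebra MA M'),
      IsFImage DT T R → IsFImage DT T' R' →
      ∀ g : M →ₗ[k] M',
        (∀ (h : H) (m : M), g (T.ha h m) = T'.ha h (g m)) →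
        (∀ (a : A) (m : M), g (T.ra a m) = T'.ra a (g m)) →
        (∀ m : M, T'.rho (g m) = (TensorProduct.map g LinearMap.id) (T.rho m)) →
        (∀ (h : H) (m : M), g (R.hb h m) = R'.hb h (g m)) ∧
        (∀ (u : A ⊗[k] Module.Dual k H) (m : M), g (R.rb u m) = R'.rb u (g m))) := by
  refine ⟨⟨QuasiHopf.toRelHopfModule DT hMA T, QuasiHopf.isFImage_toRelHopfModule DT hMA T⟩, ?_⟩
  intro M' _ _ T' R R' hR hR' g hha hra hrho
  refine ⟨fun h m => ?_, QuasiHopf.IsFImage.map_rb hR hR' g hha hra hrho⟩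
  rw [hR.1, hR'.1, hha]
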